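/- arXiv:1910.02278 — 8 statements merged into one kernel-verified Lean document; each statement's English description precedes it below -/
import Mathlib

section
/- Let q = p^s be an odd prime power, F a finite field with q^6 elements, and h ∈ F with h^(q^3+1) = −1. Then the q-polynomial f_h(x) = h^(q−1)·x^q − h^(q^2−1)·x^(q^2) + x^(q^4) + x^(q^5) is scattered: for all nonzero x, y ∈ F with y·f_h(x) = x·f_h(y) there exists λ ∈ F with λ^q = λ and y = λ·x. -/
section Scattered

variable {F : Type} [Field F] (s : F →+* F)

/-- Decomposition of `x` into the two eigen-components. -/
theorem sc_decomp (s6 : ∀ x, s (s (s (s (s (s x))))) = x) (h : F) (h0 : h ≠ 0)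
    (h3 : s (s (s h)) = -1 / h) (hd : h + s h ≠ 0) (x : F) :
    ∃ x1 x2, x = x1 + x2 ∧ s (s (s x1)) = h * s (s h) * x1 ∧
      s (s (s x2)) = -(h * s h) * x2 := by
  have h1 : s h ≠ 0 := (map_ne_zero s).2 h0
  have h2 : s (s h) ≠ 0 := (map_ne_zero s).2 h1
  have hd1 : s h + s (s h) ≠ 0 := by
    rw [← map_add]; exact (map_ne_zero s).2 hd
  have hd2 : s (s h) + s h ≠ 0 := by rwa [add_comm]
  refine ⟨(s (s (s x)) + h * s h * x) / (h * (s h + s (s h))),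
    (h * s (s h) * x - s (s (s x))) / (h * (s h + s (s h))), ?_, ?_, ?_⟩
  · field_simp
    ring
  · simp only [map_div₀, map_mul, map_add, h3, s6, map_neg, map_one]
    have e : -1 / s h + -1 / s (s h) = - (s h + s (s h)) / (s h * s (s h)) := by
      field_simp; ring
    rw [e]
    field_simp
    ring
  · simp only [map_div₀, map_mul, map_add, map_sub, h3, s6, map_neg, map_one]
    have e : -1 / s h + -1 / s (s h) = - (s h + s (s h)) / (s h * s (s h)) := by
      field_simp; ring
    rw [e]
    field_simp
    ring

theorem sc_form (h : F) (h0 : h ≠ 0)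
    (h3 : s (s (s h)) = -1 / h) (x1 x2 : F)
    (e1 : s (s (s x1)) = h * s (s h) * x1) (e2 : s (s (s x2)) = -(h * s h) * x2) :
    s h * (s h * s (x1 + x2) - s (s h) * s (s (x1 + x2)) +
      h * (s (s (s (s (x1 + x2)))) + s (s (s (s (s (x1 + x2))))))) =
    s h ^ 2 * (1 - h * s (s h)) * s x2 - s (s h) * (h + s h) * s (s x1) := by
  have h1 : s h ≠ 0 := (map_ne_zero s).2 h0
  have h2 : s (s h) ≠ 0 := (map_ne_zero s).2 h1
  simp only [map_add, e1, e2, map_mul, map_neg, h3, map_div₀, map_one]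
  field_simp
  ring

theorem sc_main (s6 : ∀ x, s (s (s (s (s (s x))))) = x) (two : (2 : F) ≠ 0)
    (h : F) (h0 : h ≠ 0)
    (h3 : s (s (s h)) = -1 / h) (hd : h + s h ≠ 0) (x1 x2 y1 y2 : F)
    (ex1 : s (s (s x1)) = h * s (s h) * x1) (ex2 : s (s (s x2)) = -(h * s h) * x2)
    (ey1 : s (s (s y1)) = h * s (s h) * y1) (ey2 : s (s (s y2)) = -(h * s h) * y2)
    (E : (y1 + y2) * (s h ^ 2 * (1 - h * s (s h)) * s x2 - s (s h) * (h + s h) * s (s x1)) =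
      (x1 + x2) * (s h ^ 2 * (1 - h * s (s h)) * s y2 - s (s h) * (h + s h) * s (s y1))) :
    y1 * s x2 = x1 * s y2 ∧ y2 * s (s x1) = x2 * s (s y1) ∧
    s h ^ 2 * (1 - h * s (s h)) * (y2 * s x2 - x2 * s y2) =
      s (s h) * (h + s h) * (y1 * s (s x1) - x1 * s (s y1)) := by
  have h1 : s h ≠ 0 := (map_ne_zero s).2 h0
  have h2 : s (s h) ≠ 0 := (map_ne_zero s).2 h1
  have hd1 : s h + s (s h) ≠ 0 := by
    rw [← map_add]; exact (map_ne_zero s).2 hd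
  have hd2 : s (s (h + s h)) ≠ 0 := (map_ne_zero s).2 ((map_ne_zero s).2 hd)
  have ed2 : s (s (h + s h)) = -(1 - h * s (s h)) / h := by
    simp only [map_add, h3]; field_simp; ring
  have hk : 1 - h * s (s h) ≠ 0 := by
    intro hc; rw [ed2, hc] at hd2; simp at hd2
  have E' := congrArg (fun t => s (s (s t))) E
  simp only [map_mul, map_add, map_sub, map_neg, map_div₀, map_one, map_pow, h3, ex1, ex2, ey1, ey2] at E'
  have key : (s h + s (s h)) * (s (s h) * (s h ^ 2 * (1 - h * s (s h))) * (y1 * s x2 - x1 * s y2) -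
      s h * (s (s h) * (h + s h)) * (y2 * s (s x1) - x2 * s (s y1))) = 0 := by
    rw [← sub_eq_zero] at E E'
    have hc := congrArg₂ (fun u v => s h ^ 3 * s (s h) * u + s h * s (s h) * v) E' E
    simp only [mul_zero, add_zero] at hc
    rw [← hc]
    clear hc E E'
    field_simp
    ring
  have key2 := (mul_eq_zero.1 key).resolve_left hd1
  set Z := y1 * s x2 - x1 * s y2 with hZ
  have hV : s (s Z) = h * s h * (y2 * s (s x1) - x2 * s (s y1)) := by
    simp only [hZ, map_mul, map_sub, ex2, ey2]; ring
  have key3 : h * s h ^ 2 * (1 - h * s (s h)) * Z = (h + s h) * s (s Z) := by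
    rw [hV]
    apply mul_left_cancel₀ (mul_ne_zero h2 h1)
    linear_combination (h * s h) * key2
  have hW : ∃ W, Z = (h + s h) * W := ⟨Z / (h + s h), by field_simp⟩
  obtain ⟨W, hW⟩ := hW
  have W1 : s (s W) = -(h * s h) ^ 2 * W := by
    have := key3
    rw [hW] at this
    rw [map_mul, map_mul, ed2] at this
    have h5 : (h + s h) * (1 - h * s (s h)) ≠ 0 := mul_ne_zero hd hk
    apply mul_left_cancel₀ h5
    field_simp at this
    linear_combination ((h + s h) * (1 - h * s (s h))) * this
  have W0 : W = 0 := by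
    have h6 := s6 W
    simp only [W1, map_mul, map_neg, map_pow, h3, map_div₀, map_one] at h6
    field_simp at h6
    have : 2 * W = 0 := by linear_combination -h6
    exact (mul_eq_zero.1 this).resolve_left two
  have Z0 : Z = 0 := by rw [hW, W0, mul_zero]
  have V0 : y2 * s (s x1) - x2 * s (s y1) = 0 := by
    rw [Z0] at hV
    simp only [map_zero] at hV
    exact (mul_eq_zero.1 hV.symm).resolve_left (mul_ne_zero h0 h1)
  refine ⟨sub_eq_zero.1 (hZ ▸ Z0), sub_eq_zero.1 V0, ?_⟩
  linear_combination E - s h ^ 2 * (1 - h * s (s h)) * Z0 + s (s h) * (h + s h) * V0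

/-- The norm to the subfield fixed by `s²`. -/
def scN (z : F) : F := z * s (s z) * s (s (s (s z)))

theorem sc_contra (s6 : ∀ x, s (s (s (s (s (s x))))) = x) (two : (2 : F) ≠ 0)
    (h : F) (h0 : h ≠ 0)
    (h3 : s (s (s h)) = -1 / h) (hd : h + s h ≠ 0) (x1 x2 : F) (hx1 : x1 ≠ 0)
    (ex1 : s (s (s x1)) = h * s (s h) * x1) (ex2 : s (s (s x2)) = -(h * s h) * x2)
    (E : s (s h) * (h + s h) * (x1 * s (s x1)) = h * s h ^ 2 * s (s (h + s h)) * (x2 * s x2)) :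
    False := by
  have h1 : s h ≠ 0 := (map_ne_zero s).2 h0
  have h2 : s (s h) ≠ 0 := (map_ne_zero s).2 h1
  have Nmul : ∀ a b, scN s (a * b) = scN s a * scN s b := by
    intro a b; simp only [scN, map_mul]; ring
  have Nss : ∀ a, scN s (s (s a)) = scN s a := by
    intro a; simp only [scN, s6]; ring
  have Ns : ∀ a, scN s (s a) = s (scN s a) := by
    intro a; simp only [scN, map_mul]
  have Nne : ∀ a, a ≠ 0 → scN s a ≠ 0 := by
    intro a ha; simp [scN, ha]
  have Nneg : ∀ a, scN s (-a) = - scN s a := by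
    intro a; simp only [scN, map_neg]; ring
  have E' := congrArg (scN s) E
  simp only [pow_two, Nmul, Nss, Ns] at E'
  have q1 := congrArg (scN s) ex1
  have q2 := congrArg (scN s) ex2
  have q3 : scN s h * s (scN s h) = -1 := by
    simp only [scN, map_mul, h3, map_div₀, map_neg, map_one]
    field_simp
  rw [Nss, Ns] at q1 q2
  simp only [Nmul, Nss, Ns, Nneg] at q1 q2
  have n0 := Nne h h0
  have nd := Nne _ hd
  have nx := Nne _ hx1
  generalize scN s (h + s h) = D at *
  generalize scN s x1 = X at *
  generalize scN s x2 = Y at *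
  generalize scN s h = m at *
  have q2' : s Y = Y := by rw [q2, q3]; ring
  rw [q2'] at E'
  have E2 : X ^ 2 = (s m * Y) ^ 2 := by
    apply mul_left_cancel₀ (mul_ne_zero n0 nd)
    linear_combination E'
  have fin : ∀ e : F, s e = e → X = e * (s m * Y) → s (s m) = m → False := by
    intro e he hX hm
    have := congrArg s hX
    rw [map_mul, map_mul, he, q2', hm, q1] at this
    have h7 : m * m * X = - (m * m * X) := by
      calc m * m * X = e * (m * Y) := this
        _ = - (m * m * (e * (s m * Y))) := by linear_combination (e * m * Y) * q3
        _ = _ := by rw [← hX]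
    have h8 : 2 * (m * m * X) = 0 := by linear_combination h7
    have := (mul_eq_zero.1 h8).resolve_left two
    simp [n0, nx] at this
  have hm : s (s m) = m := by
    have := congrArg s q3
    rw [map_mul, map_neg, map_one, ← q3, mul_comm m] at this
    exact mul_left_cancel₀ ((map_ne_zero s).2 n0) this
  rcases sq_eq_sq_iff_eq_or_eq_neg.1 E2 with e | e
  · exact fin 1 (map_one s) (by rw [e]; ring) hm
  · exact fin (-1) (by simp) (by rw [e]; ring) hm

theorem sc_abs (s6 : ∀ x, s (s (s (s (s (s x))))) = x) (two : (2 : F) ≠ 0)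
    (h : F) (hh : s (s (s h)) * h = -1) (x y : F) (hx : x ≠ 0)
    (E : y * (s h * s x - s (s h) * s (s x) + h * (s (s (s (s x))) + s (s (s (s (s x)))))) =
      x * (s h * s y - s (s h) * s (s y) + h * (s (s (s (s y))) + s (s (s (s (s y))))))) :
    ∃ l, s l = l ∧ y = l * x := by
  have h0 : h ≠ 0 := by rintro rfl; simp at hh
  have h1 : s h ≠ 0 := (map_ne_zero s).2 h0
  have h2 : s (s h) ≠ 0 := (map_ne_zero s).2 h1
  have h3 : s (s (s h)) = -1 / h := by rw [eq_div_iff h0, hh]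
  have hd : h + s h ≠ 0 := by
    intro hc
    have e : s h = -h := by linear_combination hc
    have e2 : (h - 1) * (h + 1) = 0 := by
      simp only [e, map_neg] at hh
      linear_combination -hh
    rcases mul_eq_zero.1 e2 with e3 | e3
    · have : h = 1 := by linear_combination e3
      subst this
      simp only [map_one] at hc
      exact two (by linear_combination hc)
    · have : h = -1 := by linear_combination e3
      subst this
      simp only [map_one, map_neg] at hc
      exact two (by linear_combination -hc)
  have hd2 : s (s (h + s h)) ≠ 0 := (map_ne_zero s).2 ((map_ne_zero s).2 hd)
  have ed2 : 1 - h * s (s h) = - (h * s (s (h + s h))) := by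
    simp only [map_add, h3]; field_simp; ring
  obtain ⟨x1, x2, rfl, ex1, ex2⟩ := sc_decomp s s6 h h0 h3 hd x
  obtain ⟨y1, y2, rfl, ey1, ey2⟩ := sc_decomp s s6 h h0 h3 hd y
  have fx := sc_form s h h0 h3 x1 x2 ex1 ex2
  have fy := sc_form s h h0 h3 y1 y2 ey1 ey2
  obtain ⟨A1, A2, A3⟩ := sc_main s s6 two h h0 h3 hd x1 x2 y1 y2 ex1 ex2 ey1 ey2 (by
    rw [← fx, ← fy]
    linear_combination s h * E)
  rw [ed2] at A3
  by_cases c1 : x1 = 0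
  · subst c1
    have c2 : x2 ≠ 0 := by simpa using hx
    have sc2 : s x2 ≠ 0 := (map_ne_zero s).2 c2
    have y0 : y1 = 0 := by simpa [c2] using A1
    subst y0
    refine ⟨y2 / x2, ?_, by field_simp; ring⟩
    simp only [map_zero, mul_zero, sub_zero] at A3
    have : y2 * s x2 - x2 * s y2 = 0 := by
      refine (mul_eq_zero.1 A3).resolve_left ?_
      exact mul_ne_zero (pow_ne_zero _ h1) (neg_ne_zero.2 (mul_ne_zero h0 hd2))
    rw [map_div₀, div_eq_div_iff sc2 c2]
    linear_combination -this
  by_cases c2 : x2 = 0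
  · subst c2
    have sc1 : s (s x1) ≠ 0 := (map_ne_zero s).2 ((map_ne_zero s).2 c1)
    have y0 : y2 = 0 := by simpa [c1] using A2
    subst y0
    refine ⟨y1 / x1, ?_, by field_simp; ring⟩
    simp only [map_zero, mul_zero, sub_zero] at A3
    have : y1 * s (s x1) - x1 * s (s y1) = 0 :=
      (mul_eq_zero.1 A3.symm).resolve_left (mul_ne_zero h2 hd)
    have r2 : s (s (y1 / x1)) = y1 / x1 := by
      rw [map_div₀, map_div₀, div_eq_div_iff sc1 c1]
      linear_combination -this
    have r3 : s (s (s (y1 / x1))) = y1 / x1 := by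
      rw [map_div₀, map_div₀, map_div₀, ex1, ey1]
      field_simp
    rwa [r2] at r3
  have sc2 : s x2 ≠ 0 := (map_ne_zero s).2 c2
  obtain ⟨r, rfl⟩ : ∃ r, y2 = r * x2 := ⟨y2 / x2, by field_simp⟩
  have r3 : s (s (s r)) = r := by
    rw [map_mul, map_mul, map_mul, ex2] at ey2
    have : -(h * s h) * x2 ≠ 0 := mul_ne_zero (neg_ne_zero.2 (mul_ne_zero h0 h1)) c2
    apply mul_right_cancel₀ this
    linear_combination ey2
  have hy1 : y1 = s r * x1 := by
    apply mul_right_cancel₀ sc2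
    rw [A1, map_mul]; ring
  subst hy1
  by_cases hr : s r = r
  · exact ⟨r, hr, by rw [hr]; ring⟩
  exfalso
  simp only [map_mul, r3] at A3
  refine sc_contra s s6 two h h0 h3 hd x1 x2 c1 ex1 ex2 ?_
  have : s r - r ≠ 0 := sub_ne_zero.2 hr
  apply mul_left_cancel₀ this
  linear_combination -A3

end Scattered

/-- Let `q = p^s` be an odd prime power, `F` a finite field with `q^6`
elements, and `h ∈ F` with `h^(q^3+1) = −1`. Then the `q`-polynomial
`f_h(x) = h^(q−1)·x^q − h^(q^2−1)·x^(q^2) + x^(q^4) + x^(q^5)` is scattered. -/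
theorem stmt0 (p s q : ℕ) (hp : p.Prime) (hs : 0 < s) (hq : q = p ^ s) (hodd : Odd q)
    (F : Type) [Field F] [Fintype F] (hF : Fintype.card F = q ^ 6)
    (h : F) (hh : h ^ (q ^ 3 + 1) = -1) :
    ∀ x y : F, x ≠ 0 → y ≠ 0 →
      y * (h ^ (q - 1) * x ^ q - h ^ (q ^ 2 - 1) * x ^ (q ^ 2) + x ^ (q ^ 4) + x ^ (q ^ 5)) =
        x * (h ^ (q - 1) * y ^ q - h ^ (q ^ 2 - 1) * y ^ (q ^ 2) + y ^ (q ^ 4) + y ^ (q ^ 5)) →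
      ∃ l : F, l ^ q = l ∧ y = l * x := by
  intro x y hx hy E
  haveI : Fact p.Prime := ⟨hp⟩
  have hcard : Fintype.card F = p ^ (s * 6) := by rw [hF, hq, pow_mul]
  haveI : CharP F p := by
    obtain ⟨n, hpr, hc⟩ := FiniteField.card F (ringChar F)
    have : ringChar F = p := by
      have d : ringChar F ∣ p ^ (s * 6) := by
        rw [← hcard, hc]; exact dvd_pow_self _ n.ne_zero
      exact (Nat.prime_dvd_prime_iff_eq hpr hp).1 (hpr.dvd_of_dvd_pow d)
    rw [← this]; infer_instance
  have hq0 : 0 < q := hodd.pos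
  let σ : F →+* F := iterateFrobenius F p s
  have hσ : ∀ z, σ z = z ^ q := fun z => by rw [hq]; exact iterateFrobenius_def p s z
  have two : (2 : F) ≠ 0 := by
    intro h2
    have : p ∣ 2 := (CharP.cast_eq_zero_iff F p 2).1 (by exact_mod_cast h2)
    have p2 : p = 2 := (Nat.prime_dvd_prime_iff_eq hp Nat.prime_two).1 this
    rw [hq, p2] at hodd
    exact absurd hodd (by simp [Nat.even_pow, hs.ne'])
  have s2 : ∀ z, σ (σ z) = z ^ (q ^ 2) := fun z => by rw [hσ, hσ]; ring
  have s3 : ∀ z, σ (σ (σ z)) = z ^ (q ^ 3) := fun z => by rw [s2, hσ]; ring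
  have s4 : ∀ z, σ (σ (σ (σ z))) = z ^ (q ^ 4) := fun z => by rw [s3, hσ]; ring
  have s5 : ∀ z, σ (σ (σ (σ (σ z)))) = z ^ (q ^ 5) := fun z => by rw [s4, hσ]; ring
  have s6 : ∀ z, σ (σ (σ (σ (σ (σ z))))) = z := fun z => by
    have : σ (σ (σ (σ (σ (σ z))))) = z ^ (q ^ 6) := by rw [s5, hσ]; ring
    rw [this, ← hF, FiniteField.pow_card]
  have k1 : h * h ^ (q - 1) = h ^ q := mul_pow_sub_one hq0.ne' h
  have k2 : h * h ^ (q ^ 2 - 1) = h ^ (q ^ 2) := mul_pow_sub_one (pow_pos hq0 2).ne' h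
  obtain ⟨l, hl, hyl⟩ := sc_abs σ s6 two h (by rw [s3, ← pow_succ, hh]) x y hx (by
    rw [s5 x, s5 y, s4 x, s4 y, s2 x, s2 y, s2 h, hσ x, hσ y, hσ h]
    rw [← k1, ← k2]
    linear_combination h * E)
  exact ⟨l, by rw [← hσ, hl], hyl⟩
end

section
/- Let q be a prime power and F a finite field with q^6 elements, and define f : F → F by f(x) = x^q − x^(q^2) + x^(q^4) + x^(q^5). Then f is scattered if and only if q ≡ 1 (mod 4). -/
/-- A ring endomorphism given by the `q`-th power. -/
theorem exists_phi (q : ℕ) (hq : IsPrimePow q)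
    (F : Type) [Field F] [Fintype F] (hF : Fintype.card F = q ^ 6) :
    (∃ φ : F →+* F, ∀ x, φ x = x ^ q) ∧ ((2 : F) = 0 ↔ q % 2 = 0) := by
  obtain ⟨p, k, hp, hk, rfl⟩ := hq
  have hp := hp.nat_prime
  obtain ⟨r, hr⟩ := CharP.exists F
  obtain ⟨n, hrp, hn⟩ := FiniteField.card F r
  have hrq : r = p := by
    have h1 : r ∣ (p ^ k) ^ 6 := by
      rw [← hF, hn]; exact dvd_pow_self r n.pos.ne'
    exact (Nat.prime_dvd_prime_iff_eq hrp hp).1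
      (hrp.dvd_of_dvd_pow (hrp.dvd_of_dvd_pow h1))
  subst hrq
  haveI : Fact r.Prime := ⟨hrp⟩
  refine ⟨⟨iterateFrobenius F r k, fun x => iterateFrobenius_def r k x⟩, ?_⟩
  have h2 := CharP.cast_eq_zero_iff F r 2
  push_cast at h2
  rw [h2, ← Nat.dvd_iff_mod_eq_zero, Nat.prime_dvd_prime_iff_eq hrp Nat.prime_two]
  constructor
  · rintro rfl; exact dvd_pow_self 2 hk.ne'
  · intro h
    exact ((Nat.prime_dvd_prime_iff_eq Nat.prime_two hrp).1 (Nat.prime_two.dvd_of_dvd_pow h)).symm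

/-- An element of the cubic subfield outside the base field. -/
theorem exists_lam (q : ℕ) (h2 : 2 ≤ q)
    (F : Type) [Field F] [Fintype F] (hF : Fintype.card F = q ^ 6) :
    ∃ l : F, l ≠ 0 ∧ l ^ (q ^ 3) = l ∧ l ^ q ≠ l := by
  obtain ⟨g, hg⟩ := IsCyclic.exists_generator (α := Fˣ)
  have ho : orderOf g = q ^ 6 - 1 := by
    rw [orderOf_eq_card_of_forall_mem_zpowers hg, Nat.card_units, Nat.card_eq_fintype_card, hF]
  refine ⟨(g : F) ^ (q ^ 3 + 1), pow_ne_zero _ g.ne_zero, ?_, ?_⟩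
  · have h6 : (g : F) ^ (q ^ 6) = g := by rw [← hF]; exact FiniteField.pow_card _
    rw [← pow_mul, show (q ^ 3 + 1) * q ^ 3 = q ^ 6 + q ^ 3 by ring, pow_add, h6]
    ring
  · intro h
    have h1 : g ^ ((q ^ 3 + 1) * (q - 1)) = 1 := by
      have h3 : (g ^ (q ^ 3 + 1)) ^ q = g ^ (q ^ 3 + 1) := by
        ext; push_cast; exact h
      rw [pow_mul]
      have h4 : (g ^ (q ^ 3 + 1)) ^ (q - 1) * g ^ (q ^ 3 + 1) = g ^ (q ^ 3 + 1) := by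
        rw [← pow_succ, Nat.sub_add_cancel (by omega), h3]
      exact mul_eq_right.1 h4
    have hpos : 0 < (q ^ 3 + 1) * (q - 1) := Nat.mul_pos (by omega) (by omega)
    have h5 := orderOf_le_of_pow_eq_one hpos h1
    rw [ho] at h5
    have h7 : q ^ 6 - 1 = (q ^ 3 + 1) * (q ^ 3 - 1) := by
      rw [← Nat.sq_sub_sq]; ring_nf
    rw [h7] at h5
    have h8 := Nat.le_of_mul_le_mul_left h5 (by omega)
    have h9 : q < q ^ 3 := by
      calc q = q ^ 1 := (pow_one q).symm
        _ < q ^ 3 := Nat.pow_lt_pow_right (by omega) (by omega)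
    omega

theorem stmt1_core (F : Type) [Field F] (φ : F →+* F) (h2 : (2 : F) ≠ 0)
    (h6 : ∀ x, φ (φ (φ (φ (φ (φ x))))) = x)
    (hi : ∀ t : F, t ^ 2 = -1 → φ t = t)
    (x y : F) (hx : x ≠ 0) (hy : y ≠ 0)
    (h : y * (φ x - φ (φ x) + φ (φ (φ (φ x))) + φ (φ (φ (φ (φ x))))) =
      x * (φ y - φ (φ y) + φ (φ (φ (φ y))) + φ (φ (φ (φ (φ y)))))) :
    ∃ l : F, φ l = l ∧ y = l * x := by
  have key : ∀ x : F, ∃ a b, φ (φ (φ a)) = a ∧ φ (φ (φ b)) = -b ∧ x = a + b := by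
    intro x
    have e2 : φ 2 = 2 := map_ofNat φ 2
    refine ⟨(x + φ (φ (φ x))) / 2, (x - φ (φ (φ x))) / 2, ?_, ?_, ?_⟩
    · simp only [map_div₀, map_add, h6, e2]; ring
    · simp only [map_div₀, map_sub, h6, e2]; ring
    · field_simp; ring
  obtain ⟨a, b, ha, hb, rfl⟩ := key x
  obtain ⟨c, d, hc, hd, rfl⟩ := key y
  simp only [map_add, ha, hb, hc, hd, map_neg] at h
  have h' : (c + d) * (φ a - φ (φ b)) = (a + b) * (φ c - φ (φ d)) := by
    apply mul_left_cancel₀ h2; linear_combination h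
  have h'' : (c - d) * (φ a + φ (φ b)) = (a - b) * (φ c + φ (φ d)) := by
    have := congrArg (fun z => φ (φ (φ z))) h'
    simp only [map_add, map_sub, map_mul, ha, hb, hc, hd, map_neg] at this
    linear_combination this
  have even : c * φ a - d * φ (φ b) = a * φ c - b * φ (φ d) := by
    apply mul_left_cancel₀ h2; linear_combination h' + h''
  have odd : d * φ a - c * φ (φ b) = b * φ c - a * φ (φ d) := by
    apply mul_left_cancel₀ h2; linear_combination h' - h''
  -- the odd part forces proportionality
  have huv : a * φ (φ d) = c * φ (φ b) := by
    have f1 : φ (a * φ (φ d) - c * φ (φ b)) = a * φ (φ d) - c * φ (φ b) := by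
      simp only [map_sub, map_mul, hb, hd]; linear_combination -odd
    have f3 : φ (φ (φ (a * φ (φ d) - c * φ (φ b)))) = -(a * φ (φ d) - c * φ (φ b)) := by
      simp only [map_sub, map_mul, ha, hc, hb, hd, map_neg]; ring
    rw [f1, f1, f1] at f3
    apply mul_left_cancel₀ h2; linear_combination f3
  have inj : ∀ z, φ z = 0 → z = 0 := fun z hz => (map_eq_zero φ).1 hz
  by_cases hb0 : b = 0
  · subst hb0
    have ha0 : a ≠ 0 := by simpa using hx
    have hd0 : d = 0 := by
      have : φ (φ d) = 0 := by simpa [ha0] using huv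
      exact inj _ (inj _ this)
    subst hd0
    simp only [map_zero, mul_zero, sub_zero] at even
    have hfa : φ a ≠ 0 := fun h => ha0 (inj _ h)
    refine ⟨c / a, ?_, by field_simp; ring⟩
    rw [map_div₀]; field_simp; linear_combination -even
  · have hfb : φ b ≠ 0 := fun h => hb0 (inj _ h)
    have hffb : φ (φ b) ≠ 0 := fun h => hfb (inj _ h)
    obtain ⟨l, hl⟩ : ∃ l, l = φ (φ d) / φ (φ b) := ⟨_, rfl⟩
    have hfl : φ l = d / b := by
      rw [hl, map_div₀, hb, hd, neg_div_neg_eq]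
    have e1 : c = l * a := by rw [hl]; field_simp; linear_combination -huv
    have e2 : d = φ l * b := by rw [hfl]; field_simp
    have e3 : φ (φ d) = l * φ (φ b) := by rw [hl]; field_simp
    have e4 : φ c = φ l * φ a := by rw [e1, map_mul]
    have hprod : (l - φ l) * (a * φ a + b * φ (φ b)) = 0 := by
      rw [e3, e4] at even
      linear_combination even - φ a * e1 + φ (φ b) * e2
    rcases mul_eq_zero.1 hprod with h0 | h0
    · have h0' : φ l = l := by linear_combination -h0
      refine ⟨l, h0', ?_⟩
      rw [e1, e2, h0']; ring
    · exfalso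
      have g1 := congrArg φ h0
      have g2 := congrArg φ g1
      simp only [map_add, map_mul, ha, hb, map_neg, map_zero] at g1 g2
      have hBne : b * φ b * φ (φ b) ≠ 0 := mul_ne_zero (mul_ne_zero hb0 hfb) hffb
      have hsq : (a * φ a * φ (φ a)) ^ 2 = -(b * φ b * φ (φ b)) ^ 2 := by
        have k0 : a * φ a = -(b * φ (φ b)) := by linear_combination h0
        have k1 : φ a * φ (φ a) = φ b * b := by linear_combination g1
        have k2 : φ (φ a) * a = φ (φ b) * φ b := by linear_combination g2
        calc (a * φ a * φ (φ a)) ^ 2 = (a * φ a) * (φ a * φ (φ a)) * (φ (φ a) * a) := by ring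
          _ = _ := by rw [k0, k1, k2]; ring
      have ht : (a * φ a * φ (φ a) / (b * φ b * φ (φ b))) ^ 2 = -1 := by
        rw [div_pow, hsq, neg_div, div_self (pow_ne_zero 2 hBne)]
      have hfix := hi _ ht
      have hneg : φ (a * φ a * φ (φ a) / (b * φ b * φ (φ b))) =
          -(a * φ a * φ (φ a) / (b * φ b * φ (φ b))) := by
        simp only [map_div₀, map_mul, ha, hb]
        rw [← div_neg]; congr 1 <;> ring
      rw [hneg] at hfix
      have hz : a * φ a * φ (φ a) / (b * φ b * φ (φ b)) = 0 := by
        apply mul_left_cancel₀ h2; linear_combination -hfix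
      rw [hz] at ht
      norm_num at ht

/-- Let `q` be a prime power and `F` a finite field with `q^6` elements,
and define `f : F → F` by `f(x) = x^q − x^(q^2) + x^(q^4) + x^(q^5)`.
Then `f` is scattered if and only if `q ≡ 1 (mod 4)`. -/
theorem stmt1 (q : ℕ) (hq : IsPrimePow q)
    (F : Type) [Field F] [Fintype F] (hF : Fintype.card F = q ^ 6)
    (f : F → F) (hf : ∀ x : F, f x = x ^ q - x ^ (q ^ 2) + x ^ (q ^ 4) + x ^ (q ^ 5)) :
    (∀ x y : F, x ≠ 0 → y ≠ 0 → y * f x = x * f y → ∃ l : F, l ^ q = l ∧ y = l * x) ↔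
      q % 4 = 1 := by
  obtain ⟨⟨φ, hφ⟩, htwo⟩ := exists_phi q hq F hF
  have h6 : ∀ x, φ (φ (φ (φ (φ (φ x))))) = x := by
    intro x
    simp only [hφ, ← pow_mul]
    rw [show q * q * q * q * q * q = q ^ 6 by ring, ← hF, FiniteField.pow_card]
  have hf' : ∀ x, f x = φ x - φ (φ x) + φ (φ (φ (φ x))) + φ (φ (φ (φ (φ x)))) := by
    intro x
    rw [hf]
    simp only [hφ, ← pow_mul]
    congr 2 <;> ring
  constructor
  · intro H
    obtain ⟨l, hl0, hl3, hl⟩ := exists_lam q hq.two_le F hF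
    have hl3' : φ (φ (φ l)) = l := by
      simp only [hφ, ← pow_mul]
      rw [show q * q * q = q ^ 3 by ring, hl3]
    rw [← hφ] at hl
    by_contra hq4
    rcases Nat.mod_two_eq_zero_or_one q with he | hodd
    · have h20 := htwo.2 he
      obtain ⟨m, hm, hlm⟩ := H 1 l one_ne_zero hl0 (by
        rw [hf', hf']
        simp only [map_one, hl3']
        linear_combination (l - φ l) * h20)
      rw [mul_one] at hlm
      subst hlm
      exact hl ((hφ _).trans hm)
    · have hq3 : q % 4 = 3 := by omega
      have h2 : (2 : F) ≠ 0 := fun h => by have := htwo.1 h; omega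
      have hsq : IsSquare (-1 : F) := by
        rw [FiniteField.isSquare_neg_one_iff, hF, Nat.pow_mod, hq3]; norm_num
      obtain ⟨t, ht⟩ := hsq
      have ht4 : t ^ 4 = 1 := by linear_combination (-t^2 + 1) * ht
      have hφt : φ t = -t := by
        rw [hφ, ← Nat.div_add_mod q 4, hq3, pow_add, pow_mul, ht4, one_pow]
        linear_combination -t * ht
      have hx : (1 : F) + t ≠ 0 := by
        intro h
        apply h2
        linear_combination (1 - t) * h - ht
      have hy : l + φ l * t ≠ 0 := by
        intro h
        have h3 := congrArg (fun z => φ (φ (φ z))) h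
        simp only [map_add, map_mul, hφt, map_neg, hl3', map_zero] at h3
        have : (2 : F) * l = 0 := by linear_combination h + h3
        exact hl0 ((mul_eq_zero.1 this).resolve_left h2)
      obtain ⟨m, hm, hlm⟩ := H (1 + t) (l + φ l * t) hx hy (by
        rw [hf', hf']
        simp only [map_add, map_mul, hφt, map_neg, hl3', map_one]
        linear_combination (2 * φ l - 2 * l) * ht)
      rw [← hφ] at hm
      have h3 := congrArg (fun z => φ (φ (φ z))) hlm
      simp only [map_add, map_mul, hφt, map_neg, hl3', hm, map_one] at h3
      have hlm' : l = m := by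
        apply mul_left_cancel₀ h2; linear_combination hlm + h3
      exact hl (hlm' ▸ hm)
  · intro hq4 x y hx hy h
    have h2 : (2 : F) ≠ 0 := fun h => by have := htwo.1 h; omega
    rw [hf', hf'] at h
    obtain ⟨l, hl, hl'⟩ := stmt1_core F φ h2 h6 (by
      intro t ht
      have ht4 : t ^ 4 = 1 := by linear_combination (t^2 - 1) * ht
      rw [hφ, ← Nat.div_add_mod q 4, hq4, pow_add, pow_mul, ht4, one_pow]
      ring) x y hx hy h
    exact ⟨l, (hφ l).symm.trans hl, hl'⟩
end

section
/- Let q = 2^s be an even prime power, F a finite field with q^6 elements, and h ∈ F with h^(q^3+1) = 1. Then the q-polynomial f_h(x) = h^(q−1)·x^q − h^(q^2−1)·x^(q^2) + x^(q^4) + x^(q^5) is not scattered: there exist nonzero x, y ∈ F with y·f_h(x) = x·f_h(y) such that y ≠ λ·x for every λ ∈ F with λ^q = λ. -/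
/-- Let `q = 2^s` be an even prime power, `F` a finite field with `q^6`
elements, and `h ∈ F` with `h^(q^3+1) = 1`. Then the `q`-polynomial
`f_h(x) = h^(q−1)·x^q − h^(q^2−1)·x^(q^2) + x^(q^4) + x^(q^5)` is not scattered. -/
theorem stmt2 (s q : ℕ) (hs : 0 < s) (hq : q = 2 ^ s)
    (F : Type) [Field F] [Fintype F] (hF : Fintype.card F = q ^ 6)
    (h : F) (hh : h ^ (q ^ 3 + 1) = 1)
    (f : F → F)
    (hf : ∀ x : F, f x = h ^ (q - 1) * x ^ q - h ^ (q ^ 2 - 1) * x ^ (q ^ 2)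
      + x ^ (q ^ 4) + x ^ (q ^ 5)) :
    ∃ x y : F, x ≠ 0 ∧ y ≠ 0 ∧ y * f x = x * f y ∧ ∀ l : F, l ^ q = l → y ≠ l * x := by
  classical
  have hq2 : 2 ≤ q := by
    rw [hq]; exact Nat.le_self_pow hs.ne' 2
  have hchar : CharP F 2 := by
    obtain ⟨p, hp⟩ := CharP.exists F
    obtain ⟨n, hpp, hn⟩ := FiniteField.card F p
    have h1 : p ∣ 2 := by
      have : p ∣ q ^ 6 := by rw [← hF, hn]; exact dvd_pow_self _ n.pos.ne'
      rw [hq] at this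
      exact hpp.dvd_of_dvd_pow (hpp.dvd_of_dvd_pow this)
    rwa [(Nat.prime_dvd_prime_iff_eq hpp Nat.prime_two).1 h1] at hp
  have two : (2 : F) = 0 := by exact_mod_cast CharP.cast_eq_zero F 2
  have hh0 : h ≠ 0 := by
    rintro rfl
    simp at hh
  -- the Frobenius `x ↦ x^q`
  obtain ⟨φ, hφ⟩ : ∃ φ : F →+* F, ∀ x, φ x = x ^ q :=
    ⟨iterateFrobenius F 2 s, fun x => by rw [hq]; exact iterateFrobenius_def 2 s x⟩
  have p2 : ∀ x : F, x ^ (q ^ 2) = φ (φ x) := fun x => by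
    simp only [hφ, ← pow_mul]; congr 1; ring
  have p3 : ∀ x : F, x ^ (q ^ 3) = φ (φ (φ x)) := fun x => by
    simp only [hφ, ← pow_mul]; congr 1; ring
  have p4 : ∀ x : F, x ^ (q ^ 4) = φ (φ (φ (φ x))) := fun x => by
    simp only [hφ, ← pow_mul]; congr 1; ring
  have p5 : ∀ x : F, x ^ (q ^ 5) = φ (φ (φ (φ (φ x)))) := fun x => by
    simp only [hφ, ← pow_mul]; congr 1; ring
  have p6 : ∀ x : F, φ (φ (φ (φ (φ (φ x))))) = x := fun x => by
    have : x ^ (q ^ 6) = x := by rw [← hF]; exact FiniteField.pow_card x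
    rw [← p5, hφ, ← pow_mul, ← pow_succ', this] at *
  have e0 : h * φ (φ (φ h)) = 1 := by
    rw [← p3, ← pow_succ', hh]
  have e1 : φ h * φ (φ (φ (φ h))) = 1 := by
    rw [← map_mul, e0, map_one]
  have hf' : ∀ x, h * f x = φ h * φ x + φ (φ h) * φ (φ x) + h * φ (φ (φ (φ x)))
      + h * φ (φ (φ (φ (φ x)))) := fun x => by
    have a1 : h * h ^ (q - 1) = φ h := by
      rw [← pow_succ', hφ]; congr 1; omega
    have a2 : h * h ^ (q ^ 2 - 1) = φ (φ h) := by
      rw [← pow_succ', ← p2]; congr 1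
      have : 0 < q ^ 2 := by positivity
      omega
    rw [hf, p4, p5, p2, ← hφ]
    linear_combination φ x * a1 - φ (φ x) * a2 - φ (φ h) * φ (φ x) * two
  let T : F →+ F :=
    { toFun := fun x => h * φ h * x + φ h * φ x + φ (φ (φ x)) + h * φ (φ (φ (φ x)))
      map_zero' := by simp
      map_add' := fun x y => by simp only [map_add]; ring }
  have hT : ∀ x, T x = h * φ h * x + φ h * φ x + φ (φ (φ x)) + h * φ (φ (φ (φ x))) :=
    fun x => rfl
  have hTbar : ∀ x, T x = h * φ h * (T x) ^ (q ^ 3) := fun x => by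
    rw [p3, hT]
    simp only [map_add, map_mul, p6]
    linear_combination (- φ (φ (φ x)) * φ h * φ (φ (φ (φ h))) - φ h * φ x) * e0 + (- φ (φ (φ x)) - h * φ (φ (φ (φ x)))) * e1
  have key : ∀ x, T x = 0 → f x = (φ h + φ (φ h)) * x := fun x hx => by
    have h2 : φ (φ (T x)) = 0 := by rw [hx]; simp
    rw [hT] at hx h2
    simp only [map_add, map_mul, p6] at h2
    apply mul_left_cancel₀ hh0
    rw [hf']
    linear_combination hx + h * h2 - (φ (φ h) * φ (φ x) + φ (φ (φ x))) * e0
      - (h * φ h * x + φ (φ (φ x)) + h * φ (φ h) * x) * two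
  have hker : q ^ 3 ≤ Nat.card T.ker := by
    have c1 : Nat.card T.range ≤ q ^ 3 := by
      let P : Polynomial F := Polynomial.C (h * φ h) * Polynomial.X ^ (q ^ 3) - Polynomial.X
      have h3 : 1 < q ^ 3 := Nat.one_lt_pow (by norm_num) (by omega)
      have hne : h * φ h ≠ 0 := mul_ne_zero hh0 (by simpa using hh0)
      have hdeg : P.natDegree ≤ q ^ 3 := by
        refine (Polynomial.natDegree_sub_le _ _).trans (max_le ?_ ?_)
        · exact Polynomial.natDegree_C_mul_X_pow_le _ _
        · simpa using h3.le
      have hP : P ≠ 0 := by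
        intro h0
        have := congrArg (fun p => Polynomial.coeff p (q ^ 3)) h0
        simp only [P, Polynomial.coeff_sub, Polynomial.coeff_C_mul, Polynomial.coeff_X_pow_self,
          Polynomial.coeff_X, if_neg h3.ne, Polynomial.coeff_zero, mul_one, sub_zero] at this
        exact hne this
      have hsub : (T.range : Set F) ⊆ (P.roots.toFinset : Set F) := by
        rintro _ ⟨x, rfl⟩
        simp only [Finset.mem_coe, Multiset.mem_toFinset, Polynomial.mem_roots hP,
          Polynomial.IsRoot.def]
        simp only [P, Polynomial.eval_sub, Polynomial.eval_mul, Polynomial.eval_C,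
          Polynomial.eval_pow, Polynomial.eval_X]
        rw [← hTbar, sub_self]
      calc Nat.card T.range = (T.range : Set F).ncard := rfl
        _ ≤ (P.roots.toFinset : Set F).ncard := Set.ncard_le_ncard hsub (Set.toFinite _)
        _ = P.roots.toFinset.card := Set.ncard_coe_finset _
        _ ≤ P.roots.card := Multiset.toFinset_card_le _
        _ ≤ P.natDegree := P.card_roots'
        _ ≤ q ^ 3 := hdeg
    have c2 : Nat.card F = Nat.card T.range * Nat.card T.ker := by
      rw [AddSubgroup.card_eq_card_quotient_mul_card_addSubgroup T.ker,
        Nat.card_congr (QuotientAddGroup.quotientKerEquivRange T).toEquiv]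
    rw [Nat.card_eq_fintype_card, hF] at c2
    have : q ^ 3 * q ^ 3 ≤ q ^ 3 * Nat.card T.ker := by
      rw [← pow_add, show 3 + 3 = 6 from rfl, c2]; exact Nat.mul_le_mul_right _ c1
    exact Nat.le_of_mul_le_mul_left this (by positivity)
  have hfix : ({l : F | l ^ q = l}).ncard ≤ q := by
    let P : Polynomial F := Polynomial.X ^ q - Polynomial.X
    have hP : P ≠ 0 := FiniteField.X_pow_card_sub_X_ne_zero F (by omega)
    have hsub : {l : F | l ^ q = l} ⊆ (P.roots.toFinset : Set F) := by
      intro l hl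
      simp only [Finset.mem_coe, Multiset.mem_toFinset, Polynomial.mem_roots hP]
      simpa [P, sub_eq_zero] using hl
    calc _ ≤ (P.roots.toFinset : Set F).ncard := Set.ncard_le_ncard hsub (Set.toFinite _)
      _ = P.roots.toFinset.card := Set.ncard_coe_finset _
      _ ≤ P.roots.card := Multiset.toFinset_card_le _
      _ ≤ P.natDegree := P.card_roots'
      _ = q := FiniteField.X_pow_card_sub_X_natDegree_eq F (by omega)
  have hq3 : q < q ^ 3 := by
    calc q = q ^ 1 := (pow_one q).symm
      _ < q ^ 3 := Nat.pow_lt_pow_right (by omega) (by norm_num)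
  have hkn : q ^ 3 ≤ (T.ker : Set F).ncard := hker
  obtain ⟨x, hx, hx0⟩ : ∃ x ∈ (T.ker : Set F), x ∉ ({0} : Set F) := by
    apply Set.exists_mem_notMem_of_ncard_lt_ncard _ (Set.toFinite _)
    rw [Set.ncard_singleton]; omega
  obtain ⟨y, hy, hy0⟩ : ∃ y ∈ (T.ker : Set F), y ∉ (fun l => l * x) '' {l : F | l ^ q = l} := by
    apply Set.exists_mem_notMem_of_ncard_lt_ncard _ (Set.toFinite _)
    have := Set.ncard_image_le (f := fun l => l * x) (Set.toFinite {l : F | l ^ q = l})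
    omega
  refine ⟨x, y, by simpa using hx0, ?_, ?_, ?_⟩
  · rintro rfl
    exact hy0 ⟨0, by simp; omega, by simp⟩
  · rw [key x hx, key y hy]; ring
  · intro l hl hyl
    exact hy0 ⟨l, hl, hyl.symm⟩
end

section
/- Let q = p^s be an odd prime power, F a finite field with q^6 elements, and h ∈ F with h^(q^3+1) = −1 and h^q ≠ h (i.e., h ∉ F_q). Then the q-polynomial f_h(x) = h^(q−1)·x^q − h^(q^2−1)·x^(q^2) + x^(q^4) + x^(q^5) is scattered. -/
/-- Core of the argument, for vectors already split along the two eigenspaces of `σ³`.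
Here `a, b, c` are the first three conjugates of `h`. -/
theorem core_aux {F : Type} [Field F] (σ : F →+* F) (h6 : ∀ x, σ (σ (σ (σ (σ (σ x))))) = x)
    (h2 : (2 : F) ≠ 0) (a b c : F) (ha : a ≠ 0) (hb : b ≠ 0) (hc : c ≠ 0)
    (sa : σ a = b) (sb : σ b = c) (sc : σ c = -a⁻¹)
    (e0 : a + b ≠ 0) (e1 : b + c ≠ 0) (e2 : a * c - 1 ≠ 0)
    (u v u' v' : F) (hu : σ (σ (σ u)) = -(a * b) * u) (hv : σ (σ (σ v)) = a * c * v)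
    (hu' : σ (σ (σ u')) = -(a * b) * u') (hv' : σ (σ (σ v')) = a * c * v')
    (hx : u + v ≠ 0)
    (E : (u + v) * (b ^ 2 * (1 - a * c) * σ u' - c * (a + b) * σ (σ v')) =
      (u' + v') * (b ^ 2 * (1 - a * c) * σ u - c * (a + b) * σ (σ v))) :
    ∃ l : F, σ l = l ∧ u' + v' = l * (u + v) := by
  have E2 := congrArg (fun z => σ (σ (σ z))) E
  simp only [map_add, map_mul, map_sub, map_pow, map_one, sa, sb, sc, hu, hv, hu', hv', map_neg,
    map_inv₀] at E2
  have inj : ∀ z, σ z = 0 → z = 0 := fun z hz => (map_eq_zero σ).mp hz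
  -- the mixed term
  have keyS : b ^ 2 * (1 - a * c) * (v * σ u' - v' * σ u)
      - b * (a + b) * (u * σ (σ v') - u' * σ (σ v)) = 0 := by
    field_simp at E2
    have : (b + c) * (b ^ 2 * (1 - a * c) * (v * σ u' - v' * σ u)
      - b * (a + b) * (u * σ (σ v') - u' * σ (σ v))) = 0 := by
      linear_combination b * E + b * E2
    exact (mul_eq_zero.mp this).resolve_left e1
  have hT2 : σ (σ (v * σ u' - v' * σ u)) = a * b * (u * σ (σ v') - u' * σ (σ v)) := by
    simp only [map_sub, map_mul, hu, hu']
    ring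
  have hT : v * σ u' - v' * σ u = 0 := by
    obtain ⟨T, hTd⟩ : ∃ T, T = v * σ u' - v' * σ u := ⟨_, rfl⟩
    rw [← hTd] at hT2 keyS ⊢
    have k1 : a * b ^ 2 * (1 - a * c) * T = (a + b) * σ (σ T) := by
      rw [hT2]; linear_combination a * keyS
    have hW : σ (σ (T / (a + b))) = -(a ^ 2 * b ^ 2) * (T / (a + b)) := by
      have e2' : c + -a⁻¹ ≠ 0 := by
        intro hh; apply e2; field_simp at hh; linear_combination hh
      simp only [map_div₀, map_add, sa, sb, sc]
      have : c + -a⁻¹ = (a * c - 1) / a := by field_simp; ring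
      rw [this]
      field_simp
      linear_combination -k1
    obtain ⟨W, hWd⟩ : ∃ W, W = T / (a + b) := ⟨_, rfl⟩
    rw [← hWd] at hW
    have hW4 : σ (σ (-(a ^ 2 * b ^ 2) * W)) = -(c ^ 2 * (-a⁻¹) ^ 2) * (-(a ^ 2 * b ^ 2) * W) := by
      simp only [map_mul σ, map_neg, map_pow, sa, sb, sc, hW]
    have hW6 : W = σ (σ (-(c ^ 2 * (-a⁻¹) ^ 2) * (-(a ^ 2 * b ^ 2) * W))) := by
      rw [← hW4, ← hW, h6]
    rw [map_mul, map_mul, hW4] at hW6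
    simp only [map_mul σ, map_neg, map_pow, map_inv₀, sa, sb, sc] at hW6
    have hW0 : 2 * W = 0 := by
      field_simp at hW6
      linear_combination hW6
    have hW0 := (mul_eq_zero.mp hW0).resolve_left h2
    rw [hWd] at hW0
    exact (div_eq_zero_iff.mp hW0).resolve_right e0
  have hS : u * σ (σ v') - u' * σ (σ v) = 0 := by
    rw [hT] at keyS
    have : (b * (a + b)) * (u * σ (σ v') - u' * σ (σ v)) = 0 := by linear_combination -keyS
    exact (mul_eq_zero.mp this).resolve_left (mul_ne_zero hb e0)
  have hA : b ^ 2 * (1 - a * c) * (u * σ u' - u' * σ u)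
      = c * (a + b) * (v * σ (σ v') - v' * σ (σ v)) := by
    linear_combination E - b ^ 2 * (1 - a * c) * hT + c * (a + b) * hS
  have e2n : (1 - a * c) ≠ 0 := fun hh => e2 (by linear_combination -hh)
  by_cases u0 : u = 0
  · have v0 : v ≠ 0 := by simpa [u0] using hx
    have u'0 : u' = 0 := by
      simp only [u0, map_zero, mul_zero, sub_zero] at hT
      exact inj _ ((mul_eq_zero.mp hT).resolve_left v0)
    obtain ⟨t, rfl⟩ : ∃ t, v' = t * v := ⟨v' / v, by field_simp⟩
    have t3 : σ (σ (σ t)) = t := by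
      have h1 : (σ (σ (σ t)) - t) * (a * c * v) = 0 := by
        simp only [map_mul, hv] at hv'; linear_combination hv'
      exact sub_eq_zero.mp ((mul_eq_zero.mp h1).resolve_right (by positivity))
    have t2 : σ (σ t) = t := by
      have h1 : (σ (σ t) - t) * (c * (a + b) * v * σ (σ v)) = 0 := by
        simp only [map_mul, u0, u'0] at hA; linear_combination -hA
      have h3 : σ (σ v) ≠ 0 := fun hh => v0 (inj _ (inj _ hh))
      exact sub_eq_zero.mp ((mul_eq_zero.mp h1).resolve_right (by positivity))
    refine ⟨t, ?_, by rw [u0, u'0]; ring⟩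
    rw [t2] at t3; exact t3
  by_cases v0 : v = 0
  · have v'0 : v' = 0 := by
      simp only [v0, map_zero, mul_zero, sub_zero] at hS
      exact inj _ (inj _ ((mul_eq_zero.mp hS).resolve_left u0))
    obtain ⟨t, rfl⟩ : ∃ t, u' = t * u := ⟨u' / u, by field_simp⟩
    refine ⟨t, ?_, by rw [v0, v'0]; ring⟩
    have h1 : (σ t - t) * (b ^ 2 * (1 - a * c) * u * σ u) = 0 := by
      simp only [map_mul, v0, v'0] at hA; linear_combination hA
    have h3 : σ u ≠ 0 := fun hh => u0 (inj _ hh)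
    exact sub_eq_zero.mp ((mul_eq_zero.mp h1).resolve_right (by positivity))
  have u1 : σ u ≠ 0 := fun hh => u0 (inj _ hh)
  have u2 : σ (σ u) ≠ 0 := fun hh => u1 (inj _ hh)
  have v1 : σ v ≠ 0 := fun hh => v0 (inj _ hh)
  have v2 : σ (σ v) ≠ 0 := fun hh => v1 (inj _ hh)
  obtain ⟨r, rfl⟩ : ∃ t, u' = t * u := ⟨u' / u, by field_simp⟩
  obtain ⟨t, rfl⟩ : ∃ t, v' = t * v := ⟨v' / v, by field_simp⟩
  have hr1 : t = σ r := by
    have h1 : (t - σ r) * (v * σ u) = 0 := by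
      simp only [map_mul] at hT; linear_combination -hT
    exact sub_eq_zero.mp ((mul_eq_zero.mp h1).resolve_right (by positivity))
  have hr2 : σ (σ t) = r := by
    have h1 : (σ (σ t) - r) * (u * σ (σ v)) = 0 := by
      simp only [map_mul] at hS; linear_combination hS
    exact sub_eq_zero.mp ((mul_eq_zero.mp h1).resolve_right (by positivity))
  by_cases hr : σ r = r
  · exact ⟨r, hr, by rw [hr1, hr]; ring⟩
  exfalso
  -- the remaining relation
  have q1 : b ^ 2 * (1 - a * c) * u * σ u = - (c * (a + b)) * v * σ (σ v) := by
    have h1 : (σ r - r) * (b ^ 2 * (1 - a * c) * u * σ u + c * (a + b) * v * σ (σ v)) = 0 := by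
      simp only [map_mul, hr2] at hA; rw [hr1] at hA; linear_combination hA
    have := (mul_eq_zero.mp h1).resolve_left (sub_ne_zero.mpr hr)
    linear_combination this
  have q2 := congrArg σ q1
  simp only [map_add, map_mul, map_sub, map_pow, map_one, sa, sb, sc, hv, map_neg] at q2
  have q3 := congrArg σ q2
  simp only [map_add, map_mul, map_sub, map_pow, map_one, sa, sb, sc, hv, hu, map_neg,
    map_inv₀] at q3
  field_simp at q2 q3
  have sq : (b * (a * c - 1) * σ u) ^ 2 = (a * (b + c) * v) ^ 2 := by
    have n0 : c * (a + b) * u * σ (σ u) * σ v * σ (σ v) ≠ 0 := by positivity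
    apply mul_left_cancel₀ n0
    have r1 : b ^ 2 * (a * c - 1) * u * σ u = c * (a + b) * v * σ (σ v) := by
      linear_combination -q1
    have r2 : c * (a + b) * σ u * σ (σ u) = a * (b + c) * σ v * v := by
      linear_combination q2
    have r3 : (a * c - 1) * σ v * σ (σ v) = a * (b + c) * u * σ (σ u) := by
      linear_combination q3
    have := congrArg₂ (· * ·) (congrArg₂ (· * ·) r1 r2) r3
    linear_combination this
  have fin : ∀ d : F, σ d = d → d ≠ 0 → v * (a * (b + c)) = d * (b * (a * c - 1) * σ u) → False := by
    intro d hd d0 hvd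
    have := congrArg (fun z => σ (σ (σ z))) hvd
    simp only [map_add, map_mul, map_sub, map_one, sa, sb, sc, hv, hu, hd, map_neg,
      map_inv₀] at this
    field_simp at this
    have h5 : 2 * (v * (a * (b + c))) = 0 := by
      linear_combination hvd + this
    have : a * (b + c) ≠ 0 := mul_ne_zero ha e1
    exact (mul_ne_zero h2 (mul_ne_zero v0 this)) h5
  rcases sq_eq_sq_iff_eq_or_eq_neg.mp sq with h1 | h1
  · exact fin 1 (map_one σ) one_ne_zero (by linear_combination -h1)
  · exact fin (-1) (by simp) (by simp) (by linear_combination h1)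

/-- The result for an abstract automorphism `σ` of order six. -/
theorem main_aux {F : Type} [Field F] (σ : F →+* F) (h6 : ∀ x, σ (σ (σ (σ (σ (σ x))))) = x)
    (h2 : (2 : F) ≠ 0) (a b c : F) (ha : a ≠ 0) (sa : σ a = b) (sb : σ b = c) (sc : σ c = -a⁻¹)
    (hab : a + b ≠ 0) (x y : F) (hx : x ≠ 0)
    (E : y * (b / a * σ x - c / a * σ (σ x) + σ (σ (σ (σ x))) + σ (σ (σ (σ (σ x))))) =
      x * (b / a * σ y - c / a * σ (σ y) + σ (σ (σ (σ y))) + σ (σ (σ (σ (σ y)))))) :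
    ∃ l : F, σ l = l ∧ y = l * x := by
  have hb : b ≠ 0 := by rw [← sa]; exact (map_ne_zero σ).mpr ha
  have hc : c ≠ 0 := by rw [← sb]; exact (map_ne_zero σ).mpr hb
  have e1 : b + c ≠ 0 := by
    have := (map_ne_zero σ).mpr hab
    rwa [map_add, sa, sb] at this
  have e2 : a * c - 1 ≠ 0 := by
    have := (map_ne_zero σ).mpr e1
    rw [map_add, sb, sc] at this
    intro hh; apply this; field_simp; linear_combination hh
  have dec : ∀ z : F, ∃ u v : F, z = u + v ∧ σ (σ (σ u)) = -(a * b) * u ∧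
      σ (σ (σ v)) = a * c * v := by
    intro z
    have e1' : -b⁻¹ + -c⁻¹ ≠ 0 := by
      intro hh; apply e1; field_simp at hh; linear_combination -hh
    have e1'' : -b⁻¹ + -c⁻¹ = - ((b + c) / (b * c)) := by field_simp; ring
    refine ⟨(a * c * z - σ (σ (σ z))) / (a * (b + c)), (σ (σ (σ z)) + a * b * z) / (a * (b + c)),
      ?_, ?_, ?_⟩
    · field_simp; ring
    · simp only [map_div₀, map_add, map_mul, map_sub, sa, sb, sc, h6, map_neg, map_inv₀]
      rw [e1'']
      field_simp
      try ring
    · simp only [map_div₀, map_add, map_mul, map_sub, sa, sb, sc, h6, map_neg, map_inv₀]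
      rw [e1'']
      field_simp
      try ring
  obtain ⟨u, v, rfl, hu, hv⟩ := dec x
  obtain ⟨u', v', rfl, hu', hv'⟩ := dec y
  refine core_aux σ h6 h2 a b c ha hb hc sa sb sc hab e1 e2 u v u' v' hu hv hu' hv' hx ?_
  simp only [map_add, map_mul, map_neg, map_inv₀, hu, hv, hu', hv', sa, sb, sc] at E
  field_simp at E
  linear_combination -E

/-- Let `q = p^s` be an odd prime power, `F` a finite field with `q^6`
elements, and `h ∈ F` with `h^(q^3+1) = −1` and `h^q ≠ h` (i.e. `h ∉ F_q`). Then the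
`q`-polynomial `f_h(x) = h^(q−1)·x^q − h^(q^2−1)·x^(q^2) + x^(q^4) + x^(q^5)` is scattered. -/
theorem stmt3 (p s q : ℕ) (hp : p.Prime) (hs : 0 < s) (hq : q = p ^ s) (hodd : Odd q)
    (F : Type) [Field F] [Fintype F] (hF : Fintype.card F = q ^ 6)
    (h : F) (hh : h ^ (q ^ 3 + 1) = -1) (hnotFq : h ^ q ≠ h) :
    ∀ x y : F, x ≠ 0 → y ≠ 0 →
      y * (h ^ (q - 1) * x ^ q - h ^ (q ^ 2 - 1) * x ^ (q ^ 2) + x ^ (q ^ 4) + x ^ (q ^ 5)) =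
        x * (h ^ (q - 1) * y ^ q - h ^ (q ^ 2 - 1) * y ^ (q ^ 2) + y ^ (q ^ 4) + y ^ (q ^ 5)) →
      ∃ l : F, l ^ q = l ∧ y = l * x := by
  intro x y hx _ E
  have : Fact p.Prime := ⟨hp⟩
  have : CharP F p := charP_of_card_eq_prime_pow (f := s * 6) (by rw [hF, hq, pow_mul])
  have hq0 : 0 < q := by rw [hq]; exact pow_pos hp.pos _
  have hpodd : p ≠ 2 := by
    rintro rfl
    rw [hq] at hodd
    exact (Nat.not_odd_iff_even.mpr ((even_two).pow_of_ne_zero hs.ne')) hodd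
  have h2 : (2 : F) ≠ 0 := Ring.two_ne_zero (by rw [ringChar.eq F p]; exact hpodd)
  have hσ : ∀ z : F, iterateFrobenius F p s z = z ^ q := by
    intro z; rw [iterateFrobenius_def, hq]
  have hh0 : h ≠ 0 := by
    rintro rfl
    rw [zero_pow (by omega)] at hh
    exact one_ne_zero (neg_eq_zero.mp hh.symm)
  have p2 : ∀ z : F, z ^ (q ^ 2) = (z ^ q) ^ q := by intro z; rw [← pow_mul]; congr 1; ring
  have p3 : ∀ z : F, z ^ (q ^ 3) = ((z ^ q) ^ q) ^ q := by
    intro z; simp only [← pow_mul]; congr 1; ring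
  have p4 : ∀ z : F, z ^ (q ^ 4) = (((z ^ q) ^ q) ^ q) ^ q := by
    intro z; simp only [← pow_mul]; congr 1; ring
  have p5 : ∀ z : F, z ^ (q ^ 5) = ((((z ^ q) ^ q) ^ q) ^ q) ^ q := by
    intro z; simp only [← pow_mul]; congr 1; ring
  have d1 : h ^ (q - 1) = h ^ q / h := by
    rw [eq_div_iff hh0, ← pow_succ]; congr 1; omega
  have d2 : h ^ (q ^ 2 - 1) = (h ^ q) ^ q / h := by
    have : 0 < q ^ 2 := pow_pos hq0 _
    rw [eq_div_iff hh0, ← pow_succ, ← p2]; congr 1; omega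
  have h3 : ((h ^ q) ^ q) ^ q = -h⁻¹ := by
    rw [pow_succ, p3] at hh
    field_simp
    exact hh
  have hab : h + h ^ q ≠ 0 := by
    intro h0
    have h1 : h ^ q = -h := by linear_combination h0
    rw [h1, hodd.neg_pow, h1, neg_neg, h1] at h3
    have h4 : h * h = 1 := by field_simp at h3; linear_combination -h3
    rcases mul_self_eq_one_iff.mp h4 with h5 | h5
    · exact hnotFq (by rw [h5, one_pow])
    · exact hnotFq (by rw [h5, hodd.neg_pow, one_pow])
  have := main_aux (iterateFrobenius F p s) (by
      intro z
      simp only [hσ]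
      rw [← p5, ← pow_mul, ← pow_succ', ← hF, FiniteField.pow_card]) h2 h (h ^ q) ((h ^ q) ^ q)
      hh0 (hσ _) (hσ _) (by rw [hσ, h3]) hab x y hx (by
      simp only [hσ]
      rw [d1, d2] at E
      simp only [p2, p4, p5] at E
      exact E)
  obtain ⟨l, hl, hl2⟩ := this
  exact ⟨l, by rw [← hσ, hl], hl2⟩
end

section
/- Let q be a prime power, F a finite field with q^6 elements, and h ∈ F with h^(q^3+1) = −1 and h^4 ≠ 1. Then h^(q^2+1) ≠ 1. -/
/-- Let `q` be a prime power, `F` a finite field with `q^6` elements, and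
`h ∈ F` with `h^(q^3+1) = −1` and `h^4 ≠ 1`. Then `h^(q^2+1) ≠ 1`. -/
theorem stmt5 (q : ℕ) (hq : IsPrimePow q)
    (F : Type) [Field F] [Fintype F] (hF : Fintype.card F = q ^ 6)
    (h : F) (hh : h ^ (q ^ 3 + 1) = -1) (hh4 : h ^ 4 ≠ 1) :
    h ^ (q ^ 2 + 1) ≠ 1 := by
  intro h1
  have e1 : h ^ q * h ^ (q ^ 3 + 1) = h * (h ^ (q ^ 2 + 1)) ^ q := by ring
  rw [hh, h1, one_pow] at e1
  have e2 : (h ^ 2) ^ q = h ^ 2 := by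
    rw [← pow_mul, mul_comm, pow_mul]
    linear_combination (h - h ^ q) * e1
  have e3 : (h ^ 2) ^ (q ^ 2) = h ^ 2 := by
    rw [pow_two q, pow_mul, e2, e2]
  apply hh4
  calc h ^ 4 = (h ^ 2) ^ (q ^ 2) * h ^ 2 := by rw [e3]; ring
    _ = (h ^ (q ^ 2 + 1)) ^ 2 := by ring
    _ = 1 := by rw [h1, one_pow]
end

section
/- Let q be a prime power, F a finite field with q^6 elements, and h ∈ F with h^(q^3+1) = −1 and h^4 ≠ 1. If σ ∈ F satisfies h^(q+1)·σ^(q^2+1) + (h^q + h)^(q+1) = 0, then σ = h^(q^2) + h^q or σ = −(h^(q^2) + h^q). -/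
/-- Let `q` be a prime power, `F` a finite field with `q^6` elements, and
`h ∈ F` with `h^(q^3+1) = −1` and `h^4 ≠ 1`. If `σ ∈ F` satisfies
`h^(q+1)·σ^(q^2+1) + (h^q + h)^(q+1) = 0`, then `σ = ±(h^(q^2) + h^q)`. -/
theorem stmt9 (q : ℕ) (hq : IsPrimePow q)
    (F : Type) [Field F] [Fintype F] (hF : Fintype.card F = q ^ 6)
    (h : F) (hh : h ^ (q ^ 3 + 1) = -1) (hh4 : h ^ 4 ≠ 1)
    (σ : F) (hσ : h ^ (q + 1) * σ ^ (q ^ 2 + 1) + (h ^ q + h) ^ (q + 1) = 0) :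
    σ = h ^ (q ^ 2) + h ^ q ∨ σ = -(h ^ (q ^ 2) + h ^ q) := by
  classical
  obtain ⟨p, k, hp, hk, rfl⟩ := hq
  have hp' : p.Prime := Nat.prime_iff.mpr hp
  have : Fact p.Prime := ⟨hp'⟩
  have : CharP F p := by
    refine charP_of_card_eq_prime_pow (f := k * 6) ?_
    rw [hF, pow_mul]
  have hadd : ∀ a b : F, (a + b) ^ (p ^ k) = a ^ (p ^ k) + b ^ (p ^ k) :=
    fun a b => add_pow_char_pow a b p k
  have hneg : ∀ a : F, (-a) ^ (p ^ k) = -a ^ (p ^ k) := by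
    intro a
    have h1 := hadd a (-a)
    rw [add_neg_cancel, zero_pow (pow_pos hp'.pos k).ne'] at h1
    linear_combination -h1
  have hcard : ∀ a : F, a ^ ((p ^ k) ^ 6) = a := fun a => by
    rw [← hF]; exact FiniteField.pow_card a
  have hq0 : p ^ k ≠ 0 := (pow_pos hp'.pos k).ne'
  generalize p ^ k = q at *
  obtain ⟨f, hf⟩ : ∃ f : F →+* F, ∀ a, f a = a ^ q :=
    ⟨{ toFun := fun a => a ^ q, map_one' := one_pow q, map_mul' := fun a b => mul_pow a b q,
       map_zero' := zero_pow hq0, map_add' := hadd }, fun a => rfl⟩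
  have f2 : ∀ a : F, a ^ (q ^ 2) = f (f a) := fun a => by
    simp only [hf, ← pow_mul]; congr 1; ring
  have f3 : ∀ a : F, a ^ (q ^ 3) = f (f (f a)) := fun a => by
    simp only [hf, ← pow_mul]; congr 1; ring
  have f6 : ∀ a : F, f (f (f (f (f (f a))))) = a := fun a => by
    conv_rhs => rw [← hcard a]
    simp only [hf, ← pow_mul]; congr 1; ring
  simp only [pow_succ _ q, pow_succ _ (q ^ 2), pow_succ _ (q ^ 3), f2, f3, ← hf] at hh hσ ⊢
  have E2 := congrArg (fun a => f (f a)) hσ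
  have E4 := congrArg (fun a => f (f a)) E2
  have U1 := congrArg f hh
  have U2 := congrArg f U1
  simp only [map_add, map_mul, map_zero, map_neg, map_one, f6] at hσ E2 E4 U1 U2
  have N1 : f h + h ≠ 0 := by
    intro h0
    have a1 : f h = -h := by linear_combination h0
    have : f (f (f h)) = -h := by simp [a1]
    apply hh4
    rw [this] at hh
    linear_combination (-h ^ 2 - 1) * hh
  have N2 : h * f (f h) - 1 ≠ 0 := by
    intro h0
    have h1 := congrArg (fun a => f (f a)) h0
    simp only [map_sub, map_mul, map_zero, map_one] at h1
    have z0 : f (f h) ≠ 0 := fun e => by simp [e] at h0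
    have a1 : f (f (f (f h))) = h := by
      apply mul_left_cancel₀ z0
      linear_combination h1 - h0
    rw [a1] at U1
    have h2 := congrArg f U1
    simp only [map_mul, map_neg, map_one] at h2
    have y0 : f h ≠ 0 := fun e => by simp [e] at U1
    have a2 : f (f h) = h := by
      apply mul_left_cancel₀ y0
      linear_combination h2 - U1
    rw [a2] at h0
    apply hh4
    linear_combination (h ^ 2 + 1) * h0
  generalize f (f (f (f (f h)))) = w at *
  generalize f (f (f (f h))) = v at *
  generalize f (f (f h)) = u at *
  generalize f (f (f (f σ))) = s4 at *
  generalize f (f σ) = s2 at *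
  generalize f (f h) = z at *
  generalize f h = y at *
  have x0 : h ≠ 0 := fun e => by simp [e] at hh
  have y0 : y ≠ 0 := fun e => by simp [e] at U1
  have z0 : z ≠ 0 := fun e => by simp [e] at U2
  have hu : u = -1 / h := by field_simp; linear_combination hh
  have hv : v = -1 / y := by field_simp; linear_combination U1
  have hw : w = -1 / z := by field_simp; linear_combination U2
  subst hu hv hw
  have A0 : σ * s2 = -((y + h) * (z + y)) / (h * y) := by
    field_simp; linear_combination hσ
  have A2 : s2 * s4 = -((h * z - 1) * (y + h)) / (h * y * z) := by
    field_simp at E2 ⊢; linear_combination -E2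
  have A4 : s4 * σ = (z + y) * (h * z - 1) / z := by
    field_simp at E4 ⊢; linear_combination E4
  have key : σ ^ 2 * (s2 * s4) = (σ * s2) * (s4 * σ) := by ring
  rw [A0, A2, A4] at key
  have key2 : ((y + h) * (h * z - 1)) * (σ ^ 2 - (z + y) ^ 2) = 0 := by
    field_simp at key
    linear_combination (-((y + h) * (h * z - 1))) * key
  have := (mul_eq_zero.mp key2).resolve_left (mul_ne_zero N1 N2)
  exact sq_eq_sq_iff_eq_or_eq_neg.mp (by linear_combination this)
end

section
/- Let q be an odd prime power, F a finite field with q^6 elements, and h ∈ F with h^(q^3+1) = −1. Then the linear set 𝓛_h is not PΓL-equivalent to L^3_δ for any δ ∈ F with δ^(q^3+1) ∉ {0, 1}. -/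
/-- The linear set `L_f` in `ℙ(F × F)` of a map `f : F → F`: the set of projective
points (F-spans) `[(x, f x)]` for `x ∈ F`, `x ≠ 0`. -/
def linearSet {F : Type} [Field F] (f : F → F) : Set (Projectivization F (F × F)) :=
  {P | ∃ (x : F) (hx : x ≠ 0),
    P = Projectivization.mk F (x, f x) (fun h0 => hx (congrArg Prod.fst h0))}

/-- Two subsets of `ℙ(F × F)` are PΓL-equivalent if there exist a field automorphism
`ρ` of `F` and a bijective `ρ`-semilinear map `g : F × F → F × F` whose induced map on
`ℙ(F × F)` maps `L` onto `L'`. (A bijective additive `ρ`-semilinear map sends nonzero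
vectors to nonzero vectors, so the induced map on projective points is total; requiring
the membership equivalence for all nonzero `v` says exactly that the induced bijection
maps `L` onto `L'`.) -/
def IsPGammaLEquiv {F : Type} [Field F] (L L' : Set (Projectivization F (F × F))) : Prop :=
  ∃ (ρ : F ≃+* F) (g : (F × F) ≃ (F × F)),
    (∀ u v : F × F, g (u + v) = g u + g v) ∧
    (∀ (c : F) (v : F × F), g (c • v) = ρ c • g v) ∧
    (∀ (v : F × F) (hv : v ≠ 0) (hgv : g v ≠ 0),
      (Projectivization.mk F v hv ∈ L ↔ Projectivization.mk F (g v) hgv ∈ L'))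

/-- The `q`-polynomial `f_h(x) = h^(q−1)·x^q − h^(q^2−1)·x^(q^2) + x^(q^4) + x^(q^5)`. -/
def fpol (q : ℕ) {F : Type} [Field F] (h : F) : F → F :=
  fun x => h ^ (q - 1) * x ^ q - h ^ (q ^ 2 - 1) * x ^ (q ^ 2) + x ^ (q ^ 4) + x ^ (q ^ 5)


namespace Stmt10Aux

open Finset
open scoped Fin.CommRing

set_option linter.unusedSectionVars false
set_option linter.unusedSimpArgs false

/-- `q`-polynomials with coefficients `a`. -/
def Q {F : Type} [Field F] (q : ℕ) (a : Fin 6 → F) (x : F) : F :=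
  ∑ i : Fin 6, a i * x ^ (q ^ (i : ℕ))

section
variable {F : Type} [Field F] [Fintype F] [DecidableEq F] {q : ℕ}

theorem Q_pow (hadd : ∀ x y : F, (x + y) ^ q = x ^ q + y ^ q) (hper : ∀ x : F, x ^ (q ^ 6) = x)
    (a : Fin 6 → F) (x : F) : (Q q a x) ^ q = Q q (fun i => a (i - 1) ^ q) x := by
  have e : ∀ k : ℕ, (x ^ (q ^ k)) ^ q = x ^ (q ^ (k + 1)) := fun k => by rw [← pow_mul, ← pow_succ]
  have e0 : (0 : Fin 6) - 1 = 5 := by decide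
  have e1 : (1 : Fin 6) - 1 = 0 := by decide
  have e2 : (2 : Fin 6) - 1 = 1 := by decide
  have e3 : (3 : Fin 6) - 1 = 2 := by decide
  have e4 : (4 : Fin 6) - 1 = 3 := by decide
  have e5 : (5 : Fin 6) - 1 = 4 := by decide
  simp only [Q, Fin.sum_univ_six, hadd, mul_pow, e, e0, e1, e2, e3, e4, e5]
  simp only [Fin.val_zero, Fin.val_one, Fin.val_ofNat, Nat.reduceMod, Nat.reduceAdd, Fin.isValue,
    Fin.coe_ofNat_eq_mod, hper, pow_zero, pow_one, zero_add]
  ring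

theorem Q_pow' (hadd : ∀ x y : F, (x + y) ^ q = x ^ q + y ^ q) (hper : ∀ x : F, x ^ (q ^ 6) = x)
    (k : ℕ) (a : Fin 6 → F) (x : F) :
    (Q q a x) ^ (q ^ k) = Q q (fun i => a (i - (k : Fin 6)) ^ (q ^ k)) x := by
  induction k with
  | zero => simp
  | succ k ih =>
    rw [pow_succ, pow_mul, ih, Q_pow hadd hper]
    congr 1
    funext i
    rw [← pow_mul]
    congr 2
    push_cast
    ring

theorem Q_add (a b : Fin 6 → F) (x : F) : Q q a x + Q q b x = Q q (fun i => a i + b i) x := by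
  simp [Q, add_mul, Finset.sum_add_distrib]

theorem Q_smul (c : F) (a : Fin 6 → F) (x : F) : c * Q q a x = Q q (fun i => c * a i) x := by
  simp [Q, Finset.mul_sum, mul_assoc]

theorem Q_comp (hadd : ∀ x y : F, (x + y) ^ q = x ^ q + y ^ q) (hper : ∀ x : F, x ^ (q ^ 6) = x)
    (a b : Fin 6 → F) (x : F) :
    Q q b (Q q a x) = Q q (fun i => ∑ k : Fin 6, b k * a (i - k) ^ (q ^ (k : ℕ))) x := by
  conv_lhs => rw [Q]
  simp only [Q_pow' hadd hper, Q_smul]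
  simp only [Q, Finset.sum_mul]
  rw [Finset.sum_comm]
  simp

theorem pow_add' (hadd : ∀ x y : F, (x + y) ^ q = x ^ q + y ^ q) (k : ℕ) (x y : F) :
    (x + y) ^ (q ^ k) = x ^ (q ^ k) + y ^ (q ^ k) := by
  induction k with
  | zero => simp
  | succ k ih => rw [pow_succ, pow_mul, ih, hadd, ← pow_mul, ← pow_mul]

theorem Q_map_add (hadd : ∀ x y : F, (x + y) ^ q = x ^ q + y ^ q) (a : Fin 6 → F) (x y : F) :
    Q q a (x + y) = Q q a x + Q q a y := by
  simp [Q, pow_add' hadd, mul_add, Finset.sum_add_distrib]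

theorem Q_inv (hadd : ∀ x y : F, (x + y) ^ q = x ^ q + y ^ q) (hper : ∀ x : F, x ^ (q ^ 6) = x)
    (a : Fin 6 → F) (hb : Function.Bijective (Q q a)) :
    ∃ b : Fin 6 → F, ∀ x, Q q b (Q q a x) = x := by
  let e : Equiv.Perm F := Equiv.ofBijective _ hb
  have hk : ∀ k : ℕ, ∃ b : Fin 6 → F, ∀ x, Q q b x = (e ^ k) x := by
    intro k
    induction k with
    | zero =>
      refine ⟨![1, 0, 0, 0, 0, 0], fun x => ?_⟩
      simp [Q, Fin.sum_univ_six]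
    | succ k ih =>
      obtain ⟨b, hb⟩ := ih
      refine ⟨fun i => ∑ k : Fin 6, b k * a (i - k) ^ (q ^ (k : ℕ)), fun x => ?_⟩
      rw [pow_succ, Equiv.Perm.mul_apply, ← hb]
      change _ = Q q b (Q q a x)
      rw [Q_comp hadd hper]
  obtain ⟨b, hb'⟩ := hk (orderOf e - 1)
  refine ⟨b, fun x => ?_⟩
  rw [hb']
  change (e ^ (orderOf e - 1)) (e x) = x
  rw [← Equiv.Perm.mul_apply, ← pow_succ, Nat.sub_add_cancel (orderOf_pos e), pow_orderOf_eq_one]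
  rfl

theorem psum (hF : Fintype.card F = q ^ 6) (m n : ℕ) (hm : m < q ^ 6 - 1) (hn : n < q ^ 6 - 1) :
    ∑ x : Fˣ, (x : F) ^ m * ((x : F) ^ n)⁻¹ = if m = n then -1 else 0 := by
  have h1 : ∀ x : Fˣ, (x : F) ^ m * ((x : F) ^ n)⁻¹ = (x : F) ^ (m + (q ^ 6 - 1 - n)) := by
    intro x
    have h2 : (x : F) ^ (q ^ 6 - 1) = 1 := by
      rw [← hF]; exact FiniteField.pow_card_sub_one_eq_one _ x.ne_zero
    have h3 : (x : F) ^ (q ^ 6 - 1 - n) * (x : F) ^ n = 1 := by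
      rw [← pow_add, Nat.sub_add_cancel hn.le, h2]
    rw [pow_add, eq_inv_of_mul_eq_one_left h3]
  simp only [h1]
  rw [FiniteField.sum_pow_units, hF]
  congr 1
  apply propext
  constructor
  · rintro ⟨c, hc⟩
    rcases c with _ | _ | c
    · omega
    · omega
    · exfalso
      have : (q ^ 6 - 1) * 2 ≤ (q ^ 6 - 1) * (c + 1 + 1) := Nat.mul_le_mul_left _ (by omega)
      omega
  · rintro rfl
    exact ⟨1, by omega⟩

theorem pows (hq : 3 ≤ q) : 3 * q ≤ q ^ 2 ∧ 3 * q ^ 2 ≤ q ^ 3 ∧ 3 * q ^ 3 ≤ q ^ 4 ∧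
    3 * q ^ 4 ≤ q ^ 5 ∧ 3 * q ^ 5 ≤ q ^ 6 := by
  have : ∀ k, 3 * q ^ k ≤ q ^ (k + 1) := fun k => by
    rw [pow_succ, mul_comm]; exact Nat.mul_le_mul_left _ hq
  exact ⟨by simpa using this 1, this 2, this 3, this 4, this 5⟩

theorem sum1 (hF : Fintype.card F = q ^ 6) (hq : 3 ≤ q) (a : Fin 6 → F) (k : Fin 6) :
    ∑ x : Fˣ, Q q a x * ((x : F) ^ (q ^ (k : ℕ)))⁻¹ = - a k := by
  obtain ⟨h1, h2, h3, h4, h5⟩ := pows hq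
  have hlt : ∀ i : Fin 6, q ^ (i : ℕ) < q ^ 6 - 1 := by
    intro i; fin_cases i <;> simp <;> omega
  simp only [Q, Finset.sum_mul, mul_assoc]
  rw [Finset.sum_comm]
  simp only [← Finset.mul_sum]
  simp only [psum hF _ _ (hlt _) (hlt k)]
  have : ∀ i : Fin 6, q ^ (i : ℕ) = q ^ (k : ℕ) ↔ i = k := by
    intro i
    rw [Nat.pow_right_inj (by omega), Fin.ext_iff]
  simp [this]

theorem Q_inj (hF : Fintype.card F = q ^ 6) (hq : 3 ≤ q) (a b : Fin 6 → F)
    (h : ∀ x, Q q a x = Q q b x) (k : Fin 6) : a k = b k := by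
  have h1 := sum1 hF hq a k
  have h2 := sum1 hF hq b k
  simp only [h] at h1
  exact neg_injective (h1.symm.trans h2)

theorem sum2 (hF : Fintype.card F = q ^ 6) (hq : 3 ≤ q) (a b : Fin 6 → F) (k : Fin 6)
    (hk : k ≠ 0) :
    ∑ x : Fˣ, Q q a x * Q q b x * ((x : F) ^ (1 + q ^ (k : ℕ)))⁻¹ = - (a 0 * b k + a k * b 0) := by
  obtain ⟨h1, h2, h3, h4, h5⟩ := pows hq
  have hlt : ∀ i : Fin 6, q ^ (i : ℕ) ≤ q ^ 5 := by
    intro i; exact Nat.pow_le_pow_right (by omega) (by omega)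
  have hS : ∀ i j : Fin 6, ∑ x : Fˣ, (x : F) ^ (q ^ (i : ℕ) + q ^ (j : ℕ)) *
      ((x : F) ^ (1 + q ^ (k : ℕ)))⁻¹ =
      if q ^ (i : ℕ) + q ^ (j : ℕ) = 1 + q ^ (k : ℕ) then -1 else 0 := by
    intro i j
    apply psum hF
    · have := hlt i; have := hlt j; omega
    · have := hlt k; omega
  have hN : ∀ i j : Fin 6, q ^ (i : ℕ) + q ^ (j : ℕ) = 1 + q ^ (k : ℕ) ↔
      (i = 0 ∧ j = k) ∨ (i = k ∧ j = 0) := by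
    intro i j
    fin_cases k
    · exact absurd rfl hk
    all_goals (fin_cases i <;> fin_cases j <;> simp <;> omega)
  have : ∀ x : F, Q q a x * Q q b x * (x ^ (1 + q ^ (k : ℕ)))⁻¹ =
      ∑ i : Fin 6, ∑ j : Fin 6, (a i * b j) * (x ^ (q ^ (i : ℕ) + q ^ (j : ℕ)) *
      (x ^ (1 + q ^ (k : ℕ)))⁻¹) := by
    intro x
    rw [Q, Q, Finset.sum_mul_sum, Finset.sum_mul]
    simp only [Finset.sum_mul]
    refine Finset.sum_congr rfl fun i _ => Finset.sum_congr rfl fun j _ => ?_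
    rw [pow_add x (q ^ (i : ℕ)) (q ^ (j : ℕ))]
    ring
  simp only [this]
  rw [Finset.sum_comm]
  simp only [fun i : Fin 6 => Finset.sum_comm (s := (Finset.univ : Finset Fˣ))
    (t := (Finset.univ : Finset (Fin 6)))
    (f := fun x j => (a i * b j) * ((x : F) ^ (q ^ (i : ℕ) + q ^ (j : ℕ)) *
      ((x : F) ^ (1 + q ^ (k : ℕ)))⁻¹)), ← Finset.mul_sum, hS, hN]
  fin_cases k
  · exact absurd rfl hk
  all_goals
    simp [Fin.sum_univ_six]
    try ring

theorem sum3 (hF : Fintype.card F = q ^ 6) (α β γ ε ζ η : F) (i j k l m n N : ℕ)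
    (hN : N < q ^ 6 - 1) (hb : max i j + max k l + max m n < q ^ 6 - 1) :
    ∑ x : Fˣ, (α * (x : F) ^ i + β * (x : F) ^ j) * (γ * (x : F) ^ k + ε * (x : F) ^ l) *
      (ζ * (x : F) ^ m + η * (x : F) ^ n) * ((x : F) ^ N)⁻¹ =
    α * γ * ζ * (if i + k + m = N then -1 else 0) + α * γ * η * (if i + k + n = N then -1 else 0) +
    α * ε * ζ * (if i + l + m = N then -1 else 0) + α * ε * η * (if i + l + n = N then -1 else 0) +
    β * γ * ζ * (if j + k + m = N then -1 else 0) + β * γ * η * (if j + k + n = N then -1 else 0) +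
    β * ε * ζ * (if j + l + m = N then -1 else 0) +
    β * ε * η * (if j + l + n = N then -1 else 0) := by
  rw [← psum hF (i + k + m) N (by omega) hN, ← psum hF (i + k + n) N (by omega) hN,
    ← psum hF (i + l + m) N (by omega) hN, ← psum hF (i + l + n) N (by omega) hN,
    ← psum hF (j + k + m) N (by omega) hN, ← psum hF (j + k + n) N (by omega) hN,
    ← psum hF (j + l + m) N (by omega) hN, ← psum hF (j + l + n) N (by omega) hN]
  simp only [Finset.mul_sum, ← Finset.sum_add_distrib]
  refine Finset.sum_congr rfl fun x _ => ?_
  simp only [pow_add]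
  ring

/-- The sum over the points of a linear set, in terms of the fibres. -/
theorem sum_fibre {p : ℕ} (hp : p.Prime) [CharP F p] {s : ℕ} (hF : Fintype.card F = p ^ s)
    (f : F → F) (hf : ∀ x y, f (x + y) = f x + f y) (φ : F → F) :
    ∑ x : Fˣ, φ (f x * (x : F)⁻¹) =
      - ∑ l ∈ Finset.univ.image (fun x : Fˣ => f x * (x : F)⁻¹), φ l := by
  rw [← Finset.sum_fiberwise_of_maps_to (s := Finset.univ)
    (t := Finset.univ.image (fun x : Fˣ => f x * (x : F)⁻¹))
    (g := fun x : Fˣ => f x * (x : F)⁻¹) (fun x hx => Finset.mem_image_of_mem _ hx)]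
  rw [← Finset.sum_neg_distrib]
  refine Finset.sum_congr rfl fun l hl => ?_
  rw [Finset.sum_congr rfl (g := fun _ => φ l) (fun x hx => by
    rw [(Finset.mem_filter.1 hx).2])]
  rw [Finset.sum_const, nsmul_eq_mul]
  have h0 : f 0 = 0 := by simpa using hf 0 0
  let H : AddSubgroup F := AddMonoidHom.ker
    ({ toFun := fun x => f x - l * x, map_zero' := by simp [h0],
       map_add' := fun x y => by rw [hf]; ring } : F →+ F)
  have hH : ∀ x, x ∈ H ↔ f x = l * x := by
    intro x
    rw [AddMonoidHom.mem_ker]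
    exact sub_eq_zero
  have hc : Nat.card H = (Finset.univ.filter (fun x : Fˣ => f x * (x : F)⁻¹ = l)).card + 1 := by
    have : (H : Set F) = ((insert 0 ((Finset.univ.filter
        (fun x : Fˣ => f x * (x : F)⁻¹ = l)).map ⟨_, Units.val_injective⟩) : Finset F) : Set F) := by
      ext x
      simp only [SetLike.mem_coe, hH, Finset.coe_insert, Finset.coe_map, Set.mem_insert_iff,
        Set.mem_image, Finset.mem_filter, Finset.mem_univ, true_and,
        Function.Embedding.coeFn_mk]
      constructor
      · intro hx
        by_cases h : x = 0
        · exact Or.inl h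
        · exact Or.inr ⟨Units.mk0 x h, by simp [hx, h], rfl⟩
      · rintro (rfl | ⟨y, hy, rfl⟩)
        · simp [h0]
        · rw [← hy]; simp
    have h2 : Nat.card H = (H : Set F).ncard := rfl
    rw [h2, this, Set.ncard_coe_finset, Finset.card_insert_of_notMem, Finset.card_map]
    simp
  have hd : Nat.card H ∣ p ^ s := by
    rw [← hF, ← Nat.card_eq_fintype_card]; exact AddSubgroup.card_addSubgroup_dvd_card H
  have hpos : 0 < (Finset.univ.filter (fun x : Fˣ => f x * (x : F)⁻¹ = l)).card := by
    obtain ⟨x, _, hx⟩ := Finset.mem_image.1 hl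
    exact Finset.card_pos.2 ⟨x, by simp [hx]⟩
  have hpd : p ∣ Nat.card H := by
    obtain ⟨k, _, hk⟩ := (Nat.dvd_prime_pow hp).1 hd
    rcases k with _ | k
    · rw [pow_zero] at hk; omega
    · rw [hk]; exact dvd_pow_self _ (by omega)
  have h1 := (CharP.cast_eq_zero_iff F p _).2 hpd
  rw [hc] at h1
  push_cast at h1
  rw [eq_neg_of_add_eq_zero_left h1]
  ring

theorem shape (hF : Fintype.card F = q ^ 6) (hq : 3 ≤ q)
    (hadd : ∀ x y : F, (x + y) ^ q = x ^ q + y ^ q) (hper : ∀ x : F, x ^ (q ^ 6) = x)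
    (a : Fin 6 → F) (δ : F) (hδ : δ ≠ 0)
    (hs : ∀ φ : F → F, ∑ x : Fˣ, φ (Q q a x * (x : F)⁻¹) =
      ∑ x : Fˣ, φ (Q q ![0, 1, 0, 0, δ, 0] x * (x : F)⁻¹)) :
    a 0 = 0 ∧ a 3 = 0 ∧ ((a 2 = 0 ∧ a 5 = 0 ∧ a 1 ≠ 0) ∨ (a 1 = 0 ∧ a 4 = 0 ∧ a 2 ≠ 0)) := by
  have hq0 : q ≠ 0 := by omega
  obtain ⟨h1, h2, h3, h4, h5⟩ := pows hq
  have ha0 : a 0 = 0 := by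
    have e := hs id
    have e1 := sum1 hF hq a 0
    have e2 := sum1 hF hq ![0, 1, 0, 0, δ, 0] 0
    simp only [Fin.val_zero, pow_zero, pow_one] at e1 e2
    simp only [id] at e
    rw [e1, e2] at e
    simpa using e
  have hk : ∀ k : Fin 6, k ≠ 0 → a k * a (0 - k) ^ q ^ (k : ℕ) =
      (![0, 1, 0, 0, δ, 0] : Fin 6 → F) k *
        (![0, 1, 0, 0, δ, 0] : Fin 6 → F) (0 - k) ^ q ^ (k : ℕ) := by
    intro k hk
    have key : ∀ (c : Fin 6 → F), c 0 = 0 → ∑ x : Fˣ, (Q q c x * (x : F)⁻¹) ^ (1 + q ^ (k : ℕ)) =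
        - (c k * c (0 - k) ^ q ^ (k : ℕ)) := by
      intro c hc
      have : ∀ x : F, (Q q c x * x⁻¹) ^ (1 + q ^ (k : ℕ)) = Q q c x *
          Q q (fun i => c (i - k) ^ (q ^ (k : ℕ))) x * (x ^ (1 + q ^ (k : ℕ)))⁻¹ := by
        intro x
        have := Q_pow' hadd hper (k : ℕ) c x
        rw [Fin.cast_val_eq_self] at this
        rw [← this]
        simp only [mul_pow, pow_add, pow_one, inv_pow, mul_inv]
        ring
      simp only [this]
      rw [sum2 hF hq _ _ k hk, hc]
      ring
    have e := hs (fun t => t ^ (1 + q ^ (k : ℕ)))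
    rw [key a ha0, key _ (by simp)] at e
    exact neg_injective e
  have k1 := hk 1 (by decide)
  have k2 := hk 2 (by decide)
  have k3 := hk 3 (by decide)
  rw [show (0 : Fin 6) - 1 = 5 by decide] at k1
  rw [show (0 : Fin 6) - 2 = 4 by decide] at k2
  rw [show (0 : Fin 6) - 3 = 3 by decide] at k3
  simp [hq0] at k1 k2 k3
  have e3 := hs (fun t => t ^ (1 + q + q ^ 2))
  have two : ∀ (c d : F) (i j : Fin 6), i ≠ j → ∀ b : Fin 6 → F, b i = c → b j = d →
      (∀ k, k ≠ i → k ≠ j → b k = 0) → ∀ x : F,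
      Q q b x = c * x ^ q ^ (i : ℕ) + d * x ^ q ^ (j : ℕ) := by
    intro c d i j hij b hc hd hz x
    rw [Q, Finset.sum_eq_add i j hij (fun k _ hk => by rw [hz k hk.1 hk.2, zero_mul])
      (by simp) (by simp), hc, hd]
  have cub : ∀ (c d : F) (i j : ℕ) (x : F),
      ((c * x ^ q ^ i + d * x ^ q ^ j) * x⁻¹) ^ (1 + q + q ^ 2) =
      (c * x ^ q ^ i + d * x ^ q ^ j) * (c ^ q * x ^ q ^ (i + 1) + d ^ q * x ^ q ^ (j + 1)) *
      (c ^ q ^ 2 * x ^ q ^ (i + 2) + d ^ q ^ 2 * x ^ q ^ (j + 2)) * (x ^ (1 + q + q ^ 2))⁻¹ := by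
    intro c d i j x
    have := pow_add' hadd 2 (c * x ^ q ^ i) (d * x ^ q ^ j)
    rw [mul_pow, pow_add (c * x ^ q ^ i + d * x ^ q ^ j), pow_add (c * x ^ q ^ i + d * x ^ q ^ j),
      pow_one, this, hadd]
    simp only [mul_pow, ← pow_mul, ← pow_add, inv_pow]
    ring
  have eg : ∑ x : Fˣ, (Q q ![0, 1, 0, 0, δ, 0] x * (x : F)⁻¹) ^ (1 + q + q ^ 2) = - δ ^ q ^ 2 := by
    simp only [two 1 δ 1 4 (by decide) ![0, 1, 0, 0, δ, 0] (by simp) (by simp)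
      (by intro k; fin_cases k <;> simp), cub]
    simp only [Fin.coe_ofNat_eq_mod, Nat.reduceMod, Nat.reduceAdd, hper]
    have := fun x : F => pow_one x
    have hz : ∀ x : Fˣ, (x : F) = (x : F) ^ 1 := fun x => (pow_one _).symm
    have s := sum3 hF 1 δ (1 ^ q) (δ ^ q) (1 ^ q ^ 2) (δ ^ q ^ 2) q (q ^ 4) (q ^ 2) (q ^ 5)
      (q ^ 3) 1 (1 + q + q ^ 2) (by omega) (by
        rw [max_eq_right (by omega), max_eq_right (by omega), max_eq_left (by omega)]
        omega)
    rw [if_neg (by omega), if_pos (by omega), if_neg (by omega), if_neg (by omega),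
      if_neg (by omega), if_neg (by omega), if_neg (by omega), if_neg (by omega)] at s
    simp only [pow_one, one_pow, one_mul, mul_one, mul_zero, zero_add, add_zero] at s ⊢
    rw [s]
    ring
  rw [eg] at e3
  have hne : ¬ (∑ x : Fˣ, (Q q a x * (x : F)⁻¹) ^ (1 + q + q ^ 2) = 0) := by
    rw [e3, neg_eq_zero]
    exact pow_ne_zero _ hδ
  refine ⟨ha0, k3, ?_⟩
  have z12 : ¬ (a 5 = 0 ∧ a 4 = 0) := by
    rintro ⟨z5, z4⟩
    apply hne
    simp only [two (a 1) (a 2) 1 2 (by decide) a rfl rfl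
      (by intro k; fin_cases k <;> simp [ha0, k3, z4, z5]), cub]
    simp only [Fin.coe_ofNat_eq_mod, Nat.reduceMod, Nat.reduceAdd, hper, pow_one]
    rw [sum3 hF _ _ _ _ _ _ _ _ _ _ _ _ _ (by omega) (by
        rw [max_eq_right (by omega), max_eq_right (by omega), max_eq_right (by omega)]
        omega)]
    rw [if_neg (by omega), if_neg (by omega), if_neg (by omega), if_neg (by omega),
      if_neg (by omega), if_neg (by omega), if_neg (by omega), if_neg (by omega)]
    simp
  have z54 : ¬ (a 1 = 0 ∧ a 2 = 0) := by
    rintro ⟨z1, z2⟩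
    apply hne
    simp only [two (a 4) (a 5) 4 5 (by decide) a rfl rfl
      (by intro k; fin_cases k <;> simp [ha0, k3, z1, z2]), cub]
    have e7 : ∀ x : F, x ^ q ^ 7 = x ^ q := fun x => by
      rw [pow_succ, pow_mul, hper]
    simp only [Fin.coe_ofNat_eq_mod, Nat.reduceMod, Nat.reduceAdd, hper, e7]
    have s := sum3 hF (a 4) (a 5) (a 4 ^ q) (a 5 ^ q) (a 4 ^ q ^ 2) (a 5 ^ q ^ 2)
      (q ^ 4) (q ^ 5) (q ^ 5) 1
      1 q (1 + q + q ^ 2) (by omega) (by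
        rw [max_eq_right (by omega), max_eq_left (by omega), max_eq_right (by omega)]
        omega)
    rw [if_neg (by omega), if_neg (by omega), if_neg (by omega), if_neg (by omega),
      if_neg (by omega), if_neg (by omega), if_neg (by omega), if_neg (by omega)] at s
    simp only [pow_one, mul_zero, add_zero] at s
    exact s
  tauto

theorem alg (hF : Fintype.card F = q ^ 6) (hq : 3 ≤ q) (hodd : Odd q)
    (hadd : ∀ x y : F, (x + y) ^ q = x ^ q + y ^ q) (hper : ∀ x : F, x ^ (q ^ 6) = x)
    (h2 : (2 : F) ≠ 0)
    (h : F) (hh : h ^ (q ^ 3 + 1) = -1) (A B C D : F) (a : Fin 6 → F)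
    (ha0 : a 0 = 0) (ha3 : a 3 = 0)
    (ha : (a 2 = 0 ∧ a 5 = 0 ∧ a 1 ≠ 0) ∨ (a 1 = 0 ∧ a 4 = 0 ∧ a 2 ≠ 0))
    (hc : ∀ x, Q q ![C, D * (h ^ q / h), -(D * (h ^ q ^ 2 / h)), 0, D, D] x =
      Q q a (Q q ![A, B * (h ^ q / h), -(B * (h ^ q ^ 2 / h)), 0, B, B] x)) :
    B = 0 ∧ D = 0 := by
  have hq0 : q ≠ 0 := by omega
  have h0 : h ≠ 0 := by
    rintro rfl
    rw [zero_pow (by omega)] at hh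
    exact one_ne_zero (neg_eq_zero.1 hh.symm)
  have hneg : ∀ (x : F) (k : ℕ), (-x) ^ q ^ k = - x ^ q ^ k := fun x k => (hodd.pow).neg_pow x
  have hneg1 : ∀ (x : F), (-x) ^ q = - x ^ q := fun x => hodd.neg_pow x
  have h3 : h ^ q ^ 3 = - 1 / h := by
    rw [pow_add, pow_one] at hh
    field_simp
    exact hh
  have h1' : h ^ q ≠ 0 := pow_ne_zero _ h0
  have h2' : h ^ q ^ 2 ≠ 0 := pow_ne_zero _ h0
  have h4 : h ^ q ^ 4 = - 1 / h ^ q := by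
    rw [pow_succ, pow_mul, h3, div_pow, hneg1, one_pow]
  have h5 : h ^ q ^ 5 = - 1 / h ^ q ^ 2 := by
    rw [pow_succ, pow_mul, h4, div_pow, hneg1, one_pow, ← pow_mul, pow_two]
  have e7 : ∀ x : F, x ^ q ^ 7 = x ^ q := fun x => by
    rw [pow_succ, pow_mul, hper]
  have hs : h + h ^ q ≠ 0 := by
    intro e
    have e1 : h ^ q = - h := by linear_combination e
    have e2 : h ^ q ^ 2 = h := by rw [pow_two, pow_mul, e1, hneg1, e1, neg_neg]
    have e3 : h ^ q ^ 3 = - h := by rw [pow_succ, pow_mul, e2, e1]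
    rw [h3] at e3
    have e4 : (h - 1) * (h + 1) = 0 := by
      field_simp at e3
      linear_combination e3
    rcases mul_eq_zero.1 e4 with e5 | e5
    · have : h = 1 := by linear_combination e5
      rw [this, one_pow] at e1
      apply h2; linear_combination e1
    · have : h = -1 := by linear_combination e5
      rw [this, hneg1, one_pow] at e1
      apply h2; linear_combination -e1
  have ht : h * h ^ q ^ 2 - 1 ≠ 0 := by
    intro e
    apply hs
    have e1 : h * h ^ q ^ 2 = 1 := by linear_combination e
    have e2 : (h * h ^ q ^ 2) ^ q = 1 := by rw [e1, one_pow]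
    rw [mul_pow, ← pow_mul, ← pow_succ, h3] at e2
    field_simp at e2
    linear_combination -e2
  simp only [Q_comp hadd hper] at hc
  have hk := Q_inj hF hq _ _ hc
  have k1 := hk 1
  have k2 := hk 2
  have k3 := hk 3
  have k4 := hk 4
  have k5 := hk 5
  clear hk hc
  simp only [Fin.sum_univ_six, ha0, ha3, zero_mul, zero_add, add_zero] at k1 k2 k3 k4 k5
  have s : (1 : Fin 6) - 1 = 0 ∧ (1 : Fin 6) - 2 = 5 ∧ (1 : Fin 6) - 4 = 3 ∧ (1 : Fin 6) - 5 = 2 ∧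
      (2 : Fin 6) - 1 = 1 ∧ (2 : Fin 6) - 2 = 0 ∧ (2 : Fin 6) - 4 = 4 ∧ (2 : Fin 6) - 5 = 3 ∧
      (3 : Fin 6) - 1 = 2 ∧ (3 : Fin 6) - 2 = 1 ∧ (3 : Fin 6) - 4 = 5 ∧ (3 : Fin 6) - 5 = 4 ∧
      (4 : Fin 6) - 1 = 3 ∧ (4 : Fin 6) - 2 = 2 ∧ (4 : Fin 6) - 4 = 0 ∧ (4 : Fin 6) - 5 = 5 ∧
      (5 : Fin 6) - 1 = 4 ∧ (5 : Fin 6) - 2 = 3 ∧ (5 : Fin 6) - 4 = 1 ∧ (5 : Fin 6) - 5 = 0 := by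
    decide
  obtain ⟨s1, s2, s3, s4, s5, s6, s7, s8, s9, s10, s11, s12, s13, s14, s15, s16, s17, s18, s19,
    s20⟩ := s
  have v : ∀ x0 x1 x2 x3 x4 x5 : F, (![x0, x1, x2, x3, x4, x5] : Fin 6 → F) 0 = x0 ∧
      (![x0, x1, x2, x3, x4, x5] : Fin 6 → F) 1 = x1 ∧
      (![x0, x1, x2, x3, x4, x5] : Fin 6 → F) 2 = x2 ∧
      (![x0, x1, x2, x3, x4, x5] : Fin 6 → F) 3 = x3 ∧
      (![x0, x1, x2, x3, x4, x5] : Fin 6 → F) 4 = x4 ∧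
      (![x0, x1, x2, x3, x4, x5] : Fin 6 → F) 5 = x5 := fun _ _ _ _ _ _ =>
    ⟨rfl, rfl, rfl, rfl, rfl, rfl⟩
  have pw : ∀ i j, (h ^ q ^ i) ^ q ^ j = h ^ q ^ (i + j) := fun i j => by
    rw [← pow_mul, ← pow_add]
  have pw1 : ∀ j, (h ^ q) ^ q ^ j = h ^ q ^ (1 + j) := fun j => by
    rw [← pow_mul, pow_add, pow_one]
  have pw2 : ∀ j, (h ^ q ^ j) ^ q = h ^ q ^ (j + 1) := fun j => by
    rw [← pow_mul, ← pow_succ]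
  have pw3 : (h ^ q) ^ q = h ^ q ^ 2 := by
    rw [← pow_mul, pow_two]
  have zp : ∀ k, (0 : F) ^ q ^ k = 0 := fun k => zero_pow (pow_ne_zero _ hq0)
  simp only [s1, s2, s3, s4, s5, s6, s7, s8, s9, s10, s11, s12, s13, s14, s15, s16, s17, s18, s19,
    s20, v, Fin.coe_ofNat_eq_mod, Nat.reduceMod, hneg, mul_pow, div_pow, pow_one, pw, pw1, pw2, pw3,
    Nat.reduceAdd, hper, e7, h3, h4, h5, hneg1, zp, mul_zero, add_zero, zero_add, zero_pow hq0]
    at k1 k2 k3 k4 k5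
  have hBz : B = 0 := by
    rcases ha with ⟨z2, z5, n1⟩ | ⟨z1, z4, n2⟩
    · simp only [z2, z5, zero_mul, add_zero] at k2 k3 k5
      by_contra hB
      have hB1 : B ^ q ≠ 0 := pow_ne_zero _ hB
      have hm : (a 1 * B ^ q) * ((h * h ^ q ^ 2 - 1) * (h + h ^ q)) = 0 := by
        generalize B ^ q = B1 at *
        generalize B ^ q ^ 4 = B4 at *
        generalize h ^ q = x1 at *
        generalize h ^ q ^ 2 = x2 at *
        linear_combination (norm := skip) (h * x1 * x2) * (-k5 + (-(h / x2)) * k2 +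
          (h + x1) / x2 * k3)
        field_simp
        ring
      exact (mul_ne_zero (mul_ne_zero n1 hB1) (mul_ne_zero ht hs)) hm
    · simp only [z1, z4, zero_mul, zero_add, add_zero] at k1 k3 k4
      by_contra hB
      have hB1 : B ^ q ^ 2 ≠ 0 := pow_ne_zero _ hB
      have hm : (a 2 * B ^ q ^ 2) * ((h * h ^ q ^ 2 - 1) * (h + h ^ q)) = 0 := by
        generalize B ^ q ^ 2 = B2 at *
        generalize B ^ q ^ 5 = B5 at *
        generalize h ^ q = x1 at *
        generalize h ^ q ^ 2 = x2 at *
        linear_combination (norm := skip) (h * x1 * x2) * (-(h / x1) * k1 + k4 +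
          (h * x2 - 1) * k3)
        field_simp
        ring
      exact (mul_ne_zero (mul_ne_zero n2 hB1) (mul_ne_zero ht hs)) hm
  refine ⟨hBz, ?_⟩
  rcases ha with ⟨z2, z5, n1⟩ | ⟨z1, z4, n2⟩
  · simpa [hBz, z2, z5, hq0, h0] using k5
  · simpa [hBz, z1, z4, hq0, h0] using k4

end

end Stmt10Aux

/-- Let `q` be an odd prime power, `F` a finite field with `q^6` elements,
and `h ∈ F` with `h^(q^3+1) = −1`. Then the linear set `𝓛_h` is not PΓL-equivalent to
`L^3_δ` (defined by `x^q + δ·x^(q^4)`) for any `δ` with `δ^(q^3+1) ∉ {0, 1}`. -/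
theorem stmt10 (q : ℕ) (hq : IsPrimePow q) (hodd : Odd q)
    (F : Type) [Field F] [Fintype F] (hF : Fintype.card F = q ^ 6)
    (h : F) (hh : h ^ (q ^ 3 + 1) = -1) :
    ∀ δ : F, δ ^ (q ^ 3 + 1) ≠ 0 → δ ^ (q ^ 3 + 1) ≠ 1 →
      ¬ IsPGammaLEquiv (linearSet (fpol q h))
          (linearSet (fun x : F => x ^ q + δ * x ^ (q ^ 4))) := by
  classical
  intro δ hδ0 _ hE
  obtain ⟨ρ, g, gadd, gsmul, gmem⟩ := hE
  -- basic facts about the characteristic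
  have hδ : δ ≠ 0 := by
    rintro rfl
    exact hδ0 (zero_pow (by omega))
  obtain ⟨p, s, hp, hs, rfl⟩ := (isPrimePow_nat_iff q).1 hq
  have hFp : Fintype.card F = p ^ (s * 6) := by rw [hF, ← pow_mul]
  have : Fact p.Prime := ⟨hp⟩
  have hchar : CharP F p := by
    obtain ⟨p', hp'⟩ := CharP.exists F
    obtain ⟨n, hp'p, hn⟩ := FiniteField.card F p'
    rw [hFp] at hn
    have : p' = p := by
      have h1 : p' ∣ p ^ (s * 6) := by rw [hn]; exact dvd_pow_self _ n.ne_zero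
      exact (Nat.prime_dvd_prime_iff_eq hp'p hp).1 (hp'p.dvd_of_dvd_pow h1)
    rwa [this] at hp'
  have hadd : ∀ x y : F, (x + y) ^ (p ^ s) = x ^ (p ^ s) + y ^ (p ^ s) :=
    fun x y => add_pow_char_pow x y p s
  have hp2 : p ≠ 2 := by
    rintro rfl
    exact (Nat.not_odd_iff_even.2 (even_two.pow_of_ne_zero hs.ne')) hodd
  have h2 : (2 : F) ≠ 0 := by
    intro h2
    have : p ∣ 2 := (CharP.cast_eq_zero_iff F p 2).1 (by exact_mod_cast h2)
    exact hp2 ((Nat.prime_dvd_prime_iff_eq hp Nat.prime_two).1 this)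
  have hq3 : 3 ≤ p ^ s := by
    have h3 : 3 ≤ p := by have := hp.two_le; omega
    exact h3.trans (Nat.le_self_pow hs.ne' p)
  have hFq : Fintype.card F = (p ^ s) ^ 6 := hF
  generalize hqq : p ^ s = q at *
  have hper : ∀ x : F, x ^ (q ^ 6) = x := fun x => by rw [← hF]; exact FiniteField.pow_card x
  have hq0 : q ≠ 0 := by omega
  -- the matrix of `g`
  obtain ⟨⟨A, C⟩, hAC⟩ : ∃ u, u = g (1, 0) := ⟨_, rfl⟩
  obtain ⟨⟨B, D⟩, hBD⟩ : ∃ u, u = g (0, 1) := ⟨_, rfl⟩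
  have g0 : g 0 = 0 := by simpa using gadd 0 0
  have gne : ∀ v, v ≠ 0 → g v ≠ 0 := fun v hv e => hv (g.injective (e.trans g0.symm))
  have hg : ∀ x y : F, g (x, y) = (A * ρ x + B * ρ y, C * ρ x + D * ρ y) := by
    intro x y
    have : ((x, y) : F × F) = x • ((1, 0) : F × F) + y • ((0, 1) : F × F) := by simp
    rw [this, gadd, gsmul, gsmul, ← hAC, ← hBD]
    simp [mul_comm]
  have hnz : ¬ (B = 0 ∧ D = 0) := by
    rintro ⟨rfl, rfl⟩
    exact gne (0, 1) (by simp) hBD.symm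
  apply hnz
  obtain ⟨h', hh'⟩ : ∃ h', h' = ρ h := ⟨_, rfl⟩
  have hhh : h' ^ (q ^ 3 + 1) = -1 := by rw [hh', ← map_pow, hh, map_neg, map_one]
  have hh0 : h' ≠ 0 := by
    rintro e
    rw [e, zero_pow (by omega)] at hhh
    exact one_ne_zero (neg_eq_zero.1 hhh.symm)
  have hfρ : ∀ x, ρ (fpol q h x) = fpol q h' (ρ x) := by
    intro x
    simp [fpol, hh']
  have hf : ∀ E G x : F, E * x + G * fpol q h' x =
      Stmt10Aux.Q q ![E, G * (h' ^ q / h'), -(G * (h' ^ q ^ 2 / h')), 0, G, G] x := by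
    intro E G x
    have e1 : h' ^ (q - 1) = h' ^ q / h' := by
      rw [eq_div_iff hh0, ← pow_succ, Nat.sub_add_cancel (by omega)]
    have e2 : h' ^ (q ^ 2 - 1) = h' ^ q ^ 2 / h' := by
      rw [eq_div_iff hh0, ← pow_succ, Nat.sub_add_cancel (Nat.one_le_pow _ _ (by omega))]
    simp only [fpol, e1, e2, Stmt10Aux.Q, Fin.sum_univ_six]
    simp
    ring
  have hg3 : ∀ x : F, x ^ q + δ * x ^ (q ^ 4) = Stmt10Aux.Q q ![0, 1, 0, 0, δ, 0] x := by
    intro x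
    simp [Stmt10Aux.Q, Fin.sum_univ_six]
  -- membership in a linear set
  have hmem : ∀ (f : F → F) (u v : F) (huv : (u, v) ≠ (0 : F × F)),
      Projectivization.mk F (u, v) huv ∈ linearSet f ↔
        u ≠ 0 ∧ ∃ x : F, x ≠ 0 ∧ v * u⁻¹ = f x * x⁻¹ := by
    intro f u v huv
    constructor
    · rintro ⟨x, hx, e⟩
      rw [Projectivization.mk_eq_mk_iff'] at e
      obtain ⟨c, hc⟩ := e
      have e1 : c * x = u := congrArg Prod.fst hc
      have e2 : c * f x = v := congrArg Prod.snd hc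
      have hc0 : c ≠ 0 := by
        rintro rfl
        apply huv
        rw [← e1, ← e2]; simp
      refine ⟨by rw [← e1]; exact mul_ne_zero hc0 hx, x, hx, ?_⟩
      rw [← e1, ← e2]
      field_simp
    · rintro ⟨hu, x, hx, e⟩
      refine ⟨x, hx, ?_⟩
      rw [Projectivization.mk_eq_mk_iff']
      refine ⟨u * x⁻¹, ?_⟩
      have hv : v = u * (f x * x⁻¹) := by rw [← e]; field_simp
      ext
      · simp [hx]
      · simp only [Prod.smul_mk, smul_eq_mul]
        rw [hv]; ring
  obtain ⟨M, hM⟩ : ∃ M : F → F, M = fun x => A * x + B * fpol q h' x := ⟨_, rfl⟩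
  obtain ⟨N, hN⟩ : ∃ N : F → F, N = fun x => C * x + D * fpol q h' x := ⟨_, rfl⟩
  have hgM : ∀ x, g (x, fpol q h x) = (M (ρ x), N (ρ x)) := by
    intro x
    rw [hg, hfρ, hM, hN]
  have fwd : ∀ x : F, x ≠ 0 → M x ≠ 0 ∧ ∃ y : F, y ≠ 0 ∧ N x * (M x)⁻¹ =
      (y ^ q + δ * y ^ (q ^ 4)) * y⁻¹ := by
    intro x hx
    have hy : ρ.symm x ≠ 0 := by simpa using hx
    have hv : (ρ.symm x, fpol q h (ρ.symm x)) ≠ (0 : F × F) :=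
      fun e => hy (congrArg Prod.fst e)
    have h1 := (gmem _ hv (gne _ hv)).1 ⟨ρ.symm x, hy, rfl⟩
    have e := hgM (ρ.symm x)
    rw [ρ.apply_symm_apply] at e
    simp only [e] at h1
    exact (hmem _ _ _ _).1 h1
  have bwd : ∀ y : F, y ≠ 0 → ∃ x : F, x ≠ 0 ∧ N x * (M x)⁻¹ =
      (y ^ q + δ * y ^ (q ^ 4)) * y⁻¹ := by
    intro y hy
    obtain ⟨⟨u, v⟩, hv⟩ := g.surjective (y, y ^ q + δ * y ^ (q ^ 4))
    have hv1 : g (u, v) ≠ 0 := by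
      rw [hv]; exact fun e => hy (congrArg Prod.fst e)
    have hv0 : (u, v) ≠ (0 : F × F) := fun e => hv1 (by rw [e, g0])
    have h1 := (gmem (u, v) hv0 hv1).2 (by
      simp only [hv]
      exact ⟨y, hy, rfl⟩)
    obtain ⟨hu, x, hx, e⟩ := (hmem _ _ _ _).1 h1
    refine ⟨ρ x, by simpa using hx, ?_⟩
    have hvv : (u, v) = (u * x⁻¹) • (x, fpol q h x) := by
      have : v = u * (fpol q h x * x⁻¹) := by rw [← e]; field_simp
      ext
      · simp [hx]
      · simp only [Prod.smul_mk, smul_eq_mul]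
        rw [this]; ring
    rw [hvv, gsmul, hgM] at hv
    have e1 : ρ (u * x⁻¹) * M (ρ x) = y := congrArg Prod.fst hv
    have e2 : ρ (u * x⁻¹) * N (ρ x) = y ^ q + δ * y ^ (q ^ 4) := congrArg Prod.snd hv
    rw [← e2]
    have hy' := hy
    rw [← e1] at hy' ⊢
    have n1 := left_ne_zero_of_mul hy'
    have n2 := right_ne_zero_of_mul hy'
    generalize ρ (u * x⁻¹) = c at n1
    field_simp
  have hMQ : ∀ x, M x = Stmt10Aux.Q q _ x := fun x => by rw [hM]; exact hf A B x
  have hNQ : ∀ x, N x = Stmt10Aux.Q q _ x := fun x => by rw [hN]; exact hf C D x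
  have hMbij : Function.Bijective M := by
    apply Finite.injective_iff_bijective.1
    intro x y hxy
    by_contra hne
    apply (fwd (x - y) (sub_ne_zero.2 hne)).1
    have e := Stmt10Aux.Q_map_add hadd
      ![A, B * (h' ^ q / h'), -(B * (h' ^ q ^ 2 / h')), 0, B, B] (x - y) y
    rw [← hMQ, ← hMQ, ← hMQ, sub_add_cancel, hxy] at e
    simpa using e
  obtain ⟨b, hb⟩ := Stmt10Aux.Q_inv hadd hper
    ![A, B * (h' ^ q / h'), -(B * (h' ^ q ^ 2 / h')), 0, B, B] (by
      rwa [show Stmt10Aux.Q q _ = M from (funext hMQ).symm])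
  obtain ⟨a, ha⟩ : ∃ a : Fin 6 → F, ∀ x, Stmt10Aux.Q q a (M x) = N x := by
    refine ⟨fun i => ∑ k : Fin 6,
      (![C, D * (h' ^ q / h'), -(D * (h' ^ q ^ 2 / h')), 0, D, D] : Fin 6 → F) k *
        b (i - k) ^ (q ^ (k : ℕ)), fun x => ?_⟩
    rw [← Stmt10Aux.Q_comp hadd hper, hMQ, hb, ← hNQ]
  have himg : Finset.univ.image (fun x : Fˣ => Stmt10Aux.Q q a x * (x : F)⁻¹) =
      Finset.univ.image (fun x : Fˣ => Stmt10Aux.Q q ![0, 1, 0, 0, δ, 0] x * (x : F)⁻¹) := by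
    ext l
    simp only [Finset.mem_image, Finset.mem_univ, true_and]
    constructor
    · rintro ⟨z, rfl⟩
      obtain ⟨x, hx⟩ := hMbij.2 z
      have hx0 : x ≠ 0 := by
        rintro rfl
        rw [hMQ] at hx
        apply z.ne_zero
        rw [← hx]
        simp [Stmt10Aux.Q, hq0]
      obtain ⟨_, y, hy, e⟩ := fwd x hx0
      refine ⟨Units.mk0 y hy, ?_⟩
      rw [← hx, ha, e, ← hg3]
      rfl
    · rintro ⟨y, rfl⟩
      obtain ⟨x, hx0, e⟩ := bwd y y.ne_zero
      refine ⟨Units.mk0 (M x) (fwd x hx0).1, ?_⟩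
      rw [← hg3, ← e, Units.val_mk0, ha]
  obtain ⟨a0, a3, hcase⟩ := Stmt10Aux.shape hF hq3 hadd hper a δ hδ (fun φ => by
    rw [Stmt10Aux.sum_fibre hp hFp _ (Stmt10Aux.Q_map_add hadd _),
      Stmt10Aux.sum_fibre hp hFp _ (Stmt10Aux.Q_map_add hadd _), himg])
  exact Stmt10Aux.alg hF hq3 hodd hadd hper h2 h' hhh A B C D a a0 a3 hcase (fun x => by
    rw [← hMQ, ← hNQ, ha])
end

section
/- Let q be an odd prime power, F a finite field with q^6 elements, h ∈ F with h^(q^3+1) = −1, and δ ∈ F with δ^2 + δ = 1. Then 𝓛_h is PΓL-equivalent to L^4_δ if and only if there exist a, b, c, d ∈ F and a field automorphism ρ of F with a·d − b·c ≠ 0 such that, setting k = ρ(h), either (I) c = b^q − δ·k^(q^2+1)·b^(q^5), a = −k^(q+1)·b^(q^4) − δ^q·b^(q^2), d = k^(1−q)·b^(q^3) + δ·b^(q^5), b^(q^3) + (k^(q−1) + δ·k^(q+q^2))·b^(q^5) = 0, k^(q^2−q)·b^q + (1 + k^(q^2−q))·b^(q^3) + δ·k^(q^2−1)·b^(q^5)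 = 0, and −δ·b^q + (k^(1−q) + δ^2·k^(1−q^2))·b^(q^3) + δ·b^(q^5) = 0; or (II) c = δ·b^q − k^(q^2+1)·b^(q^5), a = −δ^q·k^(q+1)·b^(q^4) − b^(q^2), d = k^(1−q)·b^(q^3) + b^(q^5), δ·b^(q^3) + (k^(q−1) − δ·k^(q^2+q))·b^(q^5) = 0, δ·k^(q^2−q)·b^q + (k^(q^2−q) + 1)·b^(q^3) + k^(q^2−1)·b^(q^5) = 0, and δ^2·b^q + (k^(1−q) + δ^2·k^(1−q^2))·b^(q^3) + b^(q^5) = 0. (Here negative exponents of k denote powers of k^(−1), which exists since k ≠ 0.) -/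
lemma aux_digits (q : ℕ) (hq : 2 ≤ q) (t : Fin 6 → ℕ) (ht : ∀ i, t i ≤ 1)
    (htlt : ∑ i, t i * q ^ (i : ℕ) < q ^ 6 - 1) :
    ∀ n, ∀ c : Fin 6 → ℕ, ∑ i, c i = n →
      ∑ i, c i * q ^ (i : ℕ) ≡ ∑ i, t i * q ^ (i : ℕ) [MOD q ^ 6 - 1] →
      ∑ i, t i ≤ n ∧ (n = ∑ i, t i → c = t) := by
  intro n
  induction n using Nat.strong_induction_on with
  | _ n ih =>
  intro c hc hmod
  have h6 : 1 ≤ q ^ 6 := Nat.one_le_pow _ _ (by omega)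
  by_cases hex : ∃ i, q ≤ c i
  · obtain ⟨i, hi⟩ := hex
    obtain ⟨r, hr⟩ := Nat.exists_eq_add_of_le hi
    set c' : Fin 6 → ℕ := fun j => if j = i then r else if j = i + 1 then c j + 1 else c j with hc'
    have hsum : ∑ j, c' j + q = ∑ j, c j + 1 := by
      clear_value c'
      subst hc'
      fin_cases i <;> simp [Fin.sum_univ_six] at hr ⊢ <;> omega
    have hmod' : ∑ j, c' j * q ^ (j : ℕ) ≡ ∑ j, c j * q ^ (j : ℕ) [MOD q ^ 6 - 1] := by
      by_cases h5 : i = 5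
      · have : ∑ j, c j * q ^ (j : ℕ) = ∑ j, c' j * q ^ (j : ℕ) + (q ^ 6 - 1) := by
          zify [h6]
          subst h5
          simp [hc', Fin.sum_univ_six, hr]
          ring
        rw [this]
        simp [Nat.ModEq]
      · have : ∑ j, c j * q ^ (j : ℕ) = ∑ j, c' j * q ^ (j : ℕ) := by
          clear_value c'
          subst hc'
          fin_cases i <;> simp [Fin.sum_univ_six] at hr h5 ⊢ <;> rw [hr] <;> ring
        rw [this]
    have := ih (∑ j, c' j) (by omega) c' rfl (hmod'.trans hmod)
    omega
  · push Not at hex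
    have hle : ∀ i, c i ≤ q - 1 := fun i => by have := hex i; omega
    have hN : ∑ i, c i * q ^ (i : ℕ) ≤ q ^ 6 - 1 := by
      calc ∑ i, c i * q ^ (i : ℕ) ≤ ∑ i : Fin 6, (q - 1) * q ^ (i : ℕ) :=
            Finset.sum_le_sum fun i _ => Nat.mul_le_mul_right _ (hle i)
        _ = q ^ 6 - 1 := by
            have h1 : 1 ≤ q := by omega
            zify [h6, h1]
            simp [Fin.sum_univ_six]; ring
    have hct : c = t ∨ ∑ i, t i = 0 := by
      rcases hN.lt_or_eq with hlt | heq
      · left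
        have heq := Nat.ModEq.eq_of_lt_of_lt hmod hlt htlt
        have : List.ofFn c = List.ofFn t := by
          apply Nat.ofDigits_inj_of_len_eq (b := q) (by omega) (by simp)
          · intro l hl
            obtain ⟨i, rfl⟩ := (List.mem_ofFn' _ _).1 hl
            exact hex i
          · intro l hl
            obtain ⟨i, rfl⟩ := (List.mem_ofFn' _ _).1 hl
            have := ht i; omega
          · simp [Fin.sum_univ_six] at heq
            simp [List.ofFn_succ, Nat.ofDigits_cons]
            linarith
        exact List.ofFn_injective this
      · right
        rw [heq] at hmod
        have h0 : ∑ i, t i * q ^ (i : ℕ) = 0 := by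
          have h1 : 0 ≡ ∑ i, t i * q ^ (i : ℕ) [MOD q ^ 6 - 1] := by
            refine Nat.ModEq.trans ?_ hmod
            simp [Nat.ModEq]
          exact (Nat.ModEq.eq_of_lt_of_lt h1 (by omega) htlt).symm
        rw [Finset.sum_eq_zero_iff] at h0 ⊢
        intro i hi
        have := h0 i hi
        have hq0 : q ^ (i : ℕ) ≠ 0 := pow_ne_zero _ (by omega)
        exact (mul_eq_zero.1 this).resolve_right hq0
    rcases hct with rfl | h0
    · simp [hc]
    · refine ⟨by omega, fun hn => ?_⟩
      rw [h0] at hn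
      rw [hn] at hc
      rw [Finset.sum_eq_zero_iff] at hc h0
      ext i
      rw [hc i (by simp), h0 i (by simp)]

lemma aux_perm_of_modEq (q : ℕ) (hq : 2 ≤ q) {m : ℕ} (hm : m ≤ 5) (e : Fin m → Fin 6)
    (he : Function.Injective e) (ψ : Fin m → Fin 6)
    (hmod : ∑ j, q ^ (ψ j : ℕ) ≡ ∑ j, q ^ (e j : ℕ) [MOD q ^ 6 - 1]) :
    ∃ π : Equiv.Perm (Fin m), ψ = e ∘ π := by
  classical
  have key : ∀ φ : Fin m → Fin 6, ∑ j, q ^ (φ j : ℕ)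
      = ∑ i : Fin 6, (Finset.univ.filter (fun j => φ j = i)).card * q ^ (i : ℕ) := by
    intro φ
    rw [← Finset.sum_fiberwise (s := Finset.univ) (g := φ)]
    refine Finset.sum_congr rfl fun i _ => ?_
    rw [Finset.sum_congr rfl (g := fun _ => q ^ (i : ℕ))]
    · simp
    · intro j hj
      simp at hj
      rw [hj]
  have keyc : ∀ φ : Fin m → Fin 6,
      ∑ i : Fin 6, (Finset.univ.filter (fun j => φ j = i)).card = m := by
    intro φ
    rw [← Finset.card_eq_sum_card_fiberwise (f := φ) (s := Finset.univ) (t := Finset.univ)]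
    · simp
    · simp
  set t : Fin 6 → ℕ := fun i => (Finset.univ.filter (fun j => e j = i)).card with ht
  have ht1 : ∀ i, t i ≤ 1 := by
    intro i
    rw [ht]
    refine Finset.card_le_one.2 ?_
    intro a ha b hb
    simp at ha hb
    exact he (ha.trans hb.symm)
  have htlt : ∑ i, t i * q ^ (i : ℕ) < q ^ 6 - 1 := by
    obtain ⟨i0, hi0⟩ : ∃ i0, t i0 = 0 := by
      by_contra hcon
      push Not at hcon
      have h1 : ∑ i : Fin 6, 1 ≤ ∑ i, t i :=
        Finset.sum_le_sum fun i _ => Nat.one_le_iff_ne_zero.2 (hcon i)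
      have h2 : ∑ i, t i = m := keyc e
      simp at h1
      omega
    have : ∑ i, t i * q ^ (i : ℕ) < ∑ i : Fin 6, (q - 1) * q ^ (i : ℕ) := by
      refine Finset.sum_lt_sum (fun i _ => Nat.mul_le_mul_right _ ((ht1 i).trans (by omega))) 
        ⟨i0, by simp, ?_⟩
      rw [hi0, zero_mul]
      have : 0 < q - 1 := by omega
      positivity
    refine this.trans_eq ?_
    have h1 : 1 ≤ q := by omega
    have h6 : 1 ≤ q ^ 6 := Nat.one_le_pow _ _ (by omega)
    zify [h6, h1]
    simp [Fin.sum_univ_six]; ring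
  rw [key ψ, key e] at hmod
  have h := (aux_digits q hq t ht1 htlt m _ (keyc ψ) hmod).2 (keyc e).symm
  have hinj : Function.Injective ψ := by
    intro a b hab
    have h1 := congrFun h (ψ b)
    have h2 := ht1 (ψ b)
    rw [← h1] at h2
    exact Finset.card_le_one.1 h2 a (by simp [hab]) b (by simp)
  have hran : ∀ j, ∃ j', e j' = ψ j := by
    intro j
    have h1 := congrFun h (ψ j)
    have h2 : 0 < t (ψ j) := by
      rw [← h1]
      exact Finset.card_pos.2 ⟨j, by simp⟩
    obtain ⟨j', hj'⟩ := Finset.card_pos.1 h2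
    exact ⟨j', by simpa using hj'⟩
  choose π hπ using hran
  have hπi : Function.Injective π := by
    intro a b hab
    apply hinj
    rw [← hπ a, ← hπ b, hab]
  refine ⟨Equiv.ofBijective π (Finite.injective_iff_bijective.1 hπi), ?_⟩
  ext j
  simp [hπ]

section field
variable {F : Type} [Field F] [Fintype F] [DecidableEq F]

lemma aux_pow_mod {q : ℕ} (hF : Fintype.card F = q ^ 6) (x : F) (i e : Fin 6) :
    x ^ (q ^ ((i + e : Fin 6) : ℕ)) = (x ^ (q ^ (i : ℕ))) ^ (q ^ (e : ℕ)) := by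
  have h6 : ∀ y : F, y ^ (q ^ 6) = y := fun y => by rw [← hF]; exact FiniteField.pow_card y
  rw [← pow_mul, ← pow_add, Fin.val_add]
  rcases Nat.lt_or_ge ((i : ℕ) + e) 6 with h | h
  · rw [Nat.mod_eq_of_lt h]
  · have h2 : ((i : ℕ) + e) % 6 = (i : ℕ) + e - 6 := by omega
    rw [h2]
    conv_rhs => rw [show (i : ℕ) + e = 6 + ((i : ℕ) + e - 6) by omega, pow_add, pow_mul, h6]

lemma aux_sum_units {q : ℕ} (hq : 2 ≤ q) (hF : Fintype.card F = q ^ 6)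
    {m : ℕ} (hm : m ≤ 5) (e : Fin m → Fin 6) (he : Function.Injective e) (ψ : Fin m → Fin 6) :
    ∑ x : Fˣ, ∏ j, ((x : F) ^ (q ^ (ψ j : ℕ)) * ((x : F)⁻¹) ^ (q ^ (e j : ℕ)))
      = if ∃ π : Equiv.Perm (Fin m), ψ = e ∘ π then -1 else 0 := by
  have h6 : 2 ≤ q ^ 6 := hq.trans (Nat.le_self_pow (by norm_num) q)
  set N := ∑ j, q ^ (ψ j : ℕ)
  set M := ∑ j, q ^ (e j : ℕ)
  have h1 : ∀ x : Fˣ, ∏ j, ((x : F) ^ (q ^ (ψ j : ℕ)) * ((x : F)⁻¹) ^ (q ^ (e j : ℕ)))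
      = ((x ^ (N + M * (q ^ 6 - 2)) : Fˣ) : F) := by
    intro x
    have hx : (x : F)⁻¹ = (x : F) ^ (q ^ 6 - 2) := by
      have hx0 : (x : F) ≠ 0 := x.ne_zero
      have := FiniteField.pow_card_sub_one_eq_one (x : F) hx0
      rw [hF, show q ^ 6 - 1 = (q ^ 6 - 2) + 1 by omega, pow_succ] at this
      exact (eq_inv_of_mul_eq_one_left this).symm
    rw [Finset.prod_mul_distrib, Finset.prod_pow_eq_pow_sum, Finset.prod_pow_eq_pow_sum, hx]
    push_cast
    rw [← pow_mul, ← pow_add, mul_comm M]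
  simp only [h1]
  have h2 := FiniteField.sum_pow_units F (N + M * (q ^ 6 - 2))
  simp only [Units.val_pow_eq_pow_val] at h2 ⊢
  rw [h2, hF]
  have h3 : N + M * (q ^ 6 - 2) + M = N + M * (q ^ 6 - 1) := by
    zify [show 1 ≤ q ^ 6 by omega, h6]; ring
  congr 1
  rw [eq_iff_iff]
  constructor
  · intro hd
    apply aux_perm_of_modEq q hq hm e he ψ
    change N ≡ M [MOD q ^ 6 - 1]
    have h4 : N + M * (q ^ 6 - 2) + M ≡ 0 + M [MOD q ^ 6 - 1] :=
      Nat.ModEq.add_right _ ((Nat.modEq_zero_iff_dvd).2 hd)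
    rw [h3] at h4
    simpa [Nat.ModEq] using h4
  · rintro ⟨π, rfl⟩
    have : N = M := Equiv.sum_comp π (fun j => q ^ (e j : ℕ))
    rw [this]
    refine ⟨M, ?_⟩
    zify [show 1 ≤ q ^ 6 by omega, h6]; ring

lemma aux_power_sum {q : ℕ} (hq : 2 ≤ q) (hF : Fintype.card F = q ^ 6)
    (hadd : ∀ (n : ℕ), ∃ φ : F →+* F, ∀ x, φ x = x ^ (q ^ n))
    {m : ℕ} (hm : m ≤ 5) (e : Fin m → Fin 6) (he : Function.Injective e) (u : Fin 6 → F) :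
    ∑ x : Fˣ, ∏ j, ((∑ i, u i * (x : F) ^ (q ^ (i : ℕ))) * (x : F)⁻¹) ^ (q ^ (e j : ℕ))
      = - ∑ π : Equiv.Perm (Fin m), ∏ j, (u (e (π j) - e j)) ^ (q ^ (e j : ℕ)) := by
  have h1 : ∀ (x : Fˣ) (j : Fin m),
      ((∑ i, u i * (x : F) ^ (q ^ (i : ℕ))) * (x : F)⁻¹) ^ (q ^ (e j : ℕ))
      = ∑ i : Fin 6, (u (i - e j)) ^ (q ^ (e j : ℕ)) *
        ((x : F) ^ (q ^ (i : ℕ)) * ((x : F)⁻¹) ^ (q ^ (e j : ℕ))) := by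
    intro x j
    obtain ⟨φ, hφ⟩ := hadd (e j)
    rw [mul_pow, ← hφ (∑ i, _), map_sum, Finset.sum_mul,
      ← Equiv.sum_comp (Equiv.subRight (e j))]
    refine Finset.sum_congr rfl fun i _ => ?_
    simp only [Equiv.subRight_apply]
    rw [hφ, mul_pow, ← aux_pow_mod hF, sub_add_cancel, mul_assoc]
  simp only [h1]
  simp only [Finset.prod_univ_sum, Fintype.piFinset_univ]
  rw [Finset.sum_comm]
  simp only [Finset.prod_mul_distrib (f := fun j => (u (_ - e j)) ^ (q ^ (e j : ℕ)))]
  simp only [← Finset.mul_sum, aux_sum_units hq hF hm e he]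
  simp only [mul_ite, mul_neg, mul_one, mul_zero]
  rw [← Finset.sum_filter, ← Finset.sum_neg_distrib]
  symm
  refine Finset.sum_bij (fun (π : Equiv.Perm (Fin m)) _ => e ∘ π) ?_ ?_ ?_ ?_
  · intro π _
    simp only [Finset.mem_filter, Finset.mem_univ, true_and]
    exact ⟨π, rfl⟩
  · intro π _ π' _ h
    ext j
    exact congrArg Fin.val (he (congrFun h j))
  · intro ψ hψ
    obtain ⟨π, hπ⟩ := (Finset.mem_filter.1 hψ).2
    exact ⟨π, by simp, hπ.symm⟩
  · intro π _
    rfl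

/-- sums over the value multiset only depend on the value set -/
lemma aux_value_sum (p : ℕ) [Fact p.Prime] [CharP F p] (f g : F →+ F)
    (hset : ∀ v : F, (∃ x : F, x ≠ 0 ∧ f x = v * x) ↔ (∃ x : F, x ≠ 0 ∧ g x = v * x))
    (H : F → F) :
    ∑ x : Fˣ, H (f x * (x : F)⁻¹) = ∑ x : Fˣ, H (g x * (x : F)⁻¹) := by
  have key : ∀ f : F →+ F, ∑ x : Fˣ, H (f x * (x : F)⁻¹)
      = ∑ v : F, if (∃ x : F, x ≠ 0 ∧ f x = v * x) then - H v else 0 := by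
    intro f
    rw [← Finset.sum_fiberwise (s := Finset.univ) (g := fun x : Fˣ => f x * (x : F)⁻¹)]
    refine Finset.sum_congr rfl fun v _ => ?_
    rw [Finset.sum_congr rfl (g := fun _ => H v)]
    swap
    · intro x hx
      simp only [Finset.mem_filter, Finset.mem_univ, true_and] at hx
      rw [hx]
    rw [Finset.sum_const]
    have hfil : ∀ x : Fˣ, f x * (x : F)⁻¹ = v ↔ f x = v * x := by
      intro x
      rw [mul_inv_eq_iff_eq_mul₀ x.ne_zero]
    simp only [hfil]
    split_ifs with hex
    · let K : AddSubgroup F := (f - AddMonoidHom.mulLeft v).ker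
      have hK : ∀ x, x ∈ K ↔ f x = v * x := by
        intro x
        simp [K, AddMonoidHom.mem_ker, sub_eq_zero]
      have hcard : (Finset.univ.filter (fun x : Fˣ => f x = v * x)).card + 1 = Nat.card K := by
        have h1 : Nat.card K = (Finset.univ.filter (fun x : F => f x = v * x)).card := by
          rw [Nat.card_eq_fintype_card, Fintype.card_of_subtype]
          intro x
          simp [hK]
        rw [h1]
        have h2 : (Finset.univ.filter (fun x : F => f x = v * x))
            = insert 0 ((Finset.univ.filter (fun x : Fˣ => f x = v * x)).image (fun x : Fˣ => (x : F))) := by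
          ext x
          simp only [Finset.mem_filter, Finset.mem_univ, true_and, Finset.mem_insert,
            Finset.mem_image]
          constructor
          · intro hx
            by_cases h0 : x = 0
            · exact Or.inl h0
            · exact Or.inr ⟨Units.mk0 x h0, hx, rfl⟩
          · rintro (rfl | ⟨y, hy, rfl⟩)
            · simp
            · exact hy
        rw [h2, Finset.card_insert_of_notMem, Finset.card_image_of_injective _ Units.val_injective]
        simp
      have hp : p ∣ Nat.card K := by
        obtain ⟨x, hx0, hx⟩ := hex
        have ho : addOrderOf (⟨x, (hK x).2 hx⟩ : K) = p := by
          apply addOrderOf_eq_prime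
          · ext; simp
          · intro h; exact hx0 (congrArg Subtype.val h)
        rw [← ho]
        exact addOrderOf_dvd_natCard _
      have : ((Finset.univ.filter (fun x : Fˣ => f x = v * x)).card : F) = -1 := by
        have h3 : ((Nat.card K : ℕ) : F) = 0 := (CharP.cast_eq_zero_iff F p _).2 hp
        rw [← hcard] at h3
        push_cast at h3
        exact eq_neg_of_add_eq_zero_left h3
      rw [nsmul_eq_mul, this]; ring
    · push Not at hex
      rw [Finset.filter_false_of_mem]
      · simp
      · intro x _
        exact hex x x.ne_zero
  rw [key f, key g]
  simp only [hset]

/-- from equality of the value sets, equality of the permanents of principal minors -/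
lemma aux_perm_eq {q : ℕ} (p : ℕ) [Fact p.Prime] [CharP F p] (hq : 2 ≤ q)
    (hF : Fintype.card F = q ^ 6)
    (hadd : ∀ (n : ℕ), ∃ φ : F →+* F, ∀ x, φ x = x ^ (q ^ n))
    (u w : Fin 6 → F)
    (hset : ∀ v : F, (∃ x : F, x ≠ 0 ∧ ∑ i, u i * x ^ (q ^ (i : ℕ)) = v * x) ↔
      (∃ x : F, x ≠ 0 ∧ ∑ i, w i * x ^ (q ^ (i : ℕ)) = v * x))
    {m : ℕ} (hm : m ≤ 5) (e : Fin m → Fin 6) (he : Function.Injective e) :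
    ∑ π : Equiv.Perm (Fin m), ∏ j, (u (e (π j) - e j)) ^ (q ^ (e j : ℕ))
    = ∑ π : Equiv.Perm (Fin m), ∏ j, (w (e (π j) - e j)) ^ (q ^ (e j : ℕ)) := by
  choose φ hφ using hadd
  let mk : (Fin 6 → F) → (F →+ F) := fun u =>
    ∑ i : Fin 6, (AddMonoidHom.mulLeft (u i)).comp (φ (i : ℕ)).toAddMonoidHom
  have hmk : ∀ u x, mk u x = ∑ i, u i * x ^ (q ^ (i : ℕ)) := by
    intro u x
    simp [mk, hφ]
  have := aux_value_sum p (mk u) (mk w) (by simpa only [hmk] using hset)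
    (fun v => ∏ j, v ^ (q ^ (e j : ℕ)))
  simp only [hmk] at this
  rw [aux_power_sum hq hF (fun n => ⟨φ n, hφ n⟩) hm e he,
    aux_power_sum hq hF (fun n => ⟨φ n, hφ n⟩) hm e he] at this
  exact neg_injective this

end field

lemma aux_perm_succ {F : Type} [CommRing F] {n : ℕ} (M : Fin (n + 1) → Fin (n + 1) → F) :
    ∑ π : Equiv.Perm (Fin (n + 1)), ∏ j, M (π j) j =
    ∑ i, M i 0 * ∑ π : Equiv.Perm (Fin n), ∏ j, M (Equiv.swap 0 i (π j).succ) j.succ := by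
  rw [← Equiv.sum_comp Equiv.Perm.decomposeFin.symm, Fintype.sum_prod_type]
  simp only [Fin.prod_univ_succ, Equiv.Perm.decomposeFin_symm_apply_zero,
    Equiv.Perm.decomposeFin_symm_apply_succ, Finset.mul_sum]

lemma aux_perm2 {F : Type} [CommRing F] (M : Fin 2 → Fin 2 → F) :
    ∑ π : Equiv.Perm (Fin 2), ∏ j, M (π j) j = M 0 0 * M 1 1 + M 1 0 * M 0 1 := by
  rw [aux_perm_succ]
  simp

lemma aux_perm3 {F : Type} [CommRing F] (M : Fin 3 → Fin 3 → F) :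
    ∑ π : Equiv.Perm (Fin 3), ∏ j, M (π j) j = M 0 0 * (M 1 1 * M 2 2 + M 2 1 * M 1 2)
      + M 1 0 * (M 0 1 * M 2 2 + M 2 1 * M 0 2) + M 2 0 * (M 0 1 * M 1 2 + M 1 1 * M 0 2) := by
  rw [aux_perm_succ, Fin.sum_univ_three]
  have h := fun i => aux_perm2 (fun a b => M (Equiv.swap 0 i a.succ) b.succ)
  beta_reduce at h
  simp only [h]
  simp [show Equiv.swap (0 : Fin 3) 1 2 = 2 by decide, show Equiv.swap (0 : Fin 3) 2 1 = 1 by decide]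
  ring

lemma aux_perm4 {F : Type} [CommRing F] (M : Fin 4 → Fin 4 → F) :
    ∑ π : Equiv.Perm (Fin 4), ∏ j, M (π j) j =
      M 0 0 * (M 1 1 * (M 2 2 * M 3 3 + M 3 2 * M 2 3)
        + M 2 1 * (M 1 2 * M 3 3 + M 3 2 * M 1 3) + M 3 1 * (M 1 2 * M 2 3 + M 2 2 * M 1 3))
      + M 1 0 * (M 0 1 * (M 2 2 * M 3 3 + M 3 2 * M 2 3)
        + M 2 1 * (M 0 2 * M 3 3 + M 3 2 * M 0 3) + M 3 1 * (M 0 2 * M 2 3 + M 2 2 * M 0 3))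
      + M 2 0 * (M 0 1 * (M 1 2 * M 3 3 + M 3 2 * M 1 3)
        + M 1 1 * (M 0 2 * M 3 3 + M 3 2 * M 0 3) + M 3 1 * (M 0 2 * M 1 3 + M 1 2 * M 0 3))
      + M 3 0 * (M 0 1 * (M 1 2 * M 2 3 + M 2 2 * M 1 3)
        + M 1 1 * (M 0 2 * M 2 3 + M 2 2 * M 0 3) + M 2 1 * (M 0 2 * M 1 3 + M 1 2 * M 0 3)) := by
  rw [aux_perm_succ, Fin.sum_univ_four]
  have h := fun i => aux_perm3 (fun a b => M (Equiv.swap 0 i a.succ) b.succ)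
  beta_reduce at h
  simp only [h]
  simp [show Equiv.swap (0 : Fin 4) 1 2 = 2 by decide, show Equiv.swap (0 : Fin 4) 1 3 = 3 by decide,
    show Equiv.swap (0 : Fin 4) 2 1 = 1 by decide, show Equiv.swap (0 : Fin 4) 2 3 = 3 by decide,
    show Equiv.swap (0 : Fin 4) 3 1 = 1 by decide, show Equiv.swap (0 : Fin 4) 3 2 = 2 by decide]
  ring

section classify
variable {F : Type} [Field F] [Fintype F]

lemma aux_identities {q : ℕ} (p : ℕ) [Fact p.Prime] [CharP F p] (hq : 2 ≤ q)
    (hF : Fintype.card F = q ^ 6)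
    (hadd : ∀ (n : ℕ), ∃ φ : F →+* F, ∀ x, φ x = x ^ (q ^ n))
    (δ : F) (u : Fin 6 → F)
    (hset : ∀ v : F, (∃ x : F, x ≠ 0 ∧ ∑ i, u i * x ^ (q ^ (i : ℕ)) = v * x) ↔
      (∃ x : F, x ≠ 0 ∧ ∑ i, (![0, 1, 0, 1, 0, δ] : Fin 6 → F) i * x ^ (q ^ (i : ℕ)) = v * x)) :
    u 0 = 0 ∧ u 1 * u 5 ^ q = δ ^ q ∧ u 2 * u 4 ^ (q ^ 2) = 0 ∧ u 3 * u 3 ^ (q ^ 3) = 1 ∧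
    u 1 * u 1 ^ q * u 4 ^ (q ^ 2) + u 2 * u 5 ^ q * u 5 ^ (q ^ 2) = 0 ∧
    (u 2 = 0 → u 4 = 0 → 
      (u 1 * u 1 ^ (q ^ 2) + u 3 * u 5 ^ (q ^ 2)) * (u 5 ^ q * u 5 ^ (q ^ 3) + u 1 ^ q * u 3 ^ (q ^ 3))
      = (1 + δ ^ (q ^ 2)) * (δ ^ q * δ ^ (q ^ 3) + 1)) := by
  classical
  have hq0 : q ≠ 0 := by omega
  have H := fun {m : ℕ} => aux_perm_eq (m := m) p hq hF hadd u _ hset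
  let P : (Fin 6 → F) → (m : ℕ) → (Fin m → Fin 6) → Fin m → Fin m → F :=
    fun u m e a b => u (e a - e b) ^ (q ^ (e b : ℕ))
  have h0 := H (by norm_num) ![0] (by decide)
  have h2 : ∀ e : Fin 2 → Fin 6, Function.Injective e → _ = _ := fun e he =>
    (aux_perm2 (P u 2 e)).symm.trans ((H (by norm_num) e he).trans (aux_perm2 (P _ 2 e)))
  have h3 : ∀ e : Fin 3 → Fin 6, Function.Injective e → _ = _ := fun e he =>
    (aux_perm3 (P u 3 e)).symm.trans ((H (by norm_num) e he).trans (aux_perm3 (P _ 3 e)))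
  have h4 : ∀ e : Fin 4 → Fin 6, Function.Injective e → _ = _ := fun e he =>
    (aux_perm4 (P u 4 e)).symm.trans ((H (by norm_num) e he).trans (aux_perm4 (P _ 4 e)))
  simp only [P] at h2 h3 h4
  have h01 := h2 ![0, 1] (by decide)
  have h02 := h2 ![0, 2] (by decide)
  have h03 := h2 ![0, 3] (by decide)
  have h012 := h3 ![0, 1, 2] (by decide)
  have h0123 := h4 ![0, 1, 2, 3] (by decide)
  clear h2 h3 h4 H
  have e1 : (-1 : Fin 6) = 5 := by decide
  have e2 : (-2 : Fin 6) = 4 := by decide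
  have e3 : (-3 : Fin 6) = 3 := by decide
  have e4 : (1 - 2 : Fin 6) = 5 := by decide
  have e5 : (1 - 3 : Fin 6) = 4 := by decide
  have e6 : (2 - 3 : Fin 6) = 5 := by decide
  have e7 : (2 - 1 : Fin 6) = 1 := by decide
  have e8 : (3 - 1 : Fin 6) = 2 := by decide
  have e9 : (3 - 2 : Fin 6) = 1 := by decide
  simp at h0
  simp [hq0, h0, e1, e2, e3, e4, e5, e6, e7, e8, e9, -mul_eq_zero] at h01 h02 h03 h012
  refine ⟨h0, h01, h02, h03, by linear_combination h012, fun hu2 hu4 => ?_⟩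
  simp [hq0, h0, hu2, hu4, e1, e2, e3, e4, e5, e6, e7, e8, e9, -mul_eq_zero] at h0123
  linear_combination h0123

end classify

section classify2
variable {F : Type} [Field F] [Fintype F]

lemma aux_cyclic {N : ℕ} (hF : Fintype.card F = N + 1) (m n : ℕ) (hm : 0 < m)
    (hmn : m * n = N) (a : F) (ha : a ^ m = 1) : ∃ b : F, b ≠ 0 ∧ a = b ^ n := by
  classical
  have ha0 : a ≠ 0 := by
    rintro rfl
    rw [zero_pow hm.ne'] at ha
    exact zero_ne_one ha
  obtain ⟨g, hg⟩ := IsCyclic.exists_generator (α := Fˣ)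
  obtain ⟨k, hk⟩ := Subgroup.mem_zpowers_iff.1 (hg (Units.mk0 a ha0))
  have hord : orderOf g = N := by
    rw [orderOf_eq_card_of_forall_mem_zpowers hg, Nat.card_eq_fintype_card, Fintype.card_units, hF]
    simp
  have h1 : g ^ (k * m) = 1 := by
    rw [zpow_mul, hk]
    ext
    simpa using ha
  have h2 : (n : ℤ) ∣ k := by
    have := orderOf_dvd_iff_zpow_eq_one.2 h1
    rw [hord, ← hmn] at this
    push_cast at this
    rw [mul_comm k] at this
    exact Int.dvd_of_mul_dvd_mul_left (by exact_mod_cast hm.ne') this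
  obtain ⟨r, rfl⟩ := h2
  refine ⟨((g ^ r : Fˣ) : F), Units.ne_zero _, ?_⟩
  have h3 : (g ^ r) ^ n = Units.mk0 a ha0 := by
    rw [← hk, mul_comm, zpow_mul, zpow_natCast]
  have := congrArg Units.val h3
  simpa using this.symm

lemma aux_classify {q : ℕ} (hq : 2 ≤ q) (hF : Fintype.card F = q ^ 6)
    (δ : F) (hδ0 : δ ≠ 0) (hδ2 : δ ^ (q ^ 2) = δ) (u : Fin 6 → F)
    (h1 : u 1 * u 5 ^ q = δ ^ q) (h2 : u 2 * u 4 ^ (q ^ 2) = 0) (h3 : u 3 * u 3 ^ (q ^ 3) = 1)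
    (h4 : u 1 * u 1 ^ q * u 4 ^ (q ^ 2) + u 2 * u 5 ^ q * u 5 ^ (q ^ 2) = 0)
    (h5 : u 2 = 0 → u 4 = 0 → 
      (u 1 * u 1 ^ (q ^ 2) + u 3 * u 5 ^ (q ^ 2)) * (u 5 ^ q * u 5 ^ (q ^ 3) + u 1 ^ q * u 3 ^ (q ^ 3))
      = (1 + δ ^ (q ^ 2)) * (δ ^ q * δ ^ (q ^ 3) + 1)) :
    u 2 = 0 ∧ u 4 = 0 ∧ ∃ l s1 s5 : F, l ≠ 0 ∧ ((s1 = 1 ∧ s5 = δ) ∨ (s1 = δ ^ q ∧ s5 = 1)) ∧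
      u 1 * l = s1 * l ^ q ∧ u 3 * l = l ^ (q ^ 3) ∧ u 5 * l = s5 * l ^ (q ^ 5) := by
  have hq0 : q ≠ 0 := by omega
  have hu1 : u 1 ≠ 0 := by
    intro h; rw [h, zero_mul] at h1; exact pow_ne_zero _ hδ0 h1.symm
  have hu5 : u 5 ≠ 0 := by
    intro h; rw [h, zero_pow hq0, mul_zero] at h1; exact pow_ne_zero _ hδ0 h1.symm
  have h24 : u 2 = 0 ∧ u 4 = 0 := by
    rcases mul_eq_zero.1 h2 with h | h
    · refine ⟨h, ?_⟩
      rw [h] at h4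
      simpa [hu1, hq0] using h4
    · have h' := (pow_eq_zero_iff (pow_ne_zero 2 hq0)).1 h
      refine ⟨?_, h'⟩
      rw [h] at h4
      simpa [hu5, hq0] using h4
  refine ⟨h24.1, h24.2, ?_⟩
  replace h5 := h5 h24.1 h24.2
  have p6 : ∀ y : F, y ^ (q ^ 6) = y := fun y => by rw [← hF]; exact FiniteField.pow_card y
  have hFN : Fintype.card F = (q ^ 6 - 1) + 1 := by
    rw [hF]; have := Nat.one_le_pow 6 q (by omega); omega
  have hq1 : 1 ≤ q := by omega
  have hq3 : 1 ≤ q ^ 3 := Nat.one_le_pow _ _ hq1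
  have hq6 : 1 ≤ q ^ 6 := Nat.one_le_pow _ _ hq1
  obtain ⟨μ, hμ0, hμ⟩ := aux_cyclic hFN (q ^ 3 + 1) (q ^ 3 - 1) (by omega)
    (by zify [hq3, hq6]; ring) (u 3) (by rw [pow_succ, mul_comm]; exact h3)
  have hμ3 : u 3 = μ ^ (q ^ 3) / μ := by
    rw [eq_div_iff hμ0, hμ, ← pow_succ]; congr 1; omega
  have pq : ∀ (x : F) (i j : ℕ), (x ^ (q ^ i)) ^ (q ^ j) = x ^ (q ^ (i + j)) := by
    intro x i j; rw [← pow_mul, ← pow_add]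
  have pq1 : ∀ (x : F) (j : ℕ), (x ^ q) ^ (q ^ j) = x ^ (q ^ (1 + j)) := by
    intro x j; rw [← pq, pow_one]
  have pq2 : ∀ (x : F) (j : ℕ), (x ^ (q ^ j)) ^ q = x ^ (q ^ (j + 1)) := by
    intro x j; rw [← pq, pow_one]
  have pq3 : ∀ (x : F), (x ^ q) ^ q = x ^ (q ^ 2) := by
    intro x; rw [← pow_mul, ← pow_two]
  have p7 : ∀ y : F, y ^ (q ^ 7) = y ^ q := fun y => by rw [← pq1 y 6, p6]
  have p8 : ∀ y : F, y ^ (q ^ 8) = y ^ (q ^ 2) := fun y => by rw [← pq y 2 6, p6]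
  have hδ3 : δ ^ (q ^ 3) = δ ^ q := by rw [← pq2, hδ2]
  obtain ⟨A, hA⟩ : ∃ A, A = u 1 * μ / μ ^ q := ⟨_, rfl⟩
  obtain ⟨B, hB⟩ : ∃ B, B = u 5 * μ / μ ^ (q ^ 5) := ⟨_, rfl⟩
  have hmu : ∀ i, μ ^ (q ^ i) ≠ 0 := fun i => pow_ne_zero _ hμ0
  have hmu1 : μ ^ q ≠ 0 := pow_ne_zero _ hμ0
  have hu1' : u 1 = A * μ ^ q / μ := by rw [hA]; field_simp
  have hu5' : u 5 = B * μ ^ (q ^ 5) / μ := by rw [hB]; have := hmu 5; field_simp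
  have hA0 : A ≠ 0 := by rintro rfl; simp at hu1'; exact hu1 hu1'
  have hA1 : A ^ q ≠ 0 := pow_ne_zero _ hA0
  have hA2 : A ^ (q ^ 2) ≠ 0 := pow_ne_zero _ hA0
  have hB1 : B ^ q = δ ^ q / A := by
    rw [eq_div_iff hA0, ← h1, hu1', hu5']
    simp only [mul_pow, div_pow, pq, pq1, pq2, pq3, p6, Nat.reduceAdd]
    field_simp
  have hB2 : B ^ (q ^ 2) = δ / A ^ q := by
    rw [← pq3, hB1, div_pow, pq3, hδ2]
  have hB3 : B ^ (q ^ 3) = δ ^ q / A ^ (q ^ 2) := by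
    rw [← pq2 B 2, hB2, div_pow, pq3]
  have hB0 : B = δ ^ (q ^ 6) / A ^ (q ^ 5) := by
    conv_lhs => rw [← p6 B, ← pq1 B 5, hB1, div_pow, pq1]
  rw [p6] at hB0
  rw [hu1', hu5', hμ3, hδ2, hδ3] at h5
  simp only [mul_pow, div_pow, pq, pq1, pq2, pq3, p6, p7, p8, Nat.reduceAdd, hB1, hB2, hB3] at h5
  have hT : (A * A ^ q * A ^ (q ^ 2) - 1) * (A * A ^ q * A ^ (q ^ 2) - δ * (δ ^ q) ^ 2) = 0 := by
    have m2 := hmu 2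
    have m3 := hmu 3
    have h5' : (A * A ^ q * A ^ (q ^ 2) + δ) * ((δ ^ q) ^ 2 + A * A ^ q * A ^ (q ^ 2))
      = (1 + δ) * (δ ^ q * δ ^ q + 1) * (A * A ^ q * A ^ (q ^ 2)) := by
      generalize μ ^ (q ^ 2) = μ2 at *
      generalize μ ^ (q ^ 3) = μ3 at *
      generalize μ ^ q = μ1 at *
      generalize A ^ (q ^ 2) = A2 at *
      generalize A ^ q = A1 at *
      generalize δ ^ q = d1 at *
      rw [← h5]
      field_simp
    linear_combination h5'
  have fin : ∀ s A0 : F, A = s * A0 → A0 * A0 ^ q * A0 ^ (q ^ 2) = 1 → s ≠ 0 →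
      ∃ l : F, l ≠ 0 ∧ u 1 * l = s * l ^ q ∧ u 3 * l = l ^ (q ^ 3) ∧
        u 5 * l = (δ / s ^ (q ^ 5)) * l ^ (q ^ 5) := by
    intro s A0 hAs hT hs
    obtain ⟨w, hw0, hw⟩ := aux_cyclic hFN (1 + q + q ^ 2) ((q - 1) * (q ^ 3 + 1)) (by omega)
      (by zify [hq1, hq6]; ring) A0 (by rw [pow_add, pow_add, pow_one]; exact hT)
    obtain ⟨z, hz⟩ : ∃ z, z = w ^ (q ^ 3 + 1) := ⟨_, rfl⟩
    have hz0 : z ≠ 0 := by rw [hz]; exact pow_ne_zero _ hw0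
    have hz3 : z ^ (q ^ 3) = z := by
      rw [hz, pow_succ, mul_pow, pq, p6, mul_comm]
    have hAz : A0 = z ^ q / z := by
      rw [eq_div_iff hz0, hw, mul_comm (q - 1), pow_mul, ← hz, ← pow_succ]
      congr 1; omega
    have hz1 : z ^ q ≠ 0 := pow_ne_zero _ hz0
    have hz5 : z ^ (q ^ 5) ≠ 0 := pow_ne_zero _ hz0
    have hs5 : s ^ (q ^ 5) ≠ 0 := pow_ne_zero _ hs
    refine ⟨μ * z, mul_ne_zero hμ0 hz0, ?_, ?_, ?_⟩
    · rw [hu1', hAs, hAz, mul_pow]; field_simp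
    · rw [hμ3, mul_pow, hz3]; field_simp
    · rw [hu5', hB0, hAs, hAz]
      simp only [mul_pow, div_pow, pq1, p6, Nat.reduceAdd]
      field_simp
  rcases mul_eq_zero.1 hT with h | h
  · obtain ⟨l, hl0, hl1, hl3, hl5⟩ := fin 1 A (by ring) (sub_eq_zero.1 h) one_ne_zero
    refine ⟨l, 1, δ, hl0, Or.inl ⟨rfl, rfl⟩, hl1, hl3, ?_⟩
    rw [hl5]; simp
  · have hd1 : δ ^ q ≠ 0 := pow_ne_zero _ hδ0
    obtain ⟨l, hl0, hl1, hl3, hl5⟩ := fin (δ ^ q) (A / δ ^ q) (by field_simp) (by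
      rw [div_pow, div_pow, pq3, hδ2, pq1, hδ3]
      field_simp
      linear_combination h) hd1
    refine ⟨l, δ ^ q, 1, hl0, Or.inr ⟨rfl, rfl⟩, hl1, hl3, ?_⟩
    rw [hl5, pq1, p6, div_self hδ0]

end classify2


section qpoly
variable {F : Type} [Field F] [Fintype F]

lemma aux_indep {q : ℕ} (hq : 2 ≤ q) (hF : Fintype.card F = q ^ 6) (u : Fin 6 → F)
    (h : ∀ x : F, ∑ i, u i * x ^ (q ^ (i : ℕ)) = 0) : u = 0 := by
  classical
  set P : Polynomial F := ∑ i : Fin 6, Polynomial.monomial (q ^ (i : ℕ)) (u i) with hP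
  have hdeg : P.natDegree < Fintype.card F := by
    rw [hF]
    refine lt_of_le_of_lt (Polynomial.natDegree_sum_le_of_forall_le (n := q ^ 5) _ _ ?_) ?_
    · intro i _
      refine (Polynomial.natDegree_monomial_le _).trans ?_
      exact Nat.pow_le_pow_right (by omega) (by omega)
    · exact Nat.pow_lt_pow_right (by omega) (by norm_num)
  have hP0 : P = 0 := by
    refine Polynomial.eq_zero_of_natDegree_lt_card_of_eval_eq_zero P (f := id)
      Function.injective_id ?_ hdeg
    intro x
    simpa [hP, Polynomial.eval_finsetSum, Polynomial.eval_monomial] using h x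
  ext j
  have hc := congrArg (fun Q => Polynomial.coeff Q (q ^ (j : ℕ))) hP0
  simp only [hP, Polynomial.finsetSum_coeff, Polynomial.coeff_monomial, Polynomial.coeff_zero] at hc
  have : ∀ i : Fin 6, (q ^ (i : ℕ) = q ^ (j : ℕ)) ↔ i = j := by
    intro i
    rw [Nat.pow_right_inj (by omega)]
    exact ⟨fun h => Fin.ext h, fun h => by rw [h]⟩
  simpa [this] using hc

def AuxIsQ (q : ℕ) (f : F → F) : Prop := ∃ u : Fin 6 → F, ∀ x, f x = ∑ i, u i * x ^ (q ^ (i : ℕ))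

lemma AuxIsQ.comp {q : ℕ} (hF : Fintype.card F = q ^ 6)
    (hadd : ∀ (n : ℕ), ∃ φ : F →+* F, ∀ x, φ x = x ^ (q ^ n)) {f g : F → F}
    (hf : AuxIsQ q f) (hg : AuxIsQ q g) : AuxIsQ q (f ∘ g) := by
  obtain ⟨u, hu⟩ := hf
  obtain ⟨v, hv⟩ := hg
  refine ⟨fun l => ∑ i, u i * v (l - i) ^ (q ^ (i : ℕ)), fun x => ?_⟩
  simp only [Function.comp, hu, Finset.sum_mul]
  rw [Finset.sum_comm]
  refine Finset.sum_congr rfl fun i _ => ?_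
  classical
  obtain ⟨φ, hφ⟩ := hadd i
  rw [← hφ, hv, map_sum, Finset.mul_sum, ← Equiv.sum_comp (Equiv.subRight i)]
  refine Finset.sum_congr rfl fun l _ => ?_
  simp only [Equiv.subRight_apply]
  rw [hφ, mul_pow, ← aux_pow_mod hF, sub_add_cancel, mul_assoc]

lemma AuxIsQ.inv {q : ℕ} (hF : Fintype.card F = q ^ 6)
    (hadd : ∀ (n : ℕ), ∃ φ : F →+* F, ∀ x, φ x = x ^ (q ^ n)) (A : Equiv.Perm F)
    (hA : AuxIsQ q A) : AuxIsQ q A.symm := by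
  classical
  have hpow : ∀ n : ℕ, AuxIsQ q ((A ^ n : Equiv.Perm F) : F → F) := by
    intro n
    induction n with
    | zero => 
      refine ⟨Pi.single 0 1, fun x => ?_⟩
      simp [Pi.single_apply]
    | succ n ih =>
      rw [pow_succ]
      exact ih.comp hF hadd hA
  have h1 : A ^ (orderOf A - 1) = A⁻¹ := by
    rw [eq_inv_iff_mul_eq_one, ← pow_succ, Nat.sub_add_cancel (orderOf_pos A), pow_orderOf_eq_one]
  have h2 := hpow (orderOf A - 1)
  rw [h1] at h2
  exact h2

lemma aux_adjoint {q : ℕ} (hq : 2 ≤ q) (hF : Fintype.card F = q ^ 6)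
    (hadd : ∀ (n : ℕ), ∃ φ : F →+* F, ∀ x, φ x = x ^ (q ^ n)) (s t v : F)
    (hex : ∃ x : F, x ≠ 0 ∧ s * x ^ q + x ^ (q ^ 3) + t * x ^ (q ^ 5) = v * x) :
    ∃ x : F, x ≠ 0 ∧ t ^ q * x ^ q + x ^ (q ^ 3) + s ^ (q ^ 5) * x ^ (q ^ 5) = v * x := by
  choose φ hφ using hadd
  have p6 : ∀ y : F, y ^ (q ^ 6) = y := fun y => by rw [← hF]; exact FiniteField.pow_card y
  let T : F →+ F := ∑ i : Fin 6, (φ (i : ℕ)).toAddMonoidHom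
  have hT : ∀ x, T x = ∑ i : Fin 6, x ^ (q ^ (i : ℕ)) := by
    intro x
    simp [T, hφ]
  have hT1 : ∀ x, T (x ^ q) = T x := by
    intro x
    simp only [hT, ← pow_mul, ← pow_succ']
    simp only [Fin.sum_univ_six]
    simp [p6]
    ring
  have hTn : ∀ n x, T (x ^ (q ^ n)) = T x := by
    intro n x
    induction n with
    | zero => simp
    | succ n ih => rw [pow_succ, pow_mul, hT1, ih]
  obtain ⟨x, hx0, hx⟩ := hex
  by_contra hcon
  push Not at hcon
  let L : F →+ F := (AddMonoidHom.mulLeft (t ^ q)).comp (φ 1).toAddMonoidHom + (φ 3).toAddMonoidHom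
    + (AddMonoidHom.mulLeft (s ^ (q ^ 5))).comp (φ 5).toAddMonoidHom - AddMonoidHom.mulLeft v
  have hL : ∀ x, L x = t ^ q * x ^ q + x ^ (q ^ 3) + s ^ (q ^ 5) * x ^ (q ^ 5) - v * x := by
    intro x
    simp [L, hφ]
  have hinj : Function.Injective L := by
    rw [injective_iff_map_eq_zero]
    intro y hy
    by_contra hy0
    rw [hL, sub_eq_zero] at hy
    exact hcon y hy0 hy
  have hsurj := Finite.injective_iff_surjective.1 hinj
  have hz : ∀ z, T (x * L z) = 0 := by
    intro z
    have e1 : T (x * (t ^ q * z ^ q)) = T (z * (t * x ^ (q ^ 5))) := by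
      rw [← hTn 5 (x * (t ^ q * z ^ q))]
      congr 1
      rw [mul_pow, mul_pow, ← pow_mul, ← pow_mul, ← pow_succ', p6, p6]
      ring
    have e3 : T (x * z ^ (q ^ 3)) = T (z * x ^ (q ^ 3)) := by
      rw [← hTn 3 (x * z ^ (q ^ 3))]
      congr 1
      rw [mul_pow, ← pow_mul, ← pow_add, p6]
      ring
    have e5 : T (x * (s ^ (q ^ 5) * z ^ (q ^ 5))) = T (z * (s * x ^ q)) := by
      rw [← hTn 1 (x * (s ^ (q ^ 5) * z ^ (q ^ 5)))]
      congr 1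
      rw [mul_pow, mul_pow, ← pow_mul, ← pow_mul, ← pow_add, p6, p6]
      ring
    have : T (x * L z) = T (z * (s * x ^ q + x ^ (q ^ 3) + t * x ^ (q ^ 5) - v * x)) := by
      rw [hL]
      simp only [mul_add, mul_sub, map_add, map_sub, e1, e3, e5]
      rw [show x * (v * z) = z * (v * x) by ring]
      ring
    rw [this, hx]
    simp
  have h0 := aux_indep hq hF (fun i => x ^ (q ^ (i : ℕ))) (by
    intro y
    obtain ⟨z, rfl⟩ := hsurj y
    have := hz z
    rw [hT] at this
    simpa only [mul_pow] using this)
  have := congrFun h0 0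
  simp at this
  exact hx0 this

end qpoly

section proj
variable {F : Type} [Field F]

lemma aux_mem_linearSet (f : F → F) (v : F × F) (hv : v ≠ 0) :
    Projectivization.mk F v hv ∈ linearSet f ↔
      v.1 ≠ 0 ∧ ∃ x, x ≠ 0 ∧ f x * v.1 = v.2 * x := by
  constructor
  · rintro ⟨x, hx, h⟩
    rw [Projectivization.mk_eq_mk_iff'] at h
    obtain ⟨t, ht⟩ := h
    have h1 : t * x = v.1 := congrArg Prod.fst ht
    have h2 : t * f x = v.2 := congrArg Prod.snd ht
    have ht0 : t ≠ 0 := by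
      rintro rfl
      apply hv
      rw [← ht]; simp
    refine ⟨by rw [← h1]; exact mul_ne_zero ht0 hx, x, hx, ?_⟩
    rw [← h1, ← h2]; ring
  · rintro ⟨hv1, x, hx, h⟩
    refine ⟨x, hx, ?_⟩
    rw [Projectivization.mk_eq_mk_iff']
    refine ⟨v.1 / x, ?_⟩
    ext
    · simp [hx]
    · simp
      field_simp
      linear_combination h

lemma aux_forward (f G : F → F) (h : IsPGammaLEquiv (linearSet f) (linearSet G)) :
    ∃ (ρ : F ≃+* F) (a b c d : F), a * d - b * c ≠ 0 ∧
      (∀ x, x ≠ 0 → a * ρ x + b * ρ (f x) ≠ 0) ∧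
      (∀ v, (∃ x, x ≠ 0 ∧ c * ρ x + d * ρ (f x) = v * (a * ρ x + b * ρ (f x))) ↔
        (∃ y, y ≠ 0 ∧ G y = v * y)) := by
  obtain ⟨ρ, g, hadd, hsmul, hmem⟩ := h
  obtain ⟨⟨a, c⟩, h10⟩ : ∃ w, g (1, 0) = w := ⟨_, rfl⟩
  obtain ⟨⟨b, d⟩, h01⟩ : ∃ w, g (0, 1) = w := ⟨_, rfl⟩
  have hg : ∀ x y, g (x, y) = (a * ρ x + b * ρ y, c * ρ x + d * ρ y) := by
    intro x y
    have : ((x, y) : F × F) = x • ((1 : F), (0 : F)) + y • ((0 : F), (1 : F)) := by simp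
    rw [this, hadd, hsmul, hsmul, h10, h01]
    ext <;> simp <;> ring
  have hg0 : g 0 = 0 := by
    have := hg 0 0
    simp at this
    exact this
  have hne : ∀ v, v ≠ 0 → g v ≠ 0 := fun v hv h => hv (g.injective (h.trans hg0.symm))
  have hf0 : ∀ x : F, x ≠ 0 → ((x, f x) : F × F) ≠ 0 := fun x hx h => hx (congrArg Prod.fst h)
  refine ⟨ρ, a, b, c, d, ?_, ?_, ?_⟩
  · intro hdet
    have h1 := hg (ρ.symm d) (ρ.symm (-c))
    have h2 := hg (ρ.symm b) (ρ.symm (-a))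
    simp only [RingEquiv.apply_symm_apply] at h1 h2
    have h1' : g (ρ.symm d, ρ.symm (-c)) = g 0 := by
      rw [h1, hg0]; ext
      · simp; linear_combination hdet
      · simp; ring
    have h2' : g (ρ.symm b, ρ.symm (-a)) = g 0 := by
      rw [h2, hg0]; ext
      · simp; ring
      · simp; linear_combination -hdet
    have h3 := g.injective h1'
    have h4 := g.injective h2'
    simp at h3 h4
    have h5 := hne (1, 0) (by simp)
    rw [h10] at h5
    apply h5
    rw [h3.2, h4.2]; rfl
  · intro x hx
    have h1 := (hmem (x, f x) (hf0 x hx) (hne _ (hf0 x hx))).1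
      ((aux_mem_linearSet _ _ _).2 ⟨hx, x, hx, rfl⟩)
    have h2 := ((aux_mem_linearSet _ _ _).1 h1).1
    rw [hg] at h2
    exact h2
  · intro v
    constructor
    · rintro ⟨x, hx, h⟩
      have h1 := (hmem (x, f x) (hf0 x hx) (hne _ (hf0 x hx))).1
        ((aux_mem_linearSet _ _ _).2 ⟨hx, x, hx, rfl⟩)
      obtain ⟨h2, y, hy, h3⟩ := (aux_mem_linearSet _ _ _).1 h1
      rw [hg] at h2 h3
      simp only at h2 h3
      rw [h] at h3
      exact ⟨y, hy, mul_right_cancel₀ h2 (by linear_combination h3)⟩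
    · rintro ⟨y, hy, h⟩
      obtain ⟨w, hw⟩ := g.surjective (y, G y)
      have hw0 : w ≠ 0 := by
        rintro rfl
        rw [hg0] at hw
        exact hy (congrArg Prod.fst hw).symm
      have h1 := (hmem w hw0 (hne _ hw0)).2 ((aux_mem_linearSet _ _ _).2 (by
        rw [hw]; exact ⟨hy, y, hy, rfl⟩))
      obtain ⟨h2, x, hx, h3⟩ := (aux_mem_linearSet _ _ _).1 h1
      refine ⟨x, hx, ?_⟩
      have h4 := hg w.1 w.2
      rw [Prod.mk.eta, hw] at h4
      have h5 : y = a * ρ w.1 + b * ρ w.2 := congrArg Prod.fst h4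
      have h6 : G y = c * ρ w.1 + d * ρ w.2 := congrArg Prod.snd h4
      have h7 : ρ (f x) * ρ w.1 = ρ w.2 * ρ x := by rw [← map_mul, h3, map_mul]
      have h8 : ρ w.1 ≠ 0 := by simpa using h2
      apply mul_right_cancel₀ h8
      rw [h6] at h
      rw [h5] at h
      linear_combination ρ x * h + (d - v * b) * h7

lemma aux_backward [Finite F] (f G : F → F) (ρ : F ≃+* F) (a b c d : F) (hdet : a * d - b * c ≠ 0)
    (h1 : ∀ x, x ≠ 0 → a * ρ x + b * ρ (f x) ≠ 0)
    (h2 : ∀ v, (∃ x, x ≠ 0 ∧ c * ρ x + d * ρ (f x) = v * (a * ρ x + b * ρ (f x))) ↔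
        (∃ y, y ≠ 0 ∧ G y = v * y)) : IsPGammaLEquiv (linearSet f) (linearSet G) := by
  let g0 : F × F → F × F := fun v => (a * ρ v.1 + b * ρ v.2, c * ρ v.1 + d * ρ v.2)
  have hinj : Function.Injective g0 := by
    intro v w h
    have e1 : a * ρ v.1 + b * ρ v.2 = a * ρ w.1 + b * ρ w.2 := congrArg Prod.fst h
    have e2 : c * ρ v.1 + d * ρ v.2 = c * ρ w.1 + d * ρ w.2 := congrArg Prod.snd h
    ext
    · apply ρ.injective
      apply mul_left_cancel₀ hdet
      linear_combination d * e1 - b * e2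
    · apply ρ.injective
      apply mul_left_cancel₀ hdet
      linear_combination a * e2 - c * e1
  refine ⟨ρ, Equiv.ofBijective g0 (Finite.injective_iff_bijective.1 hinj), ?_, ?_, ?_⟩
  · intro u v
    ext <;> simp [g0] <;> ring
  · intro r v
    ext <;> simp [g0] <;> ring
  · intro v hv hgv
    rw [aux_mem_linearSet, aux_mem_linearSet]
    simp only [Equiv.ofBijective_apply, g0]
    constructor
    · rintro ⟨hv1, x, hx, h⟩
      have hv1' : ρ v.1 ≠ 0 := by simpa using hv1
      have hx' : ρ x ≠ 0 := by simpa using hx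
      have h7 : ρ (f x) * ρ v.1 = ρ v.2 * ρ x := by rw [← map_mul, h, map_mul]
      have hA := h1 x hx
      have hAv : a * ρ v.1 + b * ρ v.2 ≠ 0 := by
        intro h0
        apply mul_ne_zero hv1' hA
        linear_combination ρ x * h0 + b * h7
      refine ⟨hAv, ?_⟩
      obtain ⟨y, hy, h8⟩ := (h2 ((c * ρ x + d * ρ (f x)) / (a * ρ x + b * ρ (f x)))).1
        ⟨x, hx, (div_mul_cancel₀ _ hA).symm⟩
      refine ⟨y, hy, ?_⟩
      rw [h8, div_mul_eq_mul_div, div_mul_eq_mul_div, div_eq_iff hA]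
      linear_combination y * (a * d - b * c) * h7
    · rintro ⟨hAv, y, hy, h⟩
      obtain ⟨x, hx, h8⟩ := (h2 ((c * ρ v.1 + d * ρ v.2) / (a * ρ v.1 + b * ρ v.2))).2
        ⟨y, hy, by
          rw [div_mul_eq_mul_div, eq_div_iff hAv]; linear_combination h⟩
      have hx' : ρ x ≠ 0 := by simpa using hx
      have h9 : ρ (f x) * ρ v.1 = ρ v.2 * ρ x := by
        rw [div_mul_eq_mul_div, eq_div_iff hAv] at h8
        apply mul_left_cancel₀ hdet
        linear_combination h8
      refine ⟨?_, x, hx, ?_⟩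
      · intro h0
        rw [h0, map_zero, mul_zero] at h9
        rcases mul_eq_zero.1 h9.symm with h10 | h10
        · have : v.2 = 0 := by simpa using h10
          exact hv (Prod.ext h0 this)
        · exact hx' h10
      · apply ρ.injective
        rw [map_mul, map_mul, h9]

end proj

set_option linter.unusedSimpArgs false
set_option linter.unusedSectionVars false
section system
variable {F : Type} [Field F] [Fintype F]

def AuxId (q : ℕ) (k a b c d s1 s5 : F) : Prop :=
  ∀ x : F, c * x + d * fpol q k x = s1 * (a * x + b * fpol q k x) ^ q
    + (a * x + b * fpol q k x) ^ (q ^ 3) + s5 * (a * x + b * fpol q k x) ^ (q ^ 5)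

lemma aux_fpol {q : ℕ} (hq : 2 ≤ q) (k : F) (hk : k ≠ 0) (x : F) :
    fpol q k x = k ^ q / k * x ^ q - k ^ (q ^ 2) / k * x ^ (q ^ 2) + x ^ (q ^ 4) + x ^ (q ^ 5) := by
  have h1 : 1 ≤ q := by omega
  have h2 : 1 ≤ q ^ 2 := Nat.one_le_pow _ _ (by omega)
  unfold fpol
  rw [pow_sub₀ k hk h1, pow_sub₀ k hk h2, pow_one]
  simp only [div_eq_mul_inv]

lemma aux_expand {q : ℕ} (hq : 2 ≤ q) (hF : Fintype.card F = q ^ 6)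
    (hadd : ∀ (n : ℕ), ∃ φ : F →+* F, ∀ x, φ x = x ^ (q ^ n))
    (k : F) (hk : k * k ^ (q ^ 3) = -1) (a b c d s1 s5 : F) :
    AuxId q k a b c d s1 s5 ↔
      (c = s1 * b ^ q - s5 * (k * k ^ (q ^ 2)) * b ^ (q ^ 5) ∧
      d * (k ^ q / k) = s1 * a ^ q + b ^ (q ^ 3) + s5 * (k ^ q * k ^ (q ^ 2)) * b ^ (q ^ 5) ∧
      - (d * (k ^ (q ^ 2) / k)) = s1 * b ^ q * (k ^ (q ^ 2) / k ^ q) + b ^ (q ^ 3) ∧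
      0 = s1 * b ^ q * (1 / (k * k ^ q)) + a ^ (q ^ 3) + s5 * b ^ (q ^ 5) ∧
      d = b ^ (q ^ 3) * (k / k ^ q) + s5 * b ^ (q ^ 5) ∧
      d = s1 * b ^ q - b ^ (q ^ 3) * (k / k ^ (q ^ 2)) + s5 * a ^ (q ^ 5)) := by
  have p6 : ∀ y : F, y ^ (q ^ 6) = y := fun y => by rw [← hF]; exact FiniteField.pow_card y
  have hk0 : k ≠ 0 := by
    rintro rfl
    simp at hk
  choose φ hφ using hadd
  have hmn : ∀ m n, ∀ y : F, (y ^ (q ^ m)) ^ (q ^ n) = y ^ (q ^ (m + n)) := fun m n y => by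
    rw [← pow_mul, ← pow_add]
  have hn : ∀ n, ∀ y : F, y ^ (q ^ (6 + n)) = y ^ (q ^ n) := fun n y => by
    rw [← hmn, p6]
  have k3 : k ^ (q ^ 3) = - 1 / k := by
    rw [eq_div_iff hk0]; linear_combination hk
  have k4 : k ^ (q ^ 4) = - 1 / k ^ q := by
    have : (φ 1) (k * k ^ (q ^ 3)) = φ 1 (-1) := by rw [hk]
    rw [map_mul, map_neg, map_one, hφ, hφ, hmn, pow_one] at this
    rw [eq_div_iff (pow_ne_zero _ hk0)]; linear_combination this
  have k5 : k ^ (q ^ 5) = - 1 / k ^ (q ^ 2) := by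
    have : (φ 2) (k * k ^ (q ^ 3)) = φ 2 (-1) := by rw [hk]
    rw [map_mul, map_neg, map_one, hφ, hφ, hmn] at this
    rw [eq_div_iff (pow_ne_zero _ hk0)]; linear_combination this
  have hq1 : ∀ y : F, y ^ q = y ^ (q ^ 1) := fun y => by rw [pow_one]
  have hfn : ∀ n x, (a * x + b * fpol q k x) ^ (q ^ n) = a ^ (q ^ n) * x ^ (q ^ n) + b ^ (q ^ n) *
      (k ^ (q ^ (1 + n)) / k ^ (q ^ n) * x ^ (q ^ (1 + n))
        - k ^ (q ^ (2 + n)) / k ^ (q ^ n) * x ^ (q ^ (2 + n))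
        + x ^ (q ^ (4 + n)) + x ^ (q ^ (5 + n))) := by
    intro n x
    rw [← hφ n, aux_fpol hq k hk0]
    simp only [map_add, map_mul, map_sub, map_div₀]
    simp only [hφ]
    rw [hq1 k, hq1 x]
    simp only [hmn]
  have hf1 := hfn 1
  have hf3 := hfn 3
  have hf5 := hfn 5
  simp only [Nat.reduceAdd, p6, hn 1, show 7 = 6 + 1 from rfl, show 8 = 6 + 2 from rfl,
    show 9 = 6 + 3 from rfl, show 10 = 6 + 4 from rfl, hn 2, hn 3, hn 4] at hf1 hf3 hf5
  rw [k3] at hf1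
  rw [k3, k4, k5] at hf3
  rw [k5] at hf5
  simp only [← hq1] at hf1 hf3 hf5
  have hk1 : k ^ q ≠ 0 := pow_ne_zero _ hk0
  have hk2 : k ^ (q ^ 2) ≠ 0 := pow_ne_zero _ hk0
  set K1 := k ^ q
  set K2 := k ^ (q ^ 2)
  let u : Fin 6 → F := ![c - (s1 * b ^ q - s5 * (k * K2) * b ^ (q ^ 5)),
      d * (K1 / k) - (s1 * a ^ q + b ^ (q ^ 3) + s5 * (K1 * K2) * b ^ (q ^ 5)),
      - (d * (K2 / k)) - (s1 * b ^ q * (K2 / K1) + b ^ (q ^ 3)),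
      0 - (s1 * b ^ q * (1 / (k * K1)) + a ^ (q ^ 3) + s5 * b ^ (q ^ 5)),
      d - (b ^ (q ^ 3) * (k / K1) + s5 * b ^ (q ^ 5)),
      d - (s1 * b ^ q - b ^ (q ^ 3) * (k / K2) + s5 * a ^ (q ^ 5))]
  have hu : ∀ x, (c * x + d * fpol q k x) - (s1 * (a * x + b * fpol q k x) ^ q
    + (a * x + b * fpol q k x) ^ (q ^ 3) + s5 * (a * x + b * fpol q k x) ^ (q ^ 5))
      = ∑ i, u i * x ^ (q ^ (i : ℕ)) := by
    intro x
    rw [hf1, hf3, hf5, aux_fpol hq k hk0, Fin.sum_univ_six]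
    simp only [u, Matrix.cons_val]
    simp
    field_simp
    ring
  constructor
  · intro h
    have h0 := aux_indep hq hF u (fun x => by rw [← hu, sub_eq_zero]; exact h x)
    refine ⟨?_, ?_, ?_, ?_, ?_, ?_⟩
    · exact sub_eq_zero.1 (congrFun h0 0)
    · exact sub_eq_zero.1 (congrFun h0 1)
    · exact sub_eq_zero.1 (congrFun h0 2)
    · exact sub_eq_zero.1 (congrFun h0 3)
    · exact sub_eq_zero.1 (congrFun h0 4)
    · exact sub_eq_zero.1 (congrFun h0 5)
  · rintro ⟨h0, h1, h2, h3, h4, h5⟩ x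
    rw [← sub_eq_zero, hu, Fin.sum_univ_six]
    simp only [u, Matrix.cons_val]
    rw [sub_eq_zero.2 h0, sub_eq_zero.2 h1, sub_eq_zero.2 h2, sub_eq_zero.2 h3, sub_eq_zero.2 h4,
      sub_eq_zero.2 h5]
    simp

lemma aux_Ea {q : ℕ} (hF : Fintype.card F = q ^ 6)
    (hadd : ∀ (n : ℕ), ∃ φ : F →+* F, ∀ x, φ x = x ^ (q ^ n))
    (k : F) (hk : k * k ^ (q ^ 3) = -1) (a b s1 s5 : F) (hs1 : s1 ^ (q ^ 2) = s1)
    (hs5 : s5 ^ (q ^ 2) = s5) :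
    (0 = s1 * b ^ q * (1 / (k * k ^ q)) + a ^ (q ^ 3) + s5 * b ^ (q ^ 5) ↔
      a = - s1 ^ q * (k * k ^ q) * b ^ (q ^ 4) - s5 ^ q * b ^ (q ^ 2)) ∧
    (a = - s1 ^ q * (k * k ^ q) * b ^ (q ^ 4) - s5 ^ q * b ^ (q ^ 2) →
      a ^ q = - s1 * (k ^ q * k ^ (q ^ 2)) * b ^ (q ^ 5) - s5 * b ^ (q ^ 3) ∧
      a ^ (q ^ 5) = s1 * (k / k ^ (q ^ 2)) * b ^ (q ^ 3) - s5 * b ^ q) := by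
  have p6 : ∀ y : F, y ^ (q ^ 6) = y := fun y => by rw [← hF]; exact FiniteField.pow_card y
  have hk0 : k ≠ 0 := by
    rintro rfl
    simp at hk
  choose φ hφ using hadd
  have hmn : ∀ m n, ∀ y : F, (y ^ (q ^ m)) ^ (q ^ n) = y ^ (q ^ (m + n)) := fun m n y => by
    rw [← pow_mul, ← pow_add]
  have hn : ∀ n, ∀ y : F, y ^ (q ^ (6 + n)) = y ^ (q ^ n) := fun n y => by
    rw [← hmn, p6]
  have k3 : k ^ (q ^ 3) = - 1 / k := by
    rw [eq_div_iff hk0]; linear_combination hk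
  have k4 : k ^ (q ^ 4) = - 1 / k ^ q := by
    have : (φ 1) (k * k ^ (q ^ 3)) = φ 1 (-1) := by rw [hk]
    rw [map_mul, map_neg, map_one, hφ, hφ, hmn, pow_one] at this
    rw [eq_div_iff (pow_ne_zero _ hk0)]; linear_combination this
  have k5 : k ^ (q ^ 5) = - 1 / k ^ (q ^ 2) := by
    have : (φ 2) (k * k ^ (q ^ 3)) = φ 2 (-1) := by rw [hk]
    rw [map_mul, map_neg, map_one, hφ, hφ, hmn] at this
    rw [eq_div_iff (pow_ne_zero _ hk0)]; linear_combination this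
  have hq1 : ∀ y : F, y ^ q = y ^ (q ^ 1) := fun y => by rw [pow_one]
  have hs : ∀ s : F, s ^ (q ^ 2) = s → s ^ (q ^ 4) = s ∧ s ^ (q ^ 3) = s ^ q := by
    intro s h
    refine ⟨?_, ?_⟩
    · rw [← hmn 2 2, h, h]
    · rw [← hmn 2 1, h, pow_one]
  obtain ⟨s14, s13⟩ := hs s1 hs1
  obtain ⟨s54, s53⟩ := hs s5 hs5
  have hk1 : k ^ q ≠ 0 := pow_ne_zero _ hk0
  have hk2 : k ^ (q ^ 2) ≠ 0 := pow_ne_zero _ hk0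
  have key : ∀ n, (- s1 ^ q * (k * k ^ q) * b ^ (q ^ 4) - s5 ^ q * b ^ (q ^ 2)) ^ (q ^ n)
      = - s1 ^ (q ^ (1 + n)) * (k ^ (q ^ n) * k ^ (q ^ (1 + n))) * b ^ (q ^ (4 + n))
        - s5 ^ (q ^ (1 + n)) * b ^ (q ^ (2 + n)) := by
    intro n
    rw [← hφ n]
    simp only [map_sub, map_mul, map_neg]
    simp only [hφ]
    rw [hq1 s1, hq1 s5, hq1 k]
    simp only [hmn]
  have key1 := key 1
  have key3 := key 3
  have key5 := key 5
  simp only [Nat.reduceAdd, p6, hn 1, show 7 = 6 + 1 from rfl, show 8 = 6 + 2 from rfl,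
    show 9 = 6 + 3 from rfl, show 10 = 6 + 4 from rfl, hn 2, hn 3, hn 4, hs1, hs5, s13, s14,
    s53, s54, k3, k4, k5] at key1 key3 key5
  simp only [← hq1] at key1 key3 key5
  have hinj : ∀ x y : F, x ^ (q ^ 3) = y ^ (q ^ 3) → x = y := by
    intro x y h
    have := congrArg (fun z => z ^ (q ^ 3)) h
    simpa only [hmn, Nat.reduceAdd, p6] using this
  refine ⟨⟨fun h => hinj _ _ ?_, fun h => ?_⟩, fun h => ⟨?_, ?_⟩⟩
  · rw [key3]
    have : a ^ (q ^ 3) = - (s1 * b ^ q * (1 / (k * k ^ q))) - s5 * b ^ (q ^ 5) := by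
      linear_combination -h
    rw [this]; field_simp
  · rw [h, key3]; field_simp; ring
  · rw [h, key1]
  · rw [h, key5]; field_simp

end system

set_option linter.unusedSectionVars false
section system2
variable {F : Type} [Field F] [Fintype F]

lemma aux_exps {q : ℕ} (hq : 2 ≤ q) (k : F) (hk : k ≠ 0) :
    k ^ (q - 1) = k ^ q / k ∧ k ^ (q ^ 2 - 1) = k ^ (q ^ 2) / k ∧
    k ^ (q ^ 2 - q) = k ^ (q ^ 2) / k ^ q ∧ k ^ ((1 : ℤ) - (q : ℤ)) = k / k ^ q ∧
    k ^ ((1 : ℤ) - (q : ℤ) ^ 2) = k / k ^ (q ^ 2) := by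
  have h1 : 1 ≤ q := by omega
  have h2 : 1 ≤ q ^ 2 := Nat.one_le_pow _ _ (by omega)
  have h3 : q ≤ q ^ 2 := by nlinarith
  refine ⟨?_, ?_, ?_, ?_, ?_⟩
  · rw [pow_sub₀ k hk h1, pow_one, div_eq_mul_inv]
  · rw [pow_sub₀ k hk h2, pow_one, div_eq_mul_inv]
  · rw [pow_sub₀ k hk h3, div_eq_mul_inv]
  · rw [zpow_sub₀ hk, zpow_one, zpow_natCast]
  · rw [zpow_sub₀ hk, zpow_one, ← Nat.cast_pow, zpow_natCast]

lemma aux_sysI {q : ℕ} (hq : 2 ≤ q) (hF : Fintype.card F = q ^ 6)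
    (hadd : ∀ (n : ℕ), ∃ φ : F →+* F, ∀ x, φ x = x ^ (q ^ n))
    (k : F) (hk : k * k ^ (q ^ 3) = -1) (δ : F) (hδ : δ ^ 2 + δ = 1) (hδ2 : δ ^ (q ^ 2) = δ)
    (hδ0 : δ ≠ 0) (a b c d : F) :
    AuxId q k a b c d 1 δ ↔
      (c = b ^ q - δ * k ^ (q ^ 2 + 1) * b ^ (q ^ 5) ∧
          a = -(k ^ (q + 1)) * b ^ (q ^ 4) - δ ^ q * b ^ (q ^ 2) ∧
          d = k ^ ((1 : ℤ) - (q : ℤ)) * b ^ (q ^ 3) + δ * b ^ (q ^ 5) ∧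
          b ^ (q ^ 3) + (k ^ (q - 1) + δ * k ^ (q + q ^ 2)) * b ^ (q ^ 5) = 0 ∧
          k ^ (q ^ 2 - q) * b ^ q + (1 + k ^ (q ^ 2 - q)) * b ^ (q ^ 3)
            + δ * k ^ (q ^ 2 - 1) * b ^ (q ^ 5) = 0 ∧
          -δ * b ^ q + (k ^ ((1 : ℤ) - (q : ℤ))
            + δ ^ 2 * k ^ ((1 : ℤ) - (q : ℤ) ^ 2)) * b ^ (q ^ 3) + δ * b ^ (q ^ 5) = 0) := by
  have hk0 : k ≠ 0 := by
    rintro rfl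
    simp at hk
  have hk1 : k ^ q ≠ 0 := pow_ne_zero _ hk0
  have hk2 : k ^ (q ^ 2) ≠ 0 := pow_ne_zero _ hk0
  obtain ⟨e1, e2, e3, e4, e5⟩ := aux_exps hq k hk0
  rw [aux_expand hq hF hadd k hk, e1, e2, e3, e4, e5, pow_succ k (q ^ 2), pow_succ k q, pow_add k q]
  obtain ⟨ea, eb⟩ := aux_Ea hF hadd k hk a b 1 δ (one_pow _) hδ2
  rw [ea]
  simp only [one_pow] at eb ⊢
  generalize k ^ q = k1 at *
  generalize k ^ (q ^ 2) = k2 at *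
  generalize a ^ q = a1 at *
  generalize a ^ (q ^ 5) = a5 at *
  generalize b ^ q = b1 at *
  generalize b ^ (q ^ 2) = b2 at *
  generalize b ^ (q ^ 3) = b3 at *
  generalize b ^ (q ^ 4) = b4 at *
  generalize b ^ (q ^ 5) = b5 at *
  generalize δ ^ q = δ1 at *
  constructor
  · rintro ⟨h0, h1, h2, h3, h4, h5⟩
    obtain ⟨r1, r5⟩ := eb h3
    rw [r1, h4] at h1
    rw [h4] at h2
    rw [h4, r5] at h5
    refine ⟨by rw [h0]; ring, by rw [h3]; ring, by rw [h4]; ring, ?_, ?_, ?_⟩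
    · field_simp at h1 ⊢
      apply mul_left_cancel₀ hδ0
      linear_combination h1 + k * k1 * k2 * b5 * hδ
    · field_simp at h2 ⊢
      linear_combination -h2
    · field_simp at h5 ⊢
      linear_combination h5 - (b1 * k1 * k2 - k * k1 * b3) * hδ
  · rintro ⟨h0, h3, h4, h1, h2, h5⟩
    have h3' : a = -1 * (k * k1) * b4 - δ1 * b2 := by rw [h3]; ring
    obtain ⟨r1, r5⟩ := eb h3'
    refine ⟨by rw [h0]; ring, ?_, ?_, h3', by rw [h4]; ring, ?_⟩
    · rw [r1, h4]
      field_simp at h1 ⊢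
      linear_combination δ * h1 - k * k1 * k2 * b5 * hδ
    · rw [h4]
      field_simp at h2 ⊢
      linear_combination -h2
    · rw [r5, h4]
      field_simp at h5 ⊢
      linear_combination h5 + (b1 * k1 * k2 - k * k1 * b3) * hδ

lemma aux_sysII {q : ℕ} (hq : 2 ≤ q) (hF : Fintype.card F = q ^ 6)
    (hadd : ∀ (n : ℕ), ∃ φ : F →+* F, ∀ x, φ x = x ^ (q ^ n))
    (k : F) (hk : k * k ^ (q ^ 3) = -1) (δ : F) (hδ : δ ^ 2 + δ = 1) (hδ2 : δ ^ (q ^ 2) = δ)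
    (a b c d : F) :
    AuxId q k a b c d δ 1 ↔
      (c = δ * b ^ q - k ^ (q ^ 2 + 1) * b ^ (q ^ 5) ∧
          a = -(δ ^ q) * k ^ (q + 1) * b ^ (q ^ 4) - b ^ (q ^ 2) ∧
          d = k ^ ((1 : ℤ) - (q : ℤ)) * b ^ (q ^ 3) + b ^ (q ^ 5) ∧
          δ * b ^ (q ^ 3) + (k ^ (q - 1) - δ * k ^ (q ^ 2 + q)) * b ^ (q ^ 5) = 0 ∧
          δ * k ^ (q ^ 2 - q) * b ^ q + (k ^ (q ^ 2 - q) + 1) * b ^ (q ^ 3)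
            + k ^ (q ^ 2 - 1) * b ^ (q ^ 5) = 0 ∧
          δ ^ 2 * b ^ q + (k ^ ((1 : ℤ) - (q : ℤ))
            + δ ^ 2 * k ^ ((1 : ℤ) - (q : ℤ) ^ 2)) * b ^ (q ^ 3) + b ^ (q ^ 5) = 0) := by
  have hk0 : k ≠ 0 := by
    rintro rfl
    simp at hk
  have hk1 : k ^ q ≠ 0 := pow_ne_zero _ hk0
  have hk2 : k ^ (q ^ 2) ≠ 0 := pow_ne_zero _ hk0
  obtain ⟨e1, e2, e3, e4, e5⟩ := aux_exps hq k hk0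
  rw [aux_expand hq hF hadd k hk, e1, e2, e3, e4, e5, pow_succ k (q ^ 2), pow_succ k q, pow_add k (q ^ 2) q]
  obtain ⟨ea, eb⟩ := aux_Ea hF hadd k hk a b δ 1 hδ2 (one_pow _)
  rw [ea]
  simp only [one_pow] at eb ⊢
  generalize k ^ q = k1 at *
  generalize k ^ (q ^ 2) = k2 at *
  generalize a ^ q = a1 at *
  generalize a ^ (q ^ 5) = a5 at *
  generalize b ^ q = b1 at *
  generalize b ^ (q ^ 2) = b2 at *
  generalize b ^ (q ^ 3) = b3 at *
  generalize b ^ (q ^ 4) = b4 at *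
  generalize b ^ (q ^ 5) = b5 at *
  generalize δ ^ q = δ1 at *
  constructor
  · rintro ⟨h0, h1, h2, h3, h4, h5⟩
    obtain ⟨r1, r5⟩ := eb h3
    rw [r1, h4] at h1
    rw [h4] at h2
    rw [h4, r5] at h5
    refine ⟨by rw [h0]; ring, by rw [h3]; ring, by rw [h4]; ring, ?_, ?_, ?_⟩
    · field_simp at h1 ⊢
      linear_combination h1 - k * k1 * k2 * b5 * hδ
    · field_simp at h2 ⊢
      linear_combination -h2
    · field_simp at h5 ⊢
      linear_combination h5 + (b1 * k1 * k2 + k * k1 * b3) * hδ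
  · rintro ⟨h0, h3, h4, h1, h2, h5⟩
    have h3' : a = -δ1 * (k * k1) * b4 - 1 * b2 := by rw [h3]; ring
    obtain ⟨r1, r5⟩ := eb h3'
    refine ⟨by rw [h0]; ring, ?_, ?_, h3', by rw [h4]; ring, ?_⟩
    · rw [r1, h4]
      field_simp at h1 ⊢
      linear_combination h1 + k * k1 * k2 * b5 * hδ
    · rw [h4]
      field_simp at h2 ⊢
      linear_combination -h2
    · rw [r5, h4]
      field_simp at h5 ⊢
      linear_combination h5 - (b1 * k1 * k2 + k * k1 * b3) * hδ

lemma aux_map_fpol (q : ℕ) (φ : F →+* F) (k x : F) : φ (fpol q k x) = fpol q (φ k) (φ x) := by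
  simp [fpol]

lemma aux_transfer (q : ℕ) (ψ : F ≃+* F) (k a b c d s1 s5 : F) (h : AuxId q k a b c d s1 s5) :
    AuxId q (ψ k) (ψ a) (ψ b) (ψ c) (ψ d) (ψ s1) (ψ s5) := by
  intro x
  obtain ⟨x, rfl⟩ := ψ.surjective x
  have := congrArg ψ (h x)
  have e : ψ (fpol q k x) = fpol q (ψ k) (ψ x) := aux_map_fpol q (ψ : F →+* F) k x
  simpa only [map_add, map_mul, map_pow, e] using this

end system2

section final
variable {F : Type} [Field F] [Fintype F]

lemma aux_fpol_add {q : ℕ}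
    (hadd : ∀ (n : ℕ), ∃ φ : F →+* F, ∀ x, φ x = x ^ (q ^ n)) (k x y : F) :
    fpol q k (x - y) = fpol q k x - fpol q k y := by
  choose φ hφ using hadd
  have h : ∀ n, (x - y) ^ (q ^ n) = x ^ (q ^ n) - y ^ (q ^ n) := fun n => by
    rw [← hφ, map_sub, hφ, hφ]
  have h1 := h 1
  rw [pow_one] at h1
  unfold fpol
  rw [h1, h 2, h 4, h 5]
  ring

lemma aux_isQ_lin (q : ℕ) (k a b : F) : AuxIsQ q (fun z : F => a * z + b * fpol q k z) := by
  refine ⟨![a, b * k ^ (q - 1), -(b * k ^ (q ^ 2 - 1)), 0, b, b], fun x => ?_⟩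
  rw [Fin.sum_univ_six]
  simp [fpol]
  ring

lemma aux_main_fwd {q : ℕ} (p : ℕ) [Fact p.Prime] [CharP F p] (hq : 2 ≤ q)
    (hF : Fintype.card F = q ^ 6)
    (hadd : ∀ (n : ℕ), ∃ φ : F →+* F, ∀ x, φ x = x ^ (q ^ n))
    (δ : F) (hδ0 : δ ≠ 0) (hδ2 : δ ^ (q ^ 2) = δ) (k a b c d : F)
    (hA : ∀ z, z ≠ 0 → a * z + b * fpol q k z ≠ 0)
    (hv : ∀ v, (∃ z, z ≠ 0 ∧ c * z + d * fpol q k z = v * (a * z + b * fpol q k z)) ↔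
      (∃ y : F, y ≠ 0 ∧ y ^ q + y ^ (q ^ 3) + δ * y ^ (q ^ 5) = v * y)) :
    ∃ l s1 s5, l ≠ 0 ∧ ((s1 = 1 ∧ s5 = δ) ∨ (s1 = δ ^ q ∧ s5 = 1)) ∧
      AuxId q k (l * a) (l * b) (l * c) (l * d) s1 s5 := by
  have hinj : Function.Injective (fun z : F => a * z + b * fpol q k z) := by
    intro x y hxy
    by_contra hne
    apply hA (x - y) (sub_ne_zero.2 hne)
    rw [aux_fpol_add hadd]
    simp only at hxy
    linear_combination hxy
  let A : Equiv.Perm F := Equiv.ofBijective _ (Finite.injective_iff_bijective.1 hinj)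
  have hAz : ∀ z, A z = a * z + b * fpol q k z := fun z => rfl
  have hAQ : AuxIsQ q A := aux_isQ_lin q k a b
  obtain ⟨u, hu⟩ := (aux_isQ_lin q k c d).comp hF hadd (AuxIsQ.inv hF hadd A hAQ)
  have hC : ∀ z, c * z + d * fpol q k z = ∑ i, u i * (a * z + b * fpol q k z) ^ (q ^ (i : ℕ)) := by
    intro z
    have := hu (A z)
    rw [Function.comp, Equiv.symm_apply_apply, hAz] at this
    exact this
  have hset : ∀ v, (∃ x, x ≠ 0 ∧ ∑ i, u i * x^(q^(i:ℕ)) = v*x) ↔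
      (∃ x, x ≠ 0 ∧ ∑ i, (![0,1,0,1,0,δ] : Fin 6 → F) i * x^(q^(i:ℕ)) = v*x) := by
    intro v
    have e : ∀ x : F, ∑ i, (![0,1,0,1,0,δ] : Fin 6 → F) i * x^(q^(i:ℕ))
        = x ^ q + x ^ (q ^ 3) + δ * x ^ (q ^ 5) := by
      intro x
      rw [Fin.sum_univ_six]
      simp
    simp only [e]
    rw [← hv]
    constructor
    · rintro ⟨x, hx, h⟩
      obtain ⟨z, rfl⟩ := A.surjective x
      refine ⟨z, ?_, ?_⟩
      · rintro rfl
        apply hx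
        have := aux_fpol_add hadd k 0 0
        simp only [sub_self] at this
        rw [hAz, this]; simp
      · rw [hC]; exact h
    · rintro ⟨z, hz, h⟩
      refine ⟨_, hA z hz, ?_⟩
      rw [← hC, h]
  obtain ⟨i0, i1, i2, i3, i4, i5⟩ := aux_identities p hq hF hadd δ u hset
  obtain ⟨j2, j4, l, s1, s5, hl, hs, m1, m3, m5⟩ := aux_classify hq hF δ hδ0 hδ2 u i1 i2 i3 i4 i5
  refine ⟨l, s1, s5, hl, hs, fun z => ?_⟩
  have e1 : l * a * z + l * b * fpol q k z = l * (a * z + b * fpol q k z) := by ring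
  have e2 : l * c * z + l * d * fpol q k z = l * (c * z + d * fpol q k z) := by ring
  rw [e1, e2, hC, Fin.sum_univ_six, i0, j2, j4]
  simp only [mul_pow]
  simp
  linear_combination (a * z + b * fpol q k z) ^ q * m1
    + (a * z + b * fpol q k z) ^ (q ^ 3) * m3 + (a * z + b * fpol q k z) ^ (q ^ 5) * m5

lemma aux_main_bwd {q : ℕ} (hq : 2 ≤ q)
    (hadd : ∀ (n : ℕ), ∃ φ : F →+* F, ∀ x, φ x = x ^ (q ^ n))
    (k a b c d s1 s5 : F) (hdet : a * d - b * c ≠ 0) (h : AuxId q k a b c d s1 s5) :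
    (∀ z, z ≠ 0 → a * z + b * fpol q k z ≠ 0) ∧
    (∀ v, (∃ z, z ≠ 0 ∧ c * z + d * fpol q k z = v * (a * z + b * fpol q k z)) ↔
      (∃ y : F, y ≠ 0 ∧ s1 * y ^ q + y ^ (q ^ 3) + s5 * y ^ (q ^ 5) = v * y)) := by
  have hA : ∀ z, z ≠ 0 → a * z + b * fpol q k z ≠ 0 := by
    intro z hz h0
    have h1 := h z
    rw [h0, zero_pow (by omega), zero_pow (pow_ne_zero _ (by omega)),
      zero_pow (pow_ne_zero _ (by omega))] at h1
    apply mul_ne_zero hdet hz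
    linear_combination d * h0 - b * h1
  refine ⟨hA, fun v => ?_⟩
  have hinj : Function.Injective (fun z : F => a * z + b * fpol q k z) := by
    intro x y hxy
    by_contra hne
    apply hA (x - y) (sub_ne_zero.2 hne)
    rw [aux_fpol_add hadd]
    simp only at hxy
    linear_combination hxy
  constructor
  · rintro ⟨z, hz, h1⟩
    exact ⟨_, hA z hz, by rw [← h1]; exact (h z).symm⟩
  · rintro ⟨y, hy, h1⟩
    obtain ⟨z, rfl⟩ := Finite.injective_iff_surjective.1 hinj y
    refine ⟨z, ?_, ?_⟩
    · rintro rfl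
      apply hy
      have := aux_fpol_add hadd k 0 0
      simp only [sub_self] at this
      simp [this]
    · rw [h z]; exact h1

end final

/-- Let `q` be an odd prime power, `F` a finite field with `q^6` elements,
`h ∈ F` with `h^(q^3+1) = −1`, and `δ ∈ F` with `δ^2 + δ = 1`. Then `𝓛_h` is
PΓL-equivalent to `L^4_δ` iff there exist `a, b, c, d ∈ F` and a field automorphism `ρ`
of `F` with `a·d − b·c ≠ 0` satisfying, with `k = ρ h`, system (I) or system (II)
(negative exponents of `k` are integer powers, i.e. powers of `k⁻¹`). -/
theorem stmt11 (q : ℕ) (hq : IsPrimePow q) (hodd : Odd q)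
    (F : Type) [Field F] [Fintype F] (hF : Fintype.card F = q ^ 6)
    (h : F) (hh : h ^ (q ^ 3 + 1) = -1)
    (δ : F) (hδ : δ ^ 2 + δ = 1) :
    IsPGammaLEquiv (linearSet (fpol q h))
        (linearSet (fun x : F => x ^ q + x ^ (q ^ 3) + δ * x ^ (q ^ 5))) ↔
      ∃ (a b c d : F) (ρ : F ≃+* F) (k : F), k = ρ h ∧ a * d - b * c ≠ 0 ∧
        ((c = b ^ q - δ * k ^ (q ^ 2 + 1) * b ^ (q ^ 5) ∧
          a = -(k ^ (q + 1)) * b ^ (q ^ 4) - δ ^ q * b ^ (q ^ 2) ∧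
          d = k ^ ((1 : ℤ) - (q : ℤ)) * b ^ (q ^ 3) + δ * b ^ (q ^ 5) ∧
          b ^ (q ^ 3) + (k ^ (q - 1) + δ * k ^ (q + q ^ 2)) * b ^ (q ^ 5) = 0 ∧
          k ^ (q ^ 2 - q) * b ^ q + (1 + k ^ (q ^ 2 - q)) * b ^ (q ^ 3)
            + δ * k ^ (q ^ 2 - 1) * b ^ (q ^ 5) = 0 ∧
          -δ * b ^ q + (k ^ ((1 : ℤ) - (q : ℤ))
            + δ ^ 2 * k ^ ((1 : ℤ) - (q : ℤ) ^ 2)) * b ^ (q ^ 3) + δ * b ^ (q ^ 5) = 0) ∨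
         (c = δ * b ^ q - k ^ (q ^ 2 + 1) * b ^ (q ^ 5) ∧
          a = -(δ ^ q) * k ^ (q + 1) * b ^ (q ^ 4) - b ^ (q ^ 2) ∧
          d = k ^ ((1 : ℤ) - (q : ℤ)) * b ^ (q ^ 3) + b ^ (q ^ 5) ∧
          δ * b ^ (q ^ 3) + (k ^ (q - 1) - δ * k ^ (q ^ 2 + q)) * b ^ (q ^ 5) = 0 ∧
          δ * k ^ (q ^ 2 - q) * b ^ q + (k ^ (q ^ 2 - q) + 1) * b ^ (q ^ 3)
            + k ^ (q ^ 2 - 1) * b ^ (q ^ 5) = 0 ∧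
          δ ^ 2 * b ^ q + (k ^ ((1 : ℤ) - (q : ℤ))
            + δ ^ 2 * k ^ ((1 : ℤ) - (q : ℤ) ^ 2)) * b ^ (q ^ 3) + b ^ (q ^ 5) = 0)) := by
  obtain ⟨p, s, hp, hs, rfl⟩ := hq
  have hp' : p.Prime := hp.nat_prime
  haveI : Fact p.Prime := ⟨hp'⟩
  haveI : CharP F p := by
    obtain ⟨p', hp1⟩ := CharP.exists F
    obtain ⟨n, hp2, hn⟩ := FiniteField.card F p'
    rw [hF, ← pow_mul] at hn
    have h1 : p ∣ p' ^ (n : ℕ) := by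
      rw [← hn]; exact dvd_pow_self p (by positivity)
    have h2 : p = p' := (Nat.prime_dvd_prime_iff_eq hp' hp2).1 (hp'.dvd_of_dvd_pow h1)
    rw [h2]; exact hp1
  have hadd : ∀ (n : ℕ), ∃ φ : F →+* F, ∀ x, φ x = x ^ ((p ^ s) ^ n) := fun n =>
    ⟨iterateFrobenius F p (s * n), fun x => by rw [iterateFrobenius_def, pow_mul]⟩
  have hq2 : 2 ≤ p ^ s := hp'.two_le.trans (Nat.le_self_pow hs.ne' p)
  generalize p ^ s = q at *
  have hψ : ∀ (n : ℕ), ∃ ψ : F ≃+* F, ∀ x, ψ x = x ^ (q ^ n) := by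
    intro n
    obtain ⟨φ, hφ⟩ := hadd n
    exact ⟨RingEquiv.ofBijective φ (Finite.injective_iff_bijective.1 φ.injective), hφ⟩
  have p6 : ∀ y : F, y ^ (q ^ 6) = y := fun y => by rw [← hF]; exact FiniteField.pow_card y
  have hδ0 : δ ≠ 0 := by
    rintro rfl
    simp at hδ
  have hδ2 : δ ^ (q ^ 2) = δ := by
    obtain ⟨ψ, hψ1⟩ := hψ 1
    have h1 := congrArg ψ hδ
    rw [map_add, map_pow, map_one] at h1
    have h2 : (ψ δ - δ) * (ψ δ + 1 + δ) = 0 := by linear_combination h1 - hδ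
    have h3 : ψ (ψ δ) = δ := by
      rcases mul_eq_zero.1 h2 with h | h
      · rw [sub_eq_zero.1 h, sub_eq_zero.1 h]
      · have h4 : ψ δ = -1 - δ := by linear_combination h
        rw [h4, map_sub, map_neg, map_one, h4]; ring
    rw [hψ1, hψ1, ← pow_mul, ← pow_add] at h3
    exact h3
  have hkρ : ∀ ρ : F ≃+* F, ρ h * ρ h ^ (q ^ 3) = -1 := by
    intro ρ
    rw [← pow_succ', ← map_pow, hh, map_neg, map_one]
  have hfρ : ∀ (ρ : F ≃+* F) x, ρ (fpol q h x) = fpol q (ρ h) (ρ x) := fun ρ x =>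
    aux_map_fpol q (ρ : F →+* F) h x
  have hconv : ∀ (ρ : F ≃+* F) (a b c d v : F),
      (∃ x, x ≠ 0 ∧ c * ρ x + d * ρ (fpol q h x) = v * (a * ρ x + b * ρ (fpol q h x))) ↔
      (∃ z, z ≠ 0 ∧ c * z + d * fpol q (ρ h) z = v * (a * z + b * fpol q (ρ h) z)) := by
    intro ρ a b c d v
    constructor
    · rintro ⟨x, hx, h1⟩
      rw [hfρ] at h1
      exact ⟨ρ x, by simpa using hx, h1⟩
    · rintro ⟨z, hz, h1⟩
      refine ⟨ρ.symm z, by simpa using hz, ?_⟩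
      rw [hfρ, RingEquiv.apply_symm_apply]
      exact h1
  have hfin : ∀ (ρ : F ≃+* F) (a b c d s1 s5 : F), a * d - b * c ≠ 0 →
      AuxId q (ρ h) a b c d s1 s5 →
      (∀ v, (∃ y : F, y ≠ 0 ∧ s1 * y ^ q + y ^ (q ^ 3) + s5 * y ^ (q ^ 5) = v * y) ↔
        (∃ y : F, y ≠ 0 ∧ y ^ q + y ^ (q ^ 3) + δ * y ^ (q ^ 5) = v * y)) →
      IsPGammaLEquiv (linearSet (fpol q h))
        (linearSet (fun x : F => x ^ q + x ^ (q ^ 3) + δ * x ^ (q ^ 5))) := by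
    intro ρ a b c d s1 s5 hdet hid hval
    obtain ⟨hA, hv⟩ := aux_main_bwd hq2 hadd (ρ h) a b c d s1 s5 hdet hid
    refine aux_backward _ _ ρ a b c d hdet ?_ ?_
    · intro x hx
      rw [hfρ]
      exact hA _ (by simpa using hx)
    · intro v
      rw [hconv, hv, hval]
  constructor
  · intro heq
    obtain ⟨ρ, a, b, c, d, hdet, hA, hv⟩ := aux_forward _ _ heq
    have hA' : ∀ z, z ≠ 0 → a * z + b * fpol q (ρ h) z ≠ 0 := by
      intro z hz
      have := hA (ρ.symm z) (by simpa using hz)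
      rwa [hfρ, RingEquiv.apply_symm_apply] at this
    obtain ⟨l, s1, s5, hl, hs15, hid⟩ := aux_main_fwd p hq2 hF hadd δ hδ0 hδ2 (ρ h) a b c d hA'
      (fun v => by rw [← hconv]; exact hv v)
    have hdet' : (l * a) * (l * d) - (l * b) * (l * c) ≠ 0 := by
      have : (l * a) * (l * d) - (l * b) * (l * c) = l * l * (a * d - b * c) := by ring
      rw [this]
      exact mul_ne_zero (mul_ne_zero hl hl) hdet
    rcases hs15 with ⟨rfl, rfl⟩ | ⟨rfl, rfl⟩
    · exact ⟨l * a, l * b, l * c, l * d, ρ, ρ h, rfl, hdet', Or.inl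
        ((aux_sysI hq2 hF hadd (ρ h) (hkρ ρ) _ hδ hδ2 hδ0 _ _ _ _).1 hid)⟩
    · obtain ⟨ψ, hψ1⟩ := hψ 1
      have hid' := aux_transfer q ψ _ _ _ _ _ _ _ hid
      have e : ψ (δ ^ q) = δ := by
        rw [hψ1, pow_one, ← pow_mul, ← pow_two, hδ2]
      rw [e, map_one] at hid'
      refine ⟨ψ (l * a), ψ (l * b), ψ (l * c), ψ (l * d), ρ.trans ψ, (ρ.trans ψ) h, rfl, ?_,
        Or.inr ((aux_sysII hq2 hF hadd _ (hkρ (ρ.trans ψ)) _ hδ hδ2 _ _ _ _).1 hid')⟩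
      rw [← map_mul, ← map_mul, ← map_sub]
      exact (map_ne_zero ψ).2 hdet'
  · rintro ⟨a, b, c, d, ρ, k, rfl, hdet, hsys | hsys⟩
    · have hid := (aux_sysI hq2 hF hadd (ρ h) (hkρ ρ) _ hδ hδ2 hδ0 _ _ _ _).2 hsys
      exact hfin ρ a b c d 1 δ hdet hid (fun v => by simp only [one_mul])
    · have hid := (aux_sysII hq2 hF hadd (ρ h) (hkρ ρ) _ hδ hδ2 _ _ _ _).2 hsys
      obtain ⟨ψ, hψ5⟩ := hψ 5
      have hid' := aux_transfer q ψ _ _ _ _ _ _ _ hid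
      have e : ψ δ = δ ^ q := by
        rw [hψ5]
        calc δ ^ (q ^ 5) = ((δ ^ (q ^ 2)) ^ (q ^ 2)) ^ q := by
              rw [← pow_mul, ← pow_mul]; ring_nf
          _ = δ ^ q := by rw [hδ2, hδ2]
      rw [e, map_one] at hid'
      refine hfin (ρ.trans ψ) (ψ a) (ψ b) (ψ c) (ψ d) (δ ^ q) 1 ?_ hid' ?_
      · rw [← map_mul, ← map_mul, ← map_sub]
        exact (map_ne_zero ψ).2 hdet
      · intro v
        constructor
        · intro hex
          have := aux_adjoint hq2 hF hadd _ _ v hex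
          have e6 : (δ ^ q) ^ (q ^ 5) = δ := by rw [← pow_mul, ← pow_succ', p6]
          simpa only [one_pow, one_mul, e6] using this
        · intro hex
          have := aux_adjoint hq2 hF hadd 1 δ v (by simpa only [one_mul] using hex)
          simpa only [one_pow] using this
end
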